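/- Let μ₁, μ₂ ∈ M¹₊(Ω) be mutually singular positive measures. Then the reduced measure of their sum equals the sum of their reduced measures: (μ₁ + μ₂)* = μ₁* + μ₂*. -/

import Mathlib

open MeasureTheory Set Filter Topology
open scoped ENNReal NNReal

noncomputable section

/-- Euclidean space `ℝ^N`. -/
abbrev Euc (N : ℕ) : Type := EuclideanSpace ℝ (Fin N)

/-- `ρ(x) = dist(x, ∂Ω)`, realized as the distance from `x` to the complement of `Ω`. -/
def rho {N : ℕ} (Ω : Set (Euc N)) (x : Euc N) : ℝ := Metric.infDist x Ωᶜ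

/-- The Laplacian (in the space variable) of `f : ℝ^N → ℝ`. -/
def lap {N : ℕ} (f : Euc N → ℝ) (x : Euc N) : ℝ :=
  ∑ i : Fin N, fderiv ℝ (fun y => fderiv ℝ f y (EuclideanSpace.single i 1)) x
    (EuclideanSpace.single i 1)

/-- The parabolic cylinder `Q_T = Ω × (0,T)`. -/
def QT {N : ℕ} (Ω : Set (Euc N)) (T : ℝ) : Set (Euc N × ℝ) := Ω ×ˢ Ioo 0 T

/-- `∂_t ζ + Δ ζ` for a function `ζ(x,t)` (curried). -/
def heatAdj {N : ℕ} (ζ : Euc N → ℝ → ℝ) (p : Euc N × ℝ) : ℝ :=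
  deriv (ζ p.1) p.2 + lap (fun y => ζ y p.2) p.1

/-- `C^{2,1}` regularity: `ζ`, `∂_t ζ`, `∇_x ζ` and `D²_x ζ` exist and are continuous. -/
def C21 {N : ℕ} (ζ : Euc N → ℝ → ℝ) : Prop :=
  Continuous (fun p : Euc N × ℝ => ζ p.1 p.2) ∧
  (∀ (x : Euc N) (t : ℝ), DifferentiableAt ℝ (ζ x) t) ∧
  Continuous (fun p : Euc N × ℝ => deriv (ζ p.1) p.2) ∧
  (∀ (t : ℝ) (x : Euc N), DifferentiableAt ℝ (fun y => ζ y t) x) ∧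
  Continuous (fun p : Euc N × ℝ => fderiv ℝ (fun y => ζ y p.2) p.1) ∧
  (∀ (t : ℝ) (x : Euc N), DifferentiableAt ℝ (fun y => fderiv ℝ (fun z => ζ z t) y) x) ∧
  Continuous (fun p : Euc N × ℝ => fderiv ℝ (fun y => fderiv ℝ (fun z => ζ z p.2) y) p.1)

/-- Membership in `C^{2,1}_{ℓ,0}(Q̄_T)` : `C^{2,1}` regularity together with
vanishing on `∂Ω × [0,T] ∪ Ω̄ × {T}`. -/
def TestZero {N : ℕ} (Ω : Set (Euc N)) (T : ℝ) (ζ : Euc N → ℝ → ℝ) : Prop :=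
  C21 ζ ∧ (∀ x ∈ frontier Ω, ∀ t ∈ Icc (0:ℝ) T, ζ x t = 0) ∧
  (∀ x ∈ closure Ω, ζ x T = 0)

/-- `g : ℝ → ℝ` continuous, nondecreasing and vanishing on `(-∞,0]`. -/
def GoodG (g : ℝ → ℝ) : Prop := Continuous g ∧ Monotone g ∧ ∀ r : ℝ, r ≤ 0 → g r = 0

/-- `μ ∈ M¹₊(Ω)` : a positive Radon measure on `Ω` with `∫_Ω ρ dμ < ∞`. -/
def MemM1 {N : ℕ} (Ω : Set (Euc N)) (μ : Measure (Euc N)) : Prop :=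
  μ Ωᶜ = 0 ∧ (∀ K : Set (Euc N), K ⊆ Ω → IsCompact K → μ K < ⊤) ∧
  (∫⁻ x, ENNReal.ofReal (rho Ω x) ∂μ) < ⊤

/-- A positive Radon measure on the (open) set `U`. -/
def RadonOn {N : ℕ} (U : Set (Euc N)) (ν : Measure (Euc N)) : Prop :=
  ν Uᶜ = 0 ∧ ∀ K : Set (Euc N), K ⊆ U → IsCompact K → ν K < ⊤

/-- Weak solution of `(P_μ)` : `∂_t u - Δu + g(u) = 0` in `Q_T`, `u = 0` on
`∂Ω × (0,T)`, `u(·,0) = μ`. -/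
def WeakSol {N : ℕ} (Ω : Set (Euc N)) (T : ℝ) (g : ℝ → ℝ) (μ : Measure (Euc N))
    (u : Euc N × ℝ → ℝ) : Prop :=
  IntegrableOn u (QT Ω T) ∧
  IntegrableOn (fun p => g (u p) * rho Ω p.1) (QT Ω T) ∧
  ∀ ζ : Euc N → ℝ → ℝ, TestZero Ω T ζ →
    (∫ p in QT Ω T,
      (-(u p) * deriv (ζ p.1) p.2 - u p * lap (fun y => ζ y p.2) p.1 + ζ p.1 p.2 * g (u p)))
      = ∫ x, ζ x 0 ∂μ

/-- Weak subsolution of `(P_μ)`. -/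
def WeakSubSol {N : ℕ} (Ω : Set (Euc N)) (T : ℝ) (g : ℝ → ℝ) (μ : Measure (Euc N))
    (u : Euc N × ℝ → ℝ) : Prop :=
  IntegrableOn u (QT Ω T) ∧
  IntegrableOn (fun p => g (u p) * rho Ω p.1) (QT Ω T) ∧
  ∀ ζ : Euc N → ℝ → ℝ, TestZero Ω T ζ → (∀ x t, 0 ≤ ζ x t) →
    (∫ p in QT Ω T,
      (-(u p) * deriv (ζ p.1) p.2 - u p * lap (fun y => ζ y p.2) p.1 + ζ p.1 p.2 * g (u p)))
      ≤ ∫ x, ζ x 0 ∂μ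

/-- `μ` is a good measure relative to `g` : `(P_μ)` admits a weak solution. -/
def GoodMeasure {N : ℕ} (Ω : Set (Euc N)) (T : ℝ) (g : ℝ → ℝ) (μ : Measure (Euc N)) : Prop :=
  ∃ u, WeakSol Ω T g μ u

/-- Essential limit of `F(t)` as `t → 0⁺` equals `L`. -/
def EssLimInit (F : ℝ → ℝ) (L : ℝ) : Prop :=
  Tendsto F ((𝓝[>] (0:ℝ)) ⊓ (ae (volume : Measure ℝ))) (𝓝 L)

/-- Essential limit of `F(t)` as `t → 0⁺` is `+∞`. -/
def EssLimInitTop (F : ℝ → ℝ) : Prop :=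
  Tendsto F ((𝓝[>] (0:ℝ)) ⊓ (ae (volume : Measure ℝ))) atTop

/-- `ν` is the initial trace of `u` on `U ⊆ Ω` : for every `φ ∈ C_c(U)`,
`ess lim_{t→0} ∫_Ω u(·,t) φ dx = ∫ φ dν`. -/
def InitTraceOn {N : ℕ} (Ω U : Set (Euc N)) (u : Euc N × ℝ → ℝ) (ν : Measure (Euc N)) : Prop :=
  ∀ φ : Euc N → ℝ, Continuous φ → HasCompactSupport φ → tsupport φ ⊆ U →
    EssLimInit (fun t => ∫ x in Ω, u (x, t) * φ x) (∫ x, φ x ∂ν)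

/-- `μstar` is the reduced measure of `μ` : the largest good measure `≤ μ`. -/
def IsReducedMeasure {N : ℕ} (Ω : Set (Euc N)) (T : ℝ) (g : ℝ → ℝ)
    (μ μstar : Measure (Euc N)) : Prop :=
  MemM1 Ω μstar ∧ μstar ≤ μ ∧ GoodMeasure Ω T g μstar ∧
  ∀ ν : Measure (Euc N), MemM1 Ω ν → GoodMeasure Ω T g ν → ν ≤ μ → ν ≤ μstar

/-- The `N`-dimensional Hausdorff measure on `ℝ^N`. -/
def hausN {N : ℕ} : Measure (Euc N) := MeasureTheory.Measure.hausdorffMeasure (N : ℝ)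




/-- uncurried to curried -/
def cur {N : ℕ} (f : Euc N × ℝ → ℝ) : Euc N → ℝ → ℝ := fun x t => f (x, t)

abbrev ee {N : ℕ} (i : Fin N) : Euc N := EuclideanSpace.single i 1

theorem C21.cont {N : ℕ} {ζ : Euc N → ℝ → ℝ} (h : C21 ζ) :
    Continuous (fun p : Euc N × ℝ => ζ p.1 p.2) := h.1

theorem C21.hasFDerivAt {N : ℕ} {ζ : Euc N → ℝ → ℝ} (h : C21 ζ) (p : Euc N × ℝ) :
    HasFDerivAt (fun q : Euc N × ℝ => ζ q.1 q.2)
      ((fderiv ℝ (fun y => ζ y p.2) p.1).coprod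
        (ContinuousLinearMap.toSpanSingleton ℝ (deriv (ζ p.1) p.2))) p := by
  have := hasStrictFDerivAt_uncurry_coprod (𝕜 := ℝ) (u := p) (f := ζ)
    (f₁ := fun x t => fderiv ℝ (fun y => ζ y t) x)
    (f₂ := fun x t => ContinuousLinearMap.toSpanSingleton ℝ (deriv (ζ x) t))
    (Eventually.of_forall fun v => (h.2.2.2.1 v.2 v.1).hasFDerivAt)
    (Eventually.of_forall fun v => (h.2.1 v.1 v.2).hasDerivAt.hasFDerivAt)
    h.2.2.2.2.1.continuousAt
    (by
      have : Continuous (fun p : Euc N × ℝ => ContinuousLinearMap.toSpanSingleton ℝ (deriv (ζ p.1) p.2)) :=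
        (ContinuousLinearMap.toSpanSingletonCLE (𝕜 := ℝ) (E := ℝ)).continuous.comp h.2.2.1
      exact this.continuousAt)
  exact this.hasFDerivAt

theorem C21.lap_eq {N : ℕ} {ζ : Euc N → ℝ → ℝ} (h : C21 ζ) (x : Euc N) (t : ℝ) :
    lap (fun y => ζ y t) x
      = ∑ i : Fin N, (fderiv ℝ (fun y => fderiv ℝ (fun z => ζ z t) y) x (ee i)) (ee i) := by
  unfold lap
  refine Finset.sum_congr rfl fun i _ => ?_
  have h1 := (h.2.2.2.2.2.1 t x).hasFDerivAt
  have h2 := h1.clm_apply (hasFDerivAt_const (ee i) x)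
  rw [h2.fderiv]
  simp

theorem C21.heatAdj_cont {N : ℕ} {ζ : Euc N → ℝ → ℝ} (h : C21 ζ) :
    Continuous (heatAdj ζ) := by
  unfold heatAdj
  refine h.2.2.1.add ?_
  have : (fun p : Euc N × ℝ => lap (fun y => ζ y p.2) p.1) = fun p : Euc N × ℝ =>
     ∑ i : Fin N, (fderiv ℝ (fun y => fderiv ℝ (fun z => ζ z p.2) y) p.1 (ee i)) (ee i) := by
    ext p; exact h.lap_eq _ _
  rw [this]
  refine continuous_finsetSum _ fun i _ => ?_
  exact (h.2.2.2.2.2.2.clm_apply continuous_const).clm_apply continuous_const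

theorem C21.mul {N : ℕ} {ζ η : Euc N → ℝ → ℝ} (h : C21 ζ) (k : C21 η) :
    C21 (fun x t => ζ x t * η x t) := by
  obtain ⟨a1, a2, a3, a4, a5, a6, a7⟩ := h
  obtain ⟨b1, b2, b3, b4, b5, b6, b7⟩ := k
  have e1 : ∀ (t : ℝ) (x : Euc N), fderiv ℝ (fun y => ζ y t * η y t) x =
      ζ x t • fderiv ℝ (fun y => η y t) x + η x t • fderiv ℝ (fun y => ζ y t) x := by
    intro t x
    exact fderiv_fun_mul (a4 t x) (b4 t x)
  have e2 : ∀ (t : ℝ) (x : Euc N), HasFDerivAt (fun y => fderiv ℝ (fun y => ζ y t * η y t) y)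
     ((ζ x t • fderiv ℝ (fun y => fderiv ℝ (fun z => η z t) y) x +
        (fderiv ℝ (fun y => ζ y t) x).smulRight (fderiv ℝ (fun y => η y t) x)) +
      (η x t • fderiv ℝ (fun y => fderiv ℝ (fun z => ζ z t) y) x +
        (fderiv ℝ (fun y => η y t) x).smulRight (fderiv ℝ (fun y => ζ y t) x))) x := by
    intro t x
    have : (fun y => fderiv ℝ (fun y => ζ y t * η y t) y) = fun y =>
      ζ y t • fderiv ℝ (fun y => η y t) y + η y t • fderiv ℝ (fun y => ζ y t) y := by
        ext1 y; exact e1 t y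
    rw [this]
    exact ((a4 t x).hasFDerivAt.smul (b6 t x).hasFDerivAt).add
      ((b4 t x).hasFDerivAt.smul (a6 t x).hasFDerivAt)
  refine ⟨a1.mul b1, fun x t => (a2 x t).mul (b2 x t), ?_, fun t x => (a4 t x).mul (b4 t x), ?_,
    fun t x => (e2 t x).differentiableAt, ?_⟩
  · have : (fun p : Euc N × ℝ => deriv (fun t => ζ p.1 t * η p.1 t) p.2) =
      fun p : Euc N × ℝ => deriv (ζ p.1) p.2 * η p.1 p.2 + ζ p.1 p.2 * deriv (η p.1) p.2 := by
      ext p; exact deriv_fun_mul (a2 _ _) (b2 _ _)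
    rw [this]; exact (a3.mul b1).add (a1.mul b3)
  · simp_rw [e1]
    exact (a1.smul b5).add (b1.smul a5)
  · have : (fun p : Euc N × ℝ => fderiv ℝ (fun y => fderiv ℝ (fun z => ζ z p.2 * η z p.2) y) p.1) = _ :=
      funext fun p => (e2 p.2 p.1).fderiv
    rw [this]
    have c : Continuous (fun q : (Euc N →L[ℝ] ℝ) × (Euc N →L[ℝ] ℝ) => q.1.smulRight q.2) := by
      exact (ContinuousLinearMap.smulRightL ℝ (Euc N) (Euc N →L[ℝ] ℝ)).continuous₂
    exact ((a1.smul b7).add (c.comp (a5.prodMk b5))).add ((b1.smul a7).add (c.comp (b5.prodMk a5)))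

theorem fderiv_slice {N : ℕ} {f : Euc N × ℝ → ℝ} (hf : ContDiff ℝ 3 f) (t : ℝ) (x : Euc N) :
    HasFDerivAt (fun y => f (y, t)) ((fderiv ℝ f (x, t)).comp (ContinuousLinearMap.inl ℝ (Euc N) ℝ)) x := by
  have h1 : HasFDerivAt f (fderiv ℝ f (x,t)) (x,t) :=
    (hf.differentiable (by norm_num) (x,t)).hasFDerivAt
  exact HasFDerivAt.comp x h1 (hasFDerivAt_prodMk_left x t)

theorem deriv_slice {N : ℕ} {f : Euc N × ℝ → ℝ} (hf : ContDiff ℝ 3 f) (t : ℝ) (x : Euc N) :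
    HasDerivAt (fun s => f (x, s)) (fderiv ℝ f (x, t) (0, 1)) t := by
  have h1 : HasFDerivAt f (fderiv ℝ f (x,t)) (x,t) :=
    (hf.differentiable (by norm_num) (x,t)).hasFDerivAt
  have := HasFDerivAt.comp t h1 (hasFDerivAt_prodMk_right x t)
  simpa using! this.hasDerivAt

theorem fderiv_slice2 {N : ℕ} {f : Euc N × ℝ → ℝ} (hf : ContDiff ℝ 3 f) (t : ℝ) (x : Euc N) :
    HasFDerivAt (fun y => fderiv ℝ (fun z => f (z, t)) y)
      ((((ContinuousLinearMap.compL ℝ (Euc N) (Euc N × ℝ) ℝ).flip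
        (ContinuousLinearMap.inl ℝ (Euc N) ℝ)).comp (fderiv ℝ (fderiv ℝ f) (x, t))).comp
          (ContinuousLinearMap.inl ℝ (Euc N) ℝ)) x := by
  have e : (fun y => fderiv ℝ (fun z => f (z, t)) y) = fun y =>
      ((ContinuousLinearMap.compL ℝ (Euc N) (Euc N × ℝ) ℝ).flip
        (ContinuousLinearMap.inl ℝ (Euc N) ℝ)) (fderiv ℝ f (y, t)) := by
    ext1 y; rw [(fderiv_slice hf t y).fderiv]; rfl
  rw [e]
  have h1 : HasFDerivAt (fderiv ℝ f) (fderiv ℝ (fderiv ℝ f) (x,t)) (x,t) := by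
    have : ContDiff ℝ 2 (fderiv ℝ f) := hf.fderiv_right (by norm_num)
    exact (this.differentiable (by norm_num) (x,t)).hasFDerivAt
  have h2 := HasFDerivAt.comp (f := fun y : Euc N => (y, t)) (g := fderiv ℝ f) x h1 (hasFDerivAt_prodMk_left x t)
  exact (ContinuousLinearMap.hasFDerivAt _).comp x h2

theorem C21_of_contDiff {N : ℕ} {f : Euc N × ℝ → ℝ} (hf : ContDiff ℝ 3 f) : C21 (cur f) := by
  have h1 : ContDiff ℝ 2 (fderiv ℝ f) := hf.fderiv_right (by norm_num)
  have h2 : ContDiff ℝ 1 (fderiv ℝ (fderiv ℝ f)) := h1.fderiv_right (by norm_num)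
  refine ⟨hf.continuous, fun x t => (deriv_slice hf t x).differentiableAt, ?_,
    fun t x => (fderiv_slice hf t x).differentiableAt, ?_,
    fun t x => (fderiv_slice2 hf t x).differentiableAt, ?_⟩
  · have : (fun p : Euc N × ℝ => deriv (cur f p.1) p.2) = fun p => fderiv ℝ f p (0,1) := by
      ext p; exact (deriv_slice hf p.2 p.1).deriv
    rw [this]; exact h1.continuous.clm_apply continuous_const
  · have : (fun p : Euc N × ℝ => fderiv ℝ (fun y => cur f y p.2) p.1) = fun p =>
       (fderiv ℝ f p).comp (ContinuousLinearMap.inl ℝ (Euc N) ℝ) := by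
      ext1 p; exact (fderiv_slice hf p.2 p.1).fderiv
    rw [this]; exact h1.continuous.clm_comp continuous_const
  · have : (fun p : Euc N × ℝ => fderiv ℝ (fun y => fderiv ℝ (fun z => cur f z p.2) y) p.1) = _ :=
      funext fun p => (fderiv_slice2 hf p.2 p.1).fderiv
    rw [this]
    exact (continuous_const.clm_comp h2.continuous).clm_comp continuous_const

theorem heatAdj_smooth {N : ℕ} {f : Euc N × ℝ → ℝ} (hf : ContDiff ℝ 3 f) (p : Euc N × ℝ) :
    heatAdj (cur f) p = fderiv ℝ f p (0, 1) +
      ∑ i : Fin N, fderiv ℝ (fun q => fderiv ℝ f q (ee i, 0)) p (ee i, 0) := by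
  unfold heatAdj
  congr 1
  · exact (deriv_slice hf p.2 p.1).deriv
  · have := (C21_of_contDiff hf).lap_eq p.1 p.2
    rw [this]
    refine Finset.sum_congr rfl fun i _ => ?_
    have e := (fderiv_slice2 hf p.2 p.1).fderiv
    have h1 : HasFDerivAt (fderiv ℝ f) (fderiv ℝ (fderiv ℝ f) p) p := by
      have : ContDiff ℝ 2 (fderiv ℝ f) := hf.fderiv_right (by norm_num)
      exact (this.differentiable (by norm_num) p).hasFDerivAt
    have h2 := (h1.clm_apply (hasFDerivAt_const ((ee i, 0) : Euc N × ℝ) p)).fderiv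
    rw [h2]
    change (fderiv ℝ (fun y => fderiv ℝ (fun z => f (z, p.2)) y) p.1 (ee i)) (ee i) = _
    rw [e]
    simp

/-- heatAdj is local -/
theorem heatAdj_congr {N : ℕ} {ζ η : Euc N → ℝ → ℝ} {p : Euc N × ℝ}
    (h : ∀ᶠ q : Euc N × ℝ in 𝓝 p, ζ q.1 q.2 = η q.1 q.2) : heatAdj ζ p = heatAdj η p := by
  unfold heatAdj
  have ht : ∀ᶠ s in 𝓝 p.2, ζ p.1 s = η p.1 s := by
    have : Tendsto (fun s : ℝ => (p.1, s)) (𝓝 p.2) (𝓝 p) :=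
      (Continuous.prodMk_right p.1).tendsto p.2
    exact this.eventually h
  have hx : ∀ᶠ y in 𝓝 p.1, ζ y p.2 = η y p.2 := by
    have : Tendsto (fun y : Euc N => (y, p.2)) (𝓝 p.1) (𝓝 p) :=
      (Continuous.prodMk_left p.2).tendsto p.1
    exact this.eventually h
  rw [Filter.EventuallyEq.deriv_eq ht]
  congr 1
  unfold lap
  refine Finset.sum_congr rfl fun i _ => ?_
  have : (fun y => fderiv ℝ (fun y => ζ y p.2) y (EuclideanSpace.single i 1)) =ᶠ[𝓝 p.1]
      (fun y => fderiv ℝ (fun y => η y p.2) y (EuclideanSpace.single i 1)) := by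
    filter_upwards [Filter.EventuallyEq.fderiv (𝕜 := ℝ) hx] with y hy
    rw [hy]
  rw [this.fderiv_eq]

theorem heatAdj_zero_of {N : ℕ} {ζ : Euc N → ℝ → ℝ} {p : Euc N × ℝ}
    (h : p ∉ tsupport (fun q : Euc N × ℝ => ζ q.1 q.2)) : heatAdj ζ p = 0 := by
  have : heatAdj ζ p = heatAdj (fun _ _ => (0:ℝ)) p := by
    apply heatAdj_congr
    rw [notMem_tsupport_iff_eventuallyEq] at h
    exact h
  rw [this]; simp [heatAdj, lap]




/-- normalizing constant -/
def gc (N : ℕ) : ℝ := (∫ z : Euc N, Real.exp (-(1/2) * ‖z‖ ^ 2))⁻¹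

/-- Gaussian -/
def gk {N : ℕ} (z : Euc N) : ℝ := gc N * Real.exp (-(1/2) * ‖z‖ ^ 2)

theorem exp_integrable {N : ℕ} {b : ℝ} (hb : 0 < b) :
    Integrable (fun z : Euc N => Real.exp (-b * ‖z‖ ^ 2)) := by
  have := GaussianFourier.integrable_cexp_neg_mul_sq_norm_add (V := Euc N) (b := (b:ℂ)) (by simpa using hb) 0 0
  have h2 := this.re
  refine h2.congr (Eventually.of_forall fun z => ?_)
  simp only [inner_zero_left, Complex.ofReal_zero, mul_zero, add_zero]
  have : (-(b:ℂ) * (‖z‖:ℂ)^2) = ((-b * ‖z‖^2 : ℝ) : ℂ) := by push_cast; ring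
  rw [this]
  exact Complex.exp_ofReal_re _

theorem exp_integral_pos {N : ℕ} {b : ℝ} (hb : 0 < b) :
    0 < ∫ z : Euc N, Real.exp (-b * ‖z‖ ^ 2) := by
  rw [GaussianFourier.integral_rexp_neg_mul_sq_norm hb]
  positivity

theorem gc_pos (N : ℕ) : 0 < gc N := inv_pos.mpr (exp_integral_pos (by norm_num))

theorem gk_nonneg {N : ℕ} (z : Euc N) : 0 ≤ gk z :=
  mul_nonneg (gc_pos N).le (Real.exp_nonneg _)

theorem gk_cont {N : ℕ} : Continuous (gk (N := N)) := by unfold gk; fun_prop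

theorem gk_integrable {N : ℕ} : Integrable (gk (N := N)) :=
  (exp_integrable (by norm_num)).const_mul _

theorem gk_integral {N : ℕ} : ∫ z : Euc N, gk z = 1 := by
  unfold gk
  rw [integral_const_mul]
  exact inv_mul_cancel₀ (exp_integral_pos (by norm_num)).ne'

theorem norm_gk_integrable {N : ℕ} : Integrable (fun z : Euc N => ‖z‖ * gk z) := by
  refine Integrable.mono' ((exp_integrable (N := N) (b := 1/4) (by norm_num)).const_mul (gc N))
    (by have := gk_cont (N := N); fun_prop) (Eventually.of_forall fun z => ?_)
  have h1 : ‖z‖ ≤ Real.exp (1/4 * ‖z‖^2) := by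
    have := Real.add_one_le_exp (1/4 * ‖z‖^2)
    nlinarith [sq_nonneg (‖z‖/2 - 1)]
  rw [Real.norm_of_nonneg (mul_nonneg (norm_nonneg _) (gk_nonneg _))]
  unfold gk
  calc ‖z‖ * (gc N * Real.exp (-(1/2) * ‖z‖ ^ 2))
      ≤ Real.exp (1/4 * ‖z‖^2) * (gc N * Real.exp (-(1/2) * ‖z‖ ^ 2)) := by
        gcongr; exact gk_nonneg z
    _ = gc N * Real.exp (-(1/4) * ‖z‖ ^ 2) := by
        rw [mul_left_comm, ← Real.exp_add]; ring_nf

/-- heat kernel -/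
def HK {N : ℕ} (p : Euc N × ℝ) : ℝ :=
  if 0 < p.2 then (√(2 * p.2) ^ N)⁻¹ * gk ((√(2 * p.2))⁻¹ • p.1) else 0

theorem HK_nonneg {N : ℕ} (p : Euc N × ℝ) : 0 ≤ HK p := by
  unfold HK
  split_ifs
  · have := gk_nonneg ((√(2 * p.2))⁻¹ • p.1); positivity
  · exact le_rfl

theorem HK_meas {N : ℕ} : Measurable (HK (N := N)) := by
  unfold HK
  refine Measurable.ite (measurableSet_lt measurable_const measurable_snd) ?_ measurable_const
  have := gk_cont (N := N).measurable
  fun_prop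

theorem HK_neg {N : ℕ} {p : Euc N × ℝ} (h : p.2 ≤ 0) : HK p = 0 := by
  unfold HK; rw [if_neg (by linarith)]

theorem HK_slice {N : ℕ} {t : ℝ} (ht : 0 < t) :
    Integrable (fun x : Euc N => HK (x, t)) ∧ ∫ x : Euc N, HK (x, t) = 1 := by
  have hr : 0 < √(2 * t) := Real.sqrt_pos.mpr (by linarith)
  have e : (fun x : Euc N => HK (x, t)) = fun x : Euc N => (√(2 * t) ^ N)⁻¹ * gk ((√(2 * t))⁻¹ • x) := by
    ext x; simp [HK, ht]
  rw [e]
  constructor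
  · exact ((integrable_comp_smul_iff volume gk (inv_pos.mpr hr).ne').mpr gk_integrable).const_mul _
  · rw [integral_const_mul, Measure.integral_comp_inv_smul, gk_integral]
    simp only [finrank_euclideanSpace, Fintype.card_fin, smul_eq_mul, mul_one]
    rw [abs_of_pos (by positivity)]
    exact inv_mul_cancel₀ (by positivity)

/-- weighted heat kernel -/
def HKl {N : ℕ} (l : ℝ) (p : Euc N × ℝ) : ℝ := Real.exp (-l * p.2) * HK p

theorem HKl_nonneg {N : ℕ} (l : ℝ) (p : Euc N × ℝ) : 0 ≤ HKl l p :=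
  mul_nonneg (Real.exp_nonneg _) (HK_nonneg _)

theorem HKl_meas {N : ℕ} (l : ℝ) : Measurable (HKl (N := N) l) := by
  have := HK_meas (N := N)
  unfold HKl; fun_prop

theorem HKl_slice {N : ℕ} (l t : ℝ) :
    Integrable (fun x : Euc N => HKl l (x, t)) ∧
    ∫ x : Euc N, HKl l (x, t) = (Ioi (0:ℝ)).indicator (fun t => Real.exp (-l * t)) t := by
  by_cases ht : 0 < t
  · unfold HKl
    simp only
    rw [integral_const_mul, (HK_slice ht).2]
    exact ⟨(HK_slice ht).1.const_mul _, by simp [ht]⟩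
  · have : (fun x : Euc N => HKl l (x, t)) = fun _ => 0 := by
      ext x; simp [HKl, HK, ht]
    rw [this]; simp [ht]

theorem HKl_integrable {N : ℕ} {l : ℝ} (hl : 0 < l) :
    Integrable (HKl (N := N) l) ∧ ∫ p, HKl (N := N) l p = l⁻¹ := by
  have h2 : Integrable (fun t => (Ioi (0:ℝ)).indicator (fun t => Real.exp (-l * t)) t) := by
    rw [integrable_indicator_iff measurableSet_Ioi]
    exact integrableOn_exp_mul_Ioi (by linarith) 0
  have h1 : Integrable (HKl (N := N) l) := by
    rw [Measure.volume_eq_prod, integrable_prod_iff' (HKl_meas l).aestronglyMeasurable]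
    refine ⟨Eventually.of_forall fun t => (HKl_slice l t).1, ?_⟩
    refine h2.congr (Eventually.of_forall fun t => ?_)
    simp only [Real.norm_of_nonneg (HKl_nonneg l _)]
    rw [(HKl_slice l t).2]
  refine ⟨h1, ?_⟩
  rw [Measure.volume_eq_prod] at h1 ⊢
  rw [integral_prod_symm _ h1]
  simp only [(HKl_slice l _).2]
  rw [integral_indicator measurableSet_Ioi, integral_exp_mul_Ioi (by linarith)]
  simp [neg_div_neg_eq]

/-- off-diagonal bound -/
theorem HK_bound {N : ℕ} {r δ : ℝ} (hr : 0 < r) (hδ : 0 < δ) :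
    ∃ C : ℝ, 0 ≤ C ∧ ∀ p : Euc N × ℝ, (r ≤ ‖p.1‖ ∨ δ ≤ p.2) → HK p ≤ C := by
  have key : ∀ d : ℝ, 0 < d → ∀ p : Euc N × ℝ, d ≤ p.2 → HK p ≤ (√(2 * d) ^ N)⁻¹ * gc N := by
    intro d hd p hp
    have : 0 < p.2 := by linarith
    unfold HK gk
    rw [if_pos this]
    have h1 : Real.exp (-(1/2) * ‖(√(2 * p.2))⁻¹ • p.1‖ ^ 2) ≤ 1 := by
      apply Real.exp_le_one_iff.mpr
      nlinarith [sq_nonneg ‖(√(2 * p.2))⁻¹ • p.1‖]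
    have h2 : √(2 * d) ≤ √(2 * p.2) := Real.sqrt_le_sqrt (by linarith)
    have h3 : 0 < √(2 * d) := Real.sqrt_pos.mpr (by linarith)
    have hg := gc_pos N
    gcongr
    nlinarith
  refine ⟨max ((√(2 * δ) ^ N)⁻¹ * gc N) (max ((√(2 * 1) ^ N)⁻¹ * gc N)
    (gc N * (N.factorial * (2 / r^2)^N * √2 ^ N))), ?_, ?_⟩
  · have hg := gc_pos N
    exact le_max_of_le_left (by positivity)
  rintro p (h | h)
  · by_cases h1 : 1 ≤ p.2
    · exact le_max_of_le_right (le_max_of_le_left (key 1 one_pos p h1))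
    by_cases h0 : 0 < p.2
    · refine le_max_of_le_right (le_max_of_le_right ?_)
      unfold HK gk
      rw [if_pos h0]
      set s := √(2 * p.2) with hs
      have hs0 : 0 < s := Real.sqrt_pos.mpr (by linarith)
      have hs2 : s ≤ √2 := Real.sqrt_le_sqrt (by linarith)
      have hg := gc_pos N
      set a := (1/2) * ‖s⁻¹ • p.1‖ ^ 2 with ha
      have ha1 : r^2 / (2 * s^2) ≤ a := by
        rw [ha, norm_smul, Real.norm_of_nonneg (inv_nonneg.mpr hs0.le), mul_pow]
        have : r^2 ≤ ‖p.1‖^2 := by gcongr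
        calc r^2 / (2 * s^2) = (1/2) * ((s⁻¹)^2 * r^2) := by field_simp
          _ ≤ _ := by gcongr
      have ha0 : 0 < a := lt_of_lt_of_le (by positivity) ha1
      have h3 := Real.pow_div_factorial_le_exp a ha0.le N
      have h4 : Real.exp (-a) ≤ N.factorial / a^N := by
        rw [Real.exp_neg, inv_le_comm₀ (Real.exp_pos _) (by positivity), inv_div]; exact h3
      have h5 : (N.factorial : ℝ) / a^N ≤ N.factorial * ((2 * s^2) / r^2)^N := by
        rw [div_eq_mul_inv, ← inv_pow]
        gcongr
        rw [inv_le_comm₀ ha0 (by positivity), inv_div]; exact ha1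
      have h6 : -(1/2) * ‖s⁻¹ • p.1‖ ^ 2 = -a := by rw [ha]; ring
      rw [h6]
      calc (s^N)⁻¹ * (gc N * Real.exp (-a)) ≤ (s^N)⁻¹ * (gc N * (N.factorial * ((2 * s^2) / r^2)^N)) := by
            gcongr; exact h4.trans h5
        _ = gc N * (N.factorial * (2 / r^2)^N * s^N) := by
            have : (2 * s^2) / r^2 = (2 / r^2) * (s * s) := by ring
            rw [this, mul_pow, mul_pow]
            field_simp
        _ ≤ _ := by gcongr
    · have hg := gc_pos N
      rw [HK_neg (by linarith)]
      exact le_max_of_le_right (le_max_of_le_left (by positivity))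
  · exact le_max_of_le_left (key δ hδ p h)




/-- Gaussian integration by parts -/
theorem gauss_ibp {N : ℕ} {ψ : Euc N → ℝ} {ψ' : Euc N → Euc N →L[ℝ] ℝ} (h : ∀ x, HasFDerivAt ψ (ψ' x) x)
    (hc : Continuous ψ') {C : ℝ} (hb : ∀ x, ‖ψ x‖ ≤ C) (hb' : ∀ x, ‖ψ' x‖ ≤ C) (i : Fin N) :
    ∫ z, gk z * (z i * ψ z) = ∫ z, gk z * ψ' z (ee i) := by
  have hψ : Continuous ψ := continuous_iff_continuousAt.mpr fun x => (h x).continuousAt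
  have hd : ∀ z : Euc N, HasFDerivAt gk (-gk z • (innerSL ℝ z)) z := by
    intro z
    have h1 := ((hasFDerivAt_id z).norm_sq.const_mul (-(1/2:ℝ))).exp.const_mul (gc N)
    refine h1.congr_fderiv ?_
    ext v
    simp [gk]; ring
  have hi : ∀ z : Euc N, inner ℝ z (ee i) = z i := by
    intro z; simp [EuclideanSpace.inner_single_right]
  have hf : ∀ z : Euc N, fderiv ℝ gk z (ee i) = - (gk z * z i) := by
    intro z; rw [(hd z).fderiv]; simp; exact Or.inl (hi z)
  have hgk := gk_cont (N := N)
  have i1 : Integrable (fun z : Euc N => gk z * (z i * ψ z)) := by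
    refine (norm_gk_integrable.mul_const C).mono' (by fun_prop) (Eventually.of_forall fun z => ?_)
    rw [norm_mul, norm_mul, Real.norm_of_nonneg (gk_nonneg z)]
    have := EuclideanSpace.norm_eq z
    have h2 : ‖z i‖ ≤ ‖z‖ := PiLp.norm_apply_le z i
    calc gk z * (‖z i‖ * ‖ψ z‖) ≤ gk z * (‖z‖ * C) := by
          gcongr
          · exact gk_nonneg z
          · exact hb z
      _ = _ := by ring
  have i2 : Integrable (fun z : Euc N => gk z * ψ' z (ee i)) := by
    refine (gk_integrable.mul_const C).mono' (by fun_prop) (Eventually.of_forall fun z => ?_)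
    rw [norm_mul, Real.norm_of_nonneg (gk_nonneg z)]
    have : ‖ψ' z (ee i)‖ ≤ C := by
      refine ((ψ' z).le_opNorm _).trans ?_
      simpa using hb' z
    have := gk_nonneg z
    gcongr
  have i3 : Integrable (fun z : Euc N => gk z * ψ z) := by
    refine (gk_integrable.mul_const C).mono' (by fun_prop) (Eventually.of_forall fun z => ?_)
    rw [norm_mul, Real.norm_of_nonneg (gk_nonneg z)]
    have := gk_nonneg z
    have := hb z
    gcongr
  have := integral_mul_fderiv_eq_neg_fderiv_mul_of_integrable (μ := (volume : Measure (Euc N)))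
    (f := gk) (g := ψ) (v := ee i)
    (by simp only [hf]; exact i1.neg.congr (Eventually.of_forall fun z => by simp; ring))
    (by simp only [(h _).fderiv]; exact i2) i3
    (fun x _ => (hd x).differentiableAt) (fun x _ => (h x).differentiableAt)
  simp only [(h _).fderiv, hf] at this
  rw [this, ← integral_neg]
  congr 1; ext z; ring

theorem compact_time_bound {N : ℕ} {f : Euc N × ℝ → ℝ} (hc : HasCompactSupport f) :
    ∃ R > 0, ∀ p, R ≤ |p.2| → p ∉ tsupport f := by
  obtain ⟨R, hR⟩ := hc.isCompact.isBounded.exists_norm_le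
  refine ⟨|R| + 1, by positivity, fun p hp hm => ?_⟩
  have := hR p hm
  have h2 : |p.2| ≤ ‖p‖ := norm_snd_le p
  linarith [le_abs_self R]

theorem C21.deriv_zero {N : ℕ} {ζ : Euc N → ℝ → ℝ} (h : C21 ζ) {p : Euc N × ℝ}
    (hp : p ∉ tsupport (fun q : Euc N × ℝ => ζ q.1 q.2)) :
    deriv (ζ p.1) p.2 = 0 ∧ fderiv ℝ (fun y => ζ y p.2) p.1 = 0 ∧
      fderiv ℝ (fun y => fderiv ℝ (fun z => ζ z p.2) y) p.1 = 0 := by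
  rw [notMem_tsupport_iff_eventuallyEq] at hp
  have ht : ∀ᶠ s in 𝓝 p.2, ζ p.1 s = (fun _ => (0:ℝ)) s := by
    have : Tendsto (fun s : ℝ => (p.1, s)) (𝓝 p.2) (𝓝 p) :=
      (Continuous.prodMk_right p.1).tendsto p.2
    exact this.eventually hp
  have hx : ∀ᶠ y in 𝓝 p.1, ζ y p.2 = (fun _ => (0:ℝ)) y := by
    have : Tendsto (fun y : Euc N => (y, p.2)) (𝓝 p.1) (𝓝 p) :=
      (Continuous.prodMk_left p.2).tendsto p.1
    exact this.eventually hp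
  refine ⟨?_, ?_, ?_⟩
  · rw [Filter.EventuallyEq.deriv_eq ht]; simp
  · rw [Filter.EventuallyEq.fderiv_eq (𝕜 := ℝ) hx]; simp
  · rw [Filter.EventuallyEq.fderiv_eq (𝕜 := ℝ) (Filter.EventuallyEq.fderiv (𝕜 := ℝ) hx)]; simp

theorem bound_of_support {N : ℕ} {F : Type*} [NormedAddCommGroup F] {f : Euc N × ℝ → ℝ} (hc : HasCompactSupport f)
    {h : Euc N × ℝ → F} (hh : Continuous h) (hz : ∀ p, p ∉ tsupport f → h p = 0) :
    ∃ C, ∀ p, ‖h p‖ ≤ C := by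
  have : HasCompactSupport h := HasCompactSupport.intro hc.isCompact hz
  exact this.exists_bound_of_continuous hh

theorem heatAdj_compact {N : ℕ} {ζ : Euc N → ℝ → ℝ}
    (hc : HasCompactSupport (fun q : Euc N × ℝ => ζ q.1 q.2)) : HasCompactSupport (heatAdj ζ) :=
  HasCompactSupport.intro hc.isCompact fun _ hp => heatAdj_zero_of hp

/-- slice of key identity -/
theorem key_slice {N : ℕ} {ζ : Euc N → ℝ → ℝ} (h : C21 ζ)
    (hc : HasCompactSupport (fun q : Euc N × ℝ => ζ q.1 q.2)) (y : Euc N) (τ r : ℝ) :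
    ∫ z, gk z * (fderiv ℝ (fun x => ζ x τ) (y + r • z) z) =
      ∫ z, gk z * (r * lap (fun x => ζ x τ) (y + r • z)) := by
  obtain ⟨C1, h1⟩ := bound_of_support hc h.2.2.2.2.1 fun p hp => (h.deriv_zero hp).2.1
  obtain ⟨C2, h2⟩ := bound_of_support (F := Euc N →L[ℝ] Euc N →L[ℝ] ℝ) hc h.2.2.2.2.2.2 fun p hp => (h.deriv_zero hp).2.2
  have hC1 : 0 ≤ C1 := (norm_nonneg _).trans (h1 (0,0))
  have hC2 : 0 ≤ C2 := le_trans (by positivity) (h2 (0,0))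
  set D : Euc N → Euc N →L[ℝ] ℝ := fun x => fderiv ℝ (fun x => ζ x τ) x with hD
  set DD : Euc N → Euc N →L[ℝ] Euc N →L[ℝ] ℝ := fun x => fderiv ℝ (fun y => fderiv ℝ (fun z => ζ z τ) y) x with hDD
  have hDc : Continuous D := h.2.2.2.2.1.comp (Continuous.prodMk_left τ)
  have hDDc : Continuous DD := h.2.2.2.2.2.2.comp (Continuous.prodMk_left τ)
  have hDb : ∀ x, ‖D x‖ ≤ C1 := fun x => h1 (x, τ)
  have hDDb : ∀ x, ‖DD x‖ ≤ C2 := fun x => h2 (x, τ)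
  have hDd : ∀ x, HasFDerivAt D (DD x) x := fun x => (h.2.2.2.2.2.1 τ x).hasFDerivAt
  have ibp : ∀ i : Fin N, ∫ z, gk z * (z i * D (y + r • z) (ee i)) =
      ∫ z, gk z * (r * DD (y + r • z) (ee i) (ee i)) := by
    intro i
    have hd : ∀ z : Euc N, HasFDerivAt (fun z : Euc N => D (y + r • z) (ee i))
        (r • ((ContinuousLinearMap.apply ℝ ℝ (ee i)).comp (DD (y + r • z)))) z := by
      intro z
      have e1 : HasFDerivAt (fun z : Euc N => y + r • z) (r • ContinuousLinearMap.id ℝ (Euc N)) z :=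
        ((hasFDerivAt_id z).const_smul r).const_add y
      have e2 := (hDd (y + r • z)).comp z e1
      have e3 := e2.clm_apply (hasFDerivAt_const (ee i) z)
      refine e3.congr_fderiv ?_
      ext v; simp
    have := gauss_ibp (C := max C1 (‖r‖ * C2)) hd (by
        refine Continuous.const_smul ?_ r
        exact continuous_const.clm_comp (hDDc.comp (by fun_prop)))
      (fun z => le_max_of_le_left (((D _).le_opNorm _).trans (by simpa using hDb _)))
      (fun z => le_max_of_le_right ?_) i
    · rw [this]; congr 1
    · rw [norm_smul]
      gcongr
      refine ContinuousLinearMap.opNorm_le_bound _ hC2 fun v => ?_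
      simp only [ContinuousLinearMap.comp_apply, ContinuousLinearMap.apply_apply]
      refine ((DD (y + r • z) v).le_opNorm _).trans ?_
      have : ‖DD (y + r • z) v‖ ≤ C2 * ‖v‖ := ((DD _).le_opNorm v).trans (by gcongr; exact hDDb _)
      simpa using this
  have hgk := gk_cont (N := N)
  have s1 : ∀ z : Euc N, gk z * (D (y + r • z) z) = ∑ i, gk z * (z i * D (y + r • z) (ee i)) := by
    intro z
    rw [← Finset.mul_sum]
    congr 1
    have : z = ∑ i, z i • ee i := by
      have := (EuclideanSpace.basisFun (Fin N) ℝ).sum_repr z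
      simpa using this.symm
    conv_lhs => rw [this]
    simp only [map_sum, map_smul, smul_eq_mul]
    rw [← this]
  have s2 : ∀ z : Euc N, gk z * (r * lap (fun x => ζ x τ) (y + r • z)) =
      ∑ i, gk z * (r * DD (y + r • z) (ee i) (ee i)) := by
    intro z
    rw [h.lap_eq, Finset.mul_sum, Finset.mul_sum]
  change ∫ z, gk z * (D (y + r • z) z) = _
  simp only [s1, s2]
  rw [integral_finsetSum, integral_finsetSum]
  · exact Finset.sum_congr rfl fun i _ => ibp i
  · intro i _
    refine (gk_integrable.mul_const (|r| * C2)).mono' ?_ (Eventually.of_forall fun z => ?_)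
    · apply Continuous.aestronglyMeasurable
      have : Continuous fun z => DD (y + r • z) (ee i) (ee i) :=
        ((hDDc.comp (by fun_prop)).clm_apply continuous_const).clm_apply continuous_const
      fun_prop
    · rw [norm_mul, Real.norm_of_nonneg (gk_nonneg z), norm_mul, Real.norm_eq_abs]
      have := gk_nonneg z
      gcongr
      refine ((DD (y + r • z) (ee i)).le_opNorm _).trans ?_
      have : ‖DD (y + r • z) (ee i)‖ ≤ C2 * ‖ee i‖ := ((DD _).le_opNorm (ee i)).trans (by gcongr; exact hDDb _)
      simpa using this
  · intro i _
    refine (norm_gk_integrable.mul_const C1).mono' ?_ (Eventually.of_forall fun z => ?_)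
    · apply Continuous.aestronglyMeasurable
      have : Continuous fun z => D (y + r • z) (ee i) :=
        (hDc.comp (by fun_prop)).clm_apply continuous_const
      fun_prop
    · rw [norm_mul, norm_mul, Real.norm_of_nonneg (gk_nonneg z)]
      have h2 : ‖z i‖ ≤ ‖z‖ := PiLp.norm_apply_le z i
      have h3 : ‖D (y + r • z) (ee i)‖ ≤ C1 := ((D _).le_opNorm _).trans (by simpa using hDb _)
      have := gk_nonneg z
      calc gk z * (‖z i‖ * ‖D (y + r • z) (ee i)‖) ≤ gk z * (‖z‖ * C1) := by gcongr
        _ = _ := by ring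




instance instHaarE {N : ℕ} : (volume : Measure (Euc N × ℝ)).IsAddHaarMeasure := by
  rw [Measure.volume_eq_prod]; infer_instance

theorem HK_mul_integrable {N : ℕ} {H : Euc N × ℝ → ℝ} (hH : Continuous H) (hc : HasCompactSupport H)
    (q : Euc N × ℝ) : Integrable (fun p => HK (p - q) * H p) := by
  have h1 : Integrable (fun p : Euc N × ℝ => HKl 1 (p - q)) := (HKl_integrable one_pos).1.comp_sub_right q
  have h2 : Continuous (fun p : Euc N × ℝ => Real.exp (p.2 - q.2) * H p) := by fun_prop
  have h3 : HasCompactSupport (fun p : Euc N × ℝ => Real.exp (p.2 - q.2) * H p) := hc.mul_left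
  obtain ⟨C, hC⟩ := h3.exists_bound_of_continuous h2
  refine (h1.mul_bdd (c := C) h2.aestronglyMeasurable (Eventually.of_forall hC)).congr
    (Eventually.of_forall fun p => ?_)
  simp only [HKl, Prod.snd_sub]
  rw [show Real.exp (-1 * (p.2 - q.2)) * HK (p - q) * (Real.exp (p.2 - q.2) * H p) =
    (Real.exp (-1 * (p.2 - q.2)) * Real.exp (p.2 - q.2)) * (HK (p - q) * H p) by ring, ← Real.exp_add]
  simp

theorem slice_subst {N : ℕ} (H : Euc N × ℝ → ℝ) (y : Euc N) (s τ : ℝ) (hτ : 0 < τ) :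
    ∫ x, HK (x - y, τ) * H (x, s + τ) = ∫ z, gk z * H (y + √(2 * τ) • z, s + τ) := by
  have hr : 0 < √(2 * τ) := Real.sqrt_pos.mpr (by linarith)
  set ρ := √(2 * τ) with hρ
  have e1 := integral_sub_right_eq_self (μ := (volume : Measure (Euc N)))
    (fun x' => HK (x', τ) * H (y + x', s + τ)) y
  simp only [add_sub_cancel] at e1
  rw [e1]
  have e2 := Measure.integral_comp_inv_smul (volume : Measure (Euc N))
    (fun z => (ρ ^ N)⁻¹ * (gk z * H (y + ρ • z, s + τ))) ρ
  have e3 : ∀ x : Euc N, HK (x, τ) * H (y + x, s + τ) =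
    (ρ ^ N)⁻¹ * (gk (ρ⁻¹ • x) * H (y + ρ • ρ⁻¹ • x, s + τ)) := by
    intro x
    rw [smul_inv_smul₀ hr.ne']
    simp only [HK, if_pos hτ]
    ring
  simp only [e3]
  rw [e2, integral_const_mul]
  simp only [finrank_euclideanSpace, Fintype.card_fin, smul_eq_mul]
  rw [abs_of_pos (by positivity), mul_inv_cancel_left₀ (by positivity)]

theorem key_identity {N : ℕ} {ζ : Euc N → ℝ → ℝ} (h : C21 ζ)
    (hc : HasCompactSupport (fun q : Euc N × ℝ => ζ q.1 q.2)) (q : Euc N × ℝ) :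
    ∫ p, HK (p - q) * heatAdj ζ p = - ζ q.1 q.2 := by
  obtain ⟨y, s⟩ := q
  have hHc := h.heatAdj_cont
  have hHs := heatAdj_compact hc
  obtain ⟨C, hC⟩ := hHs.exists_bound_of_continuous hHc
  obtain ⟨R, hR0, hR⟩ := compact_time_bound hc
  set H := heatAdj ζ with hH
  have hgk := gk_cont (N := N)
  set Ψ : ℝ → ℝ := fun τ => ∫ z, gk z * H (y + √(2 * τ) • z, s + τ) with hΨ
  have hΨc : Continuous Ψ := by
    refine continuous_of_dominated (bound := fun z => gk z * C) (fun τ => ?_) (fun τ => ?_)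
      (gk_integrable.mul_const C) (Eventually.of_forall fun z => ?_)
    · apply Continuous.aestronglyMeasurable; fun_prop
    · refine Eventually.of_forall fun z => ?_
      rw [norm_mul, Real.norm_of_nonneg (gk_nonneg z)]
      have := gk_nonneg z
      have := hC (y + √(2 * τ) • z, s + τ)
      gcongr
    · fun_prop
  set M := R + |s| with hM
  have hM0 : 0 < M := by positivity
  have hΨz : ∀ τ, M ≤ τ → Ψ τ = 0 := by
    intro τ hτ
    have : ∀ z : Euc N, gk z * H (y + √(2 * τ) • z, s + τ) = 0 := by
      intro z
      rw [hH, heatAdj_zero_of, mul_zero]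
      apply hR
      refine le_trans ?_ (le_abs_self _)
      simp only
      linarith [neg_abs_le s]
    simp only [hΨ, this, integral_zero]
  have s1 : ∫ p, HK (p - (y, s)) * H p = ∫ τ in (0:ℝ)..M, Ψ τ := by
    have hi := HK_mul_integrable hHc hHs (y, s)
    rw [Measure.volume_eq_prod] at hi ⊢
    rw [integral_prod_symm _ hi]
    have e1 : ∀ t : ℝ, ∫ x, HK ((x, t) - (y, s)) * H (x, t) = (Ioi (0:ℝ)).indicator Ψ (t - s) := by
      intro t
      by_cases ht : 0 < t - s
      · rw [indicator_of_mem (by exact ht)]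
        have := slice_subst H y s (t - s) ht
        simp only [add_sub_cancel] at this
        simp only [Prod.mk_sub_mk]
        rw [this]
        simp only [hΨ, add_sub_cancel]
      · rw [indicator_of_notMem (by exact ht)]
        simp only [Prod.mk_sub_mk]
        have : ∀ x : Euc N, HK (x - y, t - s) = 0 := fun x => HK_neg (by simpa using ht)
        simp [this]
    simp only [e1]
    rw [integral_sub_right_eq_self (μ := (volume : Measure ℝ)) (fun t => (Ioi (0:ℝ)).indicator Ψ t) s,
      integral_indicator measurableSet_Ioi, intervalIntegral.integral_of_le hM0.le]
    refine setIntegral_eq_of_subset_of_forall_sdiff_eq_zero measurableSet_Ioi (fun x hx => hx.1) ?_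
    rintro x ⟨hx, hx2⟩
    apply hΨz
    by_contra hlt
    exact hx2 ⟨hx, (not_le.mp hlt).le⟩
  rw [s1]
  set L := √(2 * M) with hL
  have hL0 : 0 < L := Real.sqrt_pos.mpr (by linarith)
  have hL2 : L^2 / 2 = M := by rw [hL, Real.sq_sqrt (by linarith)]; ring
  have s2 : ∫ τ in (0:ℝ)..M, Ψ τ = ∫ r in (0:ℝ)..L, Ψ (r^2/2) * r := by
    have := intervalIntegral.integral_comp_mul_deriv (a := 0) (b := L) (f := fun r => r^2/2)
      (f' := fun r => r) (g := Ψ) (fun r _ => by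
        have := ((hasDerivAt_id r).pow 2).div_const 2
        simpa using! this) continuousOn_id hΨc
    simp only [hL2] at this
    simp only [Function.comp_def] at this
    rw [this]
    norm_num
  rw [s2]
  set dH : Euc N → ℝ → ℝ := fun z r => fderiv ℝ (fun x => ζ x (s + r^2/2)) (y + r • z) z +
      r * deriv (ζ (y + r • z)) (s + r^2/2) with hdH
  obtain ⟨C1, h1⟩ := bound_of_support hc h.2.2.2.2.1 fun p hp => (h.deriv_zero hp).2.1
  obtain ⟨C2, h2⟩ := bound_of_support hc h.2.2.1 fun p hp => (h.deriv_zero hp).1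
  have hC1 : 0 ≤ C1 := le_trans (norm_nonneg _) (h1 (0,0))
  have hC2 : 0 ≤ C2 := le_trans (norm_nonneg _) (h2 (0,0))
  have cD : Continuous (fun p : Euc N × ℝ => fderiv ℝ (fun x => ζ x (s + p.2^2/2)) (y + p.2 • p.1)) :=
    h.2.2.2.2.1.comp (show Continuous (fun p : Euc N × ℝ => (y + p.2 • p.1, s + p.2^2/2)) by fun_prop)
  have cT : Continuous (fun p : Euc N × ℝ => deriv (ζ (y + p.2 • p.1)) (s + p.2^2/2)) :=
    h.2.2.1.comp (show Continuous (fun p : Euc N × ℝ => (y + p.2 • p.1, s + p.2^2/2)) by fun_prop)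
  have cd : Continuous (fun p : Euc N × ℝ => dH p.1 p.2) :=
    (cD.clm_apply continuous_fst).add (continuous_snd.mul cT)
  have s3 : ∀ r ∈ Icc (0:ℝ) L, Ψ (r^2/2) * r = ∫ z, gk z * dH z r := by
    intro r hr
    have e : √(2 * (r^2/2)) = r := by
      rw [show 2 * (r^2/2) = r^2 by ring]; exact Real.sqrt_sq hr.1
    simp only [hΨ, e]
    rw [← integral_mul_const]
    have cDr : Continuous (fun z : Euc N => fderiv ℝ (fun x => ζ x (s + r^2/2)) (y + r • z)) :=
      cD.comp (Continuous.prodMk_left r)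
    have cTr : Continuous (fun z : Euc N => deriv (ζ (y + r • z)) (s + r^2/2)) :=
      cT.comp (Continuous.prodMk_left r)
    have i1 : Integrable (fun z => gk z * (fderiv ℝ (fun x => ζ x (s + r^2/2)) (y + r • z) z)) := by
      refine (norm_gk_integrable.mul_const C1).mono' ?_ (Eventually.of_forall fun z => ?_)
      · exact (gk_cont.mul (cDr.clm_apply continuous_id)).aestronglyMeasurable
      · rw [norm_mul, Real.norm_of_nonneg (gk_nonneg z)]
        have := gk_nonneg z
        have h3 := (fderiv ℝ (fun x => ζ x (s + r^2/2)) (y + r • z)).le_opNorm z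
        have h4 : _ ≤ C1 := h1 (y + r • z, s + r^2/2)
        calc _ ≤ gk z * (C1 * ‖z‖) := by
              gcongr; exact h3.trans (by gcongr)
          _ = _ := by ring
    have i2 : Integrable (fun z => gk z * (r * deriv (ζ (y + r • z)) (s + r^2/2))) := by
      refine (gk_integrable.mul_const (|r| * C2)).mono' ?_ (Eventually.of_forall fun z => ?_)
      · exact (gk_cont.mul (continuous_const.mul cTr)).aestronglyMeasurable
      · rw [norm_mul, Real.norm_of_nonneg (gk_nonneg z), norm_mul, Real.norm_eq_abs r]
        have := gk_nonneg z
        have h4 : _ ≤ C2 := h2 (y + r • z, s + r^2/2)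
        simp only at h4
        gcongr
    simp only [hdH, mul_add]
    rw [integral_add i1 i2, key_slice h hc]
    have i3 : Integrable (fun z => gk z * H (y + r • z, s + r^2/2) * r) := by
      refine ((gk_integrable.mul_const C).mono' ?_ (Eventually.of_forall fun z => ?_)).mul_const r
      · apply Continuous.aestronglyMeasurable; fun_prop
      · rw [norm_mul, Real.norm_of_nonneg (gk_nonneg z)]
        have := gk_nonneg z
        have := hC (y + r • z, s + r^2/2)
        gcongr
    rw [← integral_add _ i2]
    · congr 1; ext z; simp only [hH, heatAdj]; ring
    · refine (i3.sub i2).congr (Eventually.of_forall fun z => ?_)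
      simp only [hH, heatAdj, Pi.sub_apply]; ring
  have s4 : ∫ r in (0:ℝ)..L, Ψ (r^2/2) * r = ∫ r in (0:ℝ)..L, ∫ z, gk z * dH z r := by
    apply intervalIntegral.integral_congr
    intro r hr
    rw [uIcc_of_le hL0.le] at hr
    exact s3 r hr
  rw [s4, intervalIntegral_integral_swap]
  · have ftc : ∀ z : Euc N, ∫ r in (0:ℝ)..L, gk z * dH z r = gk z * (- ζ y s) := by
      intro z
      rw [intervalIntegral.integral_const_mul]
      congr 1
      have hder : ∀ r ∈ uIcc 0 L, HasDerivAt (fun r : ℝ => ζ (y + r • z) (s + r^2/2)) (dH z r) r := by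
        intro r _
        have a1 : HasDerivAt (fun r : ℝ => (y + r • z, s + r^2/2)) (z, r) r := by
          have b1 : HasDerivAt (fun r : ℝ => y + r • z) z r := by
            simpa using! ((hasDerivAt_id r).smul_const z).const_add y
          have b2 : HasDerivAt (fun r : ℝ => s + r^2/2) r r := by
            have := (((hasDerivAt_id r).pow 2).div_const 2).const_add s
            simpa using! this
          exact b1.prodMk b2
        have a2 := (h.hasFDerivAt (y + r • z, s + r^2/2)).comp_hasDerivAt r a1
        simpa using! a2
      rw [intervalIntegral.integral_eq_sub_of_hasDerivAt hder]
      · have : ζ (y + L • z) (s + L^2/2) = 0 := by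
          have := hR (y + L • z, s + L^2/2) (by
            refine le_trans ?_ (le_abs_self _)
            simp only [hL2, hM]
            linarith [neg_abs_le s])
          exact image_eq_zero_of_notMem_tsupport (f := fun q : Euc N × ℝ => ζ q.1 q.2) this
        rw [this]; simp
      · exact (cd.comp (Continuous.prodMk_right z)).intervalIntegrable _ _
    simp only [ftc]
    rw [integral_mul_const, gk_integral, one_mul]
  · rw [uIoc_of_le hL0.le]
    have b : Integrable (fun z : Euc N => C1 * (‖z‖ * gk z) + (L * C2) * gk z) :=
      (norm_gk_integrable.const_mul _).add (gk_integrable.const_mul _)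
    have b2 : Integrable (fun p : ℝ × Euc N => (1:ℝ) * (C1 * (‖p.2‖ * gk p.2) + (L * C2) * gk p.2))
        ((volume.restrict (Ioc 0 L)).prod volume) :=
      Integrable.mul_prod (integrable_const (1:ℝ)) b
    refine b2.mono' ?_ ?_
    · apply Continuous.aestronglyMeasurable
      exact (gk_cont.comp continuous_snd).mul (cd.comp continuous_swap)
    · have : ∀ᵐ p ∂((volume.restrict (Ioc 0 L)).prod (volume : Measure (Euc N))), p.1 ∈ Ioc 0 L :=
        Measure.quasiMeasurePreserving_fst.ae (ae_restrict_mem measurableSet_Ioc)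
      filter_upwards [this] with p hp
      obtain ⟨r, z⟩ := p
      simp only [Function.uncurry, hdH]
      rw [norm_mul, Real.norm_of_nonneg (gk_nonneg z)]
      have := gk_nonneg z
      have h3 := (fderiv ℝ (fun x => ζ x (s + r^2/2)) (y + r • z)).le_opNorm z
      have h4 : ‖fderiv ℝ (fun x => ζ x (s + r^2/2)) (y + r • z)‖ ≤ C1 := h1 (y + r • z, s + r^2/2)
      have h5 : ‖deriv (ζ (y + r • z)) (s + r^2/2)‖ ≤ C2 := h2 (y + r • z, s + r^2/2)
      have h6 : ‖fderiv ℝ (fun x => ζ x (s + r^2/2)) (y + r • z) z + r * deriv (ζ (y + r • z)) (s + r^2/2)‖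
          ≤ C1 * ‖z‖ + L * C2 := by
        refine (norm_add_le _ _).trans ?_
        rw [norm_mul, Real.norm_of_nonneg hp.1.le]
        have := hp.2
        simp only at this
        have := hp.1.le
        gcongr
        exact h3.trans (by gcongr)
      calc _ ≤ gk z * (C1 * ‖z‖ + L * C2) := by gcongr
        _ = _ := by ring




/-- heat potential of a measure -/
def pot {N : ℕ} (ν : Measure (Euc N)) (p : Euc N × ℝ) : ℝ := ∫ y, HK (p - (y, 0)) ∂ν

theorem pot_nonneg {N : ℕ} (ν : Measure (Euc N)) (p : Euc N × ℝ) : 0 ≤ pot ν p :=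
  integral_nonneg fun _ => HK_nonneg _

theorem pot_neg {N : ℕ} (ν : Measure (Euc N)) {p : Euc N × ℝ} (h : p.2 ≤ 0) : pot ν p = 0 := by
  unfold pot
  have : ∀ y : Euc N, HK (p - (y, 0)) = 0 := fun y => HK_neg (by simpa using h)
  simp [this]

theorem pot_meas {N : ℕ} (ν : Measure (Euc N)) [IsFiniteMeasure ν] : StronglyMeasurable (pot ν) := by
  have : Measurable (fun z : (Euc N × ℝ) × Euc N => HK (z.1 - (z.2, 0))) :=
    HK_meas.comp (by fun_prop)
  exact this.stronglyMeasurable.integral_prod_right'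

theorem pot_bound {N : ℕ} (ν : Measure (Euc N)) [IsFiniteMeasure ν] {x0 : Euc N} {r δ : ℝ} (hr : 0 < r)
    (hδ : 0 < δ) (hν : ν (Metric.closedBall x0 r)ᶜ = 0) :
    ∃ C : ℝ, 0 ≤ C ∧ ∀ p : Euc N × ℝ, (p.1 ∉ Metric.ball x0 (2 * r) ∨ δ ≤ p.2) → pot ν p ≤ C := by
  obtain ⟨C, hC0, hC⟩ := HK_bound (N := N) hr hδ
  refine ⟨C * ν.real univ, by positivity, fun p hp => ?_⟩
  have hae : ∀ᵐ y ∂ν, HK (p - (y, 0)) ≤ C := by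
    have : ∀ᵐ y ∂ν, y ∈ Metric.closedBall x0 r := by
      rw [ae_iff]; exact hν
    filter_upwards [this] with y hy
    apply hC
    rcases hp with h | h
    · left
      simp only [Metric.mem_ball, not_lt, Metric.mem_closedBall] at h hy
      have : ‖(p - (y, (0:ℝ))).1‖ = dist p.1 y := by simp [dist_eq_norm]
      rw [this]
      have := dist_triangle p.1 y x0
      linarith
    · right; simpa using h
  unfold pot
  have hm : Measurable (fun y : Euc N => HK (p - (y, 0))) := HK_meas.comp (by fun_prop)
  have hi : Integrable (fun y : Euc N => HK (p - (y, 0))) ν :=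
    (integrable_const C).mono' hm.aestronglyMeasurable (by
      filter_upwards [hae] with y hy
      rw [Real.norm_of_nonneg (HK_nonneg _)]; exact hy)
  calc _ ≤ ∫ y, C ∂ν := integral_mono_ae hi (integrable_const C) hae
    _ = _ := by simp [mul_comm]

theorem HKl_prod_integrable {N : ℕ} (ν : Measure (Euc N)) [IsFiniteMeasure ν] {l : ℝ} (hl : 0 < l) :
    Integrable (fun z : (Euc N × ℝ) × Euc N => HKl l (z.1 - (z.2, 0))) ((volume : Measure (Euc N × ℝ)).prod ν) := by
  have hm : Measurable (fun z : (Euc N × ℝ) × Euc N => HKl l (z.1 - (z.2, 0))) :=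
    (HKl_meas l).comp (by fun_prop)
  have h1 : ∀ y : Euc N, Integrable (fun p : Euc N × ℝ => HKl l (p - (y, 0))) :=
    fun y => (HKl_integrable hl).1.comp_sub_right _
  have h2 : ∀ y : Euc N, ∫ p : Euc N × ℝ, ‖HKl l (p - (y, 0))‖ = l⁻¹ := by
    intro y
    simp only [Real.norm_of_nonneg (HKl_nonneg l _)]
    rw [integral_sub_right_eq_self (μ := (volume : Measure (Euc N × ℝ))) (HKl l) (y, 0), (HKl_integrable hl).2]
  refine (integrable_prod_iff' hm.aestronglyMeasurable).mpr ⟨Eventually.of_forall h1, ?_⟩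
  simp only [h2]
  exact integrable_const l⁻¹

theorem pot_exp {N : ℕ} (ν : Measure (Euc N)) (l : ℝ) (p : Euc N × ℝ) :
    Real.exp (-l * p.2) * pot ν p = ∫ y, HKl l (p - (y, 0)) ∂ν := by
  unfold pot HKl
  rw [← integral_const_mul]; simp

theorem pot_integrable {N : ℕ} (ν : Measure (Euc N)) [IsFiniteMeasure ν] {l : ℝ} (hl : 0 < l) :
    Integrable (fun p => Real.exp (-l * p.2) * pot ν p) := by
  simp only [pot_exp]
  exact (HKl_prod_integrable ν hl).integral_prod_left

theorem exp_cancel (a b : ℝ) : Real.exp (-a) * (Real.exp a * b) = b := by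
  rw [← mul_assoc, ← Real.exp_add]; simp

theorem exp_cancel' (a b : ℝ) : Real.exp a * (Real.exp (-a) * b) = b := by
  rw [← mul_assoc, ← Real.exp_add]; simp

theorem exp_mul_bound {N : ℕ} {H : Euc N × ℝ → ℝ} (hH : Continuous H) (hc : HasCompactSupport H) (l : ℝ) :
    ∃ C, ∀ p, ‖Real.exp (l * p.2) * H p‖ ≤ C :=
  HasCompactSupport.exists_bound_of_continuous (f := fun p : Euc N × ℝ => Real.exp (l * p.2) * H p)
    hc.mul_left (by fun_prop)

theorem pot_weak {N : ℕ} (ν : Measure (Euc N)) [IsFiniteMeasure ν] {ζ : Euc N → ℝ → ℝ} (h : C21 ζ)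
    (hc : HasCompactSupport (fun q : Euc N × ℝ => ζ q.1 q.2)) :
    ∫ p, pot ν p * heatAdj ζ p = - ∫ y, ζ y 0 ∂ν := by
  have hHc := h.heatAdj_cont
  obtain ⟨C, hC⟩ := exp_mul_bound hHc (heatAdj_compact hc) 1
  have hi : Integrable (fun z : (Euc N × ℝ) × Euc N => HK (z.1 - (z.2, 0)) * heatAdj ζ z.1)
      ((volume : Measure (Euc N × ℝ)).prod ν) := by
    refine ((HKl_prod_integrable ν one_pos).mul_bdd (c := C) (g := fun z => Real.exp (1 * z.1.2) * heatAdj ζ z.1) ?_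
      (Eventually.of_forall fun z => hC z.1)).congr (Eventually.of_forall fun z => ?_)
    · apply Continuous.aestronglyMeasurable; fun_prop
    · simp only [HKl, Prod.snd_sub, sub_zero]
      rw [show Real.exp (-1 * z.1.2) * HK (z.1 - (z.2, 0)) * (Real.exp (1 * z.1.2) * heatAdj ζ z.1) =
        Real.exp (-(1 * z.1.2)) * (Real.exp (1 * z.1.2) * (HK (z.1 - (z.2, 0)) * heatAdj ζ z.1)) by ring_nf,
        exp_cancel]
  have e : ∀ p, pot ν p * heatAdj ζ p = ∫ y, HK (p - (y, 0)) * heatAdj ζ p ∂ν := by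
    intro p; unfold pot; rw [integral_mul_const]
  simp only [e]
  rw [integral_integral_swap hi]
  simp only [key_identity h hc, integral_neg]

/-- weighted Duhamel operator -/
def duh {N : ℕ} (l : ℝ) (G : Euc N × ℝ → ℝ) (p : Euc N × ℝ) : ℝ := ∫ q, G q * HKl l (p - q)

theorem duh_integrand {N : ℕ} {l : ℝ} (hl : 0 < l) {G : Euc N × ℝ → ℝ} (hG : Integrable G) :
    Integrable (fun z : (Euc N × ℝ) × (Euc N × ℝ) => G z.2 * HKl l (z.1 - z.2)) (volume.prod volume) :=
  hG.convolution_integrand (ContinuousLinearMap.mul ℝ ℝ) (HKl_integrable hl).1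

theorem duh_integrable {N : ℕ} {l : ℝ} (hl : 0 < l) {G : Euc N × ℝ → ℝ} (hG : Integrable G) :
    Integrable (duh l G) := (duh_integrand hl hG).integral_prod_left

theorem duh_norm {N : ℕ} {l : ℝ} (hl : 0 < l) {G : Euc N × ℝ → ℝ} (hG : Integrable G) :
    ∫ p, ‖duh l G p‖ ≤ l⁻¹ * ∫ p, ‖G p‖ := by
  have hi := (duh_integrand hl hG).norm
  calc ∫ p, ‖duh l G p‖ ≤ ∫ p, ∫ q, ‖G q * HKl l (p - q)‖ := by
        refine integral_mono (duh_integrable hl hG).norm hi.integral_prod_left fun p => ?_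
        exact norm_integral_le_integral_norm _
    _ = ∫ q, ∫ p, ‖G q * HKl l (p - q)‖ := integral_integral_swap hi
    _ = ∫ q, l⁻¹ * ‖G q‖ := by
        congr 1; ext q
        simp only [norm_mul, Real.norm_of_nonneg (HKl_nonneg l _)]
        rw [integral_const_mul, integral_sub_right_eq_self (μ := (volume : Measure (Euc N × ℝ))) (HKl l) q,
          (HKl_integrable hl).2, mul_comm]
    _ = _ := integral_const_mul _ _

theorem duh_weak {N : ℕ} {l : ℝ} (hl : 0 < l) {G : Euc N × ℝ → ℝ} (hG : Integrable G) {ζ : Euc N → ℝ → ℝ} (h : C21 ζ)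
    (hc : HasCompactSupport (fun q : Euc N × ℝ => ζ q.1 q.2)) :
    ∫ p, Real.exp (l * p.2) * duh l G p * heatAdj ζ p = - ∫ q, Real.exp (l * q.2) * G q * ζ q.1 q.2 := by
  have hHc := h.heatAdj_cont
  obtain ⟨C, hC⟩ := exp_mul_bound hHc (heatAdj_compact hc) l
  have hi : Integrable (fun z : (Euc N × ℝ) × (Euc N × ℝ) => G z.2 * HKl l (z.1 - z.2) *
      (Real.exp (l * z.1.2) * heatAdj ζ z.1))
      ((volume : Measure (Euc N × ℝ)).prod volume) := by
    refine ((duh_integrand hl hG).mul_bdd (c := C) (g := fun z => Real.exp (l * z.1.2) * heatAdj ζ z.1) ?_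
      (Eventually.of_forall fun z => hC z.1))
    apply Continuous.aestronglyMeasurable; fun_prop
  have e : ∀ p, Real.exp (l * p.2) * duh l G p * heatAdj ζ p =
      ∫ q, G q * HKl l (p - q) * (Real.exp (l * p.2) * heatAdj ζ p) := by
    intro p; unfold duh; rw [integral_mul_const]; ring
  simp only [e]
  rw [integral_integral_swap hi, ← integral_neg]
  congr 1; ext q
  have e2 : ∀ p : Euc N × ℝ, G q * HKl l (p - q) * (Real.exp (l * p.2) * heatAdj ζ p) =
      (Real.exp (l * q.2) * G q) * (HK (p - q) * heatAdj ζ p) := by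
    intro p
    simp only [HKl, Prod.snd_sub]
    have : Real.exp (-l * (p.2 - q.2)) * Real.exp (l * p.2) = Real.exp (l * q.2) := by
      rw [← Real.exp_add]; ring_nf
    rw [← this]; ring
  simp only [e2]
  rw [integral_const_mul, key_identity h hc]
  ring

theorem duh_congr {N : ℕ} (l : ℝ) {G G' : Euc N × ℝ → ℝ} (h : G =ᵐ[volume] G') : duh l G = duh l G' := by
  ext p
  refine integral_congr_ae ?_
  filter_upwards [h] with q hq
  rw [hq]

theorem exists_sol {N : ℕ} (ν : Measure (Euc N)) [IsFiniteMeasure ν] (F : Euc N × ℝ → ℝ → ℝ)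
    (hFm : Measurable (fun z : (Euc N × ℝ) × ℝ => F z.1 z.2)) (hF0 : ∀ p, F p 0 = 0)
    (hFn : ∀ p s, 0 ≤ F p s) {L : ℝ} (hL : 0 < L)
    (hFL : ∀ p a b, |F p a - F p b| ≤ L * |a - b|) :
    ∃ v : Euc N × ℝ → ℝ, AEStronglyMeasurable v ∧ (∃ l > 0, Integrable (fun p => Real.exp (-l * p.2) * v p)) ∧
      (∀ p, p.2 ≤ 0 → v p = 0) ∧ (∀ p, v p ≤ pot ν p) ∧
      (∀ ζ : Euc N → ℝ → ℝ, C21 ζ → HasCompactSupport (fun q : Euc N × ℝ => ζ q.1 q.2) →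
        ∫ p, (-(v p * heatAdj ζ p) + F p (v p) * ζ p.1 p.2) = ∫ y, ζ y 0 ∂ν) := by
  set l := 2 * L with hl
  have hl0 : 0 < l := by positivity
  set G : (Euc N × ℝ → ℝ) → Euc N × ℝ → ℝ := fun w => {p : Euc N × ℝ | 0 < p.2}.indicator
    fun p => Real.exp (-(l * p.2)) * F p (Real.exp (l * p.2) * w p) with hG
  have hGL : ∀ w w' p, ‖G w p - G w' p‖ ≤ L * ‖w p - w' p‖ := by
    intro w w' p
    simp only [hG]
    by_cases hp : p ∈ {p : Euc N × ℝ | 0 < p.2}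
    · rw [indicator_of_mem hp, indicator_of_mem hp, ← mul_sub, norm_mul, Real.norm_of_nonneg (Real.exp_nonneg _)]
      calc _ ≤ Real.exp (-(l * p.2)) * (L * |Real.exp (l * p.2) * w p - Real.exp (l * p.2) * w' p|) := by
            gcongr; exact hFL _ _ _
        _ = Real.exp (-(l * p.2)) * (Real.exp (l * p.2) * (L * |w p - w' p|)) := by
            rw [← mul_sub, abs_mul, abs_of_pos (Real.exp_pos _)]; ring
        _ = _ := by rw [exp_cancel]; rfl
    · rw [indicator_of_notMem hp, indicator_of_notMem hp]; simp; positivity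
  have hG0 : G (fun _ => 0) = fun _ => 0 := by
    ext p; simp only [hG, mul_zero, hF0]; simp
  have hGn : ∀ w p, 0 ≤ G w p := fun w p => indicator_nonneg (fun p _ => mul_nonneg (Real.exp_nonneg _) (hFn _ _)) p
  have hGm : ∀ w, AEStronglyMeasurable w → AEStronglyMeasurable (G w) := by
    intro w hw
    refine AEStronglyMeasurable.indicator ?_ (measurableSet_lt measurable_const measurable_snd)
    have h1 : AEMeasurable (fun p : Euc N × ℝ => F p (Real.exp (l * p.2) * w p)) :=
      hFm.comp_aemeasurable (aemeasurable_id.prodMk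
        ((by fun_prop : Measurable (fun p : Euc N × ℝ => Real.exp (l * p.2))).aemeasurable.mul hw.aemeasurable))
    exact ((by fun_prop : Measurable (fun p : Euc N × ℝ => Real.exp (-(l * p.2)))).aemeasurable.mul h1).aestronglyMeasurable
  have hGi : ∀ w, Integrable w → Integrable (G w) := by
    intro w hw
    refine (hw.norm.const_mul L).mono' (hGm w hw.1) (Eventually.of_forall fun p => ?_)
    have := hGL w (fun _ => 0) p
    rw [hG0] at this
    simpa using this
  have hVi := pot_integrable ν hl0
  set Φ0 : (Euc N × ℝ → ℝ) → Euc N × ℝ → ℝ := fun w p => Real.exp (-l * p.2) * pot ν p - duh l (G w) p with hΦ0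
  have hΦi : ∀ w, Integrable w → Integrable (Φ0 w) := fun w hw => hVi.sub (duh_integrable hl0 (hGi w hw))
  set Φ : Lp ℝ 1 (volume : Measure (Euc N × ℝ)) → Lp ℝ 1 (volume : Measure (Euc N × ℝ)) :=
    fun w => (hΦi w (L1.integrable_coeFn w)).toL1 _ with hΦ
  have hcontr : ContractingWith (1/2) Φ := by
    refine ⟨by norm_num, LipschitzWith.of_dist_le_mul fun w w' => ?_⟩
    have iw := L1.integrable_coeFn w
    have iw' := L1.integrable_coeFn w'
    rw [dist_eq_norm, dist_eq_norm, hΦ]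
    simp only
    rw [← Integrable.toL1_sub, L1.norm_eq_integral_norm, L1.norm_eq_integral_norm]
    have e1 : ∫ a, ‖(Integrable.toL1 (Φ0 w - Φ0 w') ((hΦi w iw).sub (hΦi w' iw')) : Euc N × ℝ → ℝ) a‖ =
        ∫ a, ‖duh l (G w' - G w) a‖ := by
      refine integral_congr_ae ?_
      filter_upwards [Integrable.coeFn_toL1 ((hΦi w iw).sub (hΦi w' iw')),
        (duh_integrand hl0 (hGi w iw)).prod_right_ae, (duh_integrand hl0 (hGi w' iw')).prod_right_ae] with p hp h1 h2
      rw [hp]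
      simp only [Pi.sub_apply, hΦ0, duh, sub_mul]
      rw [integral_sub h2 h1]
      congr 1; ring
    have e2 : ∫ a, ‖(w - w' : Lp ℝ 1 (volume : Measure (Euc N × ℝ))) a‖ = ∫ a, ‖w a - w' a‖ := by
      refine integral_congr_ae ?_
      filter_upwards [Lp.coeFn_sub w w'] with p hp
      rw [hp]; rfl
    rw [e1, e2]
    refine (duh_norm hl0 ((hGi w' iw').sub (hGi w iw))).trans ?_
    calc l⁻¹ * ∫ p, ‖(G w' - G w) p‖ ≤ l⁻¹ * ∫ p, L * ‖w p - w' p‖ := by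
          refine mul_le_mul_of_nonneg_left ?_ (by positivity)
          refine integral_mono ((hGi w' iw').sub (hGi w iw)).norm ((iw.sub iw').norm.const_mul L) fun p => ?_
          have := hGL w' w p
          rw [norm_sub_rev (w p)]
          exact this
      _ = _ := by
          rw [integral_const_mul, hl]
          simp only [NNReal.coe_div, NNReal.coe_one, NNReal.coe_ofNat]
          field_simp
  have hfix := hcontr.fixedPoint_isFixedPt
  set w := ContractingWith.fixedPoint Φ hcontr with hw
  have iw := L1.integrable_coeFn w
  have hwae : (w : Euc N × ℝ → ℝ) =ᵐ[volume] Φ0 w := by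
    have h1 : Φ w = w := hfix
    have h2 := Integrable.coeFn_toL1 (hΦi w iw)
    have h3 : ((hΦi w iw).toL1 _ : Lp ℝ 1 (volume : Measure (Euc N × ℝ))) = w := h1
    rw [h3] at h2
    exact h2
  set w1 := Φ0 w with hw1
  have iw1 : Integrable w1 := hΦi w iw
  have hGcong : ∀ a b : Euc N × ℝ → ℝ, ∀ p, a p = b p → G a p = G b p := by
    intro a b p hp
    simp only [hG, indicator, hp]
  have hGae : G w =ᵐ[volume] G w1 := by
    filter_upwards [hwae] with p hp
    exact hGcong _ _ p hp
  have hd : duh l (G w) = duh l (G w1) := duh_congr l hGae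
  set v : Euc N × ℝ → ℝ := fun p => Real.exp (l * p.2) * w1 p with hv
  have hvp : ∀ p, v p = pot ν p - Real.exp (l * p.2) * duh l (G w1) p := by
    intro p
    rw [← hd]
    change Real.exp (l * p.2) * (Real.exp (-l * p.2) * pot ν p - duh l (G w) p) = _
    rw [mul_sub, neg_mul]
    rw [exp_cancel']
  have hv0 : ∀ p : Euc N × ℝ, p.2 ≤ 0 → v p = 0 := by
    intro p hp
    rw [hvp, pot_neg ν hp]
    have : duh l (G w1) p = 0 := by
      unfold duh
      have : ∀ q, G w1 q * HKl l (p - q) = 0 := by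
        intro q
        by_cases hq : 0 < q.2
        · rw [HKl, HK_neg (by simp; linarith)]; simp
        · simp only [hG]; rw [indicator_of_notMem (by exact hq), zero_mul]
      simp [this]
    rw [this]; simp
  have hFv : ∀ p, F p (v p) = Real.exp (l * p.2) * G w1 p := by
    intro p
    by_cases hp : 0 < p.2
    · simp only [hG]
      rw [indicator_of_mem (by exact hp), exp_cancel']
    · rw [hv0 p (not_lt.mp hp), hF0]
      simp only [hG]
      rw [indicator_of_notMem (by exact hp)]; simp
  refine ⟨v, ?_, ⟨l, hl0, ?_⟩, hv0, ?_, ?_⟩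
  · exact ((by fun_prop : Continuous (fun p : Euc N × ℝ => Real.exp (l * p.2))).aestronglyMeasurable.mul iw1.1)
  · refine iw1.congr (Eventually.of_forall fun p => ?_)
    simp only [hv, neg_mul, exp_cancel]
  · intro p
    rw [hvp]
    have : 0 ≤ duh l (G w1) p := integral_nonneg fun q => mul_nonneg (hGn _ _) (HKl_nonneg _ _)
    have := mul_nonneg (Real.exp_nonneg (l * p.2)) this
    linarith
  · intro ζ h hc
    have hHc := h.heatAdj_cont
    have iG := hGi w1 iw1
    obtain ⟨C, hC⟩ := exp_mul_bound hHc (heatAdj_compact hc) l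
    obtain ⟨C', hC'⟩ := exp_mul_bound h.cont hc l
    have hcH : AEStronglyMeasurable (fun p : Euc N × ℝ => Real.exp (l * p.2) * heatAdj ζ p) := by
      apply Continuous.aestronglyMeasurable; fun_prop
    have hcZ : AEStronglyMeasurable (fun p : Euc N × ℝ => Real.exp (l * p.2) * ζ p.1 p.2) := by
      apply Continuous.aestronglyMeasurable; have := h.cont; fun_prop
    have i1 : Integrable (fun p => pot ν p * heatAdj ζ p) := by
      refine (hVi.mul_bdd hcH (Eventually.of_forall hC)).congr (Eventually.of_forall fun p => ?_)
      simp only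
      rw [show Real.exp (-l * p.2) * pot ν p * (Real.exp (l * p.2) * heatAdj ζ p) =
        Real.exp (-(l * p.2)) * (Real.exp (l * p.2) * (pot ν p * heatAdj ζ p)) by ring_nf, exp_cancel]
    have i2 : Integrable (fun p => Real.exp (l * p.2) * duh l (G w1) p * heatAdj ζ p) := by
      refine ((duh_integrable hl0 iG).mul_bdd hcH (Eventually.of_forall hC)).congr (Eventually.of_forall fun p => ?_)
      simp only; ring
    have i3 : Integrable (fun p : Euc N × ℝ => Real.exp (l * p.2) * G w1 p * ζ p.1 p.2) := by
      refine (iG.mul_bdd hcZ (Eventually.of_forall hC')).congr (Eventually.of_forall fun p => ?_)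
      simp only; ring
    have e : ∀ p, -(v p * heatAdj ζ p) + F p (v p) * ζ p.1 p.2 =
      (-(pot ν p * heatAdj ζ p) + Real.exp (l * p.2) * duh l (G w1) p * heatAdj ζ p) +
        Real.exp (l * p.2) * G w1 p * ζ p.1 p.2 := by
      intro p; rw [hFv, hvp]; ring
    simp only [e]
    have a1 : Integrable (fun p => -(pot ν p * heatAdj ζ p)) := i1.neg
    have a2 : Integrable (fun p => -(pot ν p * heatAdj ζ p) +
      Real.exp (l * p.2) * duh l (G w1) p * heatAdj ζ p) := a1.add i2
    rw [integral_add a2 i3, integral_add a1 i2, duh_weak hl0 iG h hc, integral_neg, pot_weak ν h hc]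
    ring




/-- nonnegative test functions -/
structure Tst {N : ℕ} (U : Set (Euc N × ℝ)) (ζ : Euc N × ℝ → ℝ) : Prop where
  sm : ContDiff ℝ 3 ζ
  nn : ∀ p, 0 ≤ ζ p
  cs : HasCompactSupport ζ
  sub : tsupport ζ ⊆ U

theorem ibp {N : ℕ} {a ζ : Euc N × ℝ → ℝ} {a' : Euc N × ℝ → Euc N × ℝ →L[ℝ] ℝ}
    (ha : ∀ p, HasFDerivAt a (a' p) p) (ha' : Continuous a')
    (hζ : ContDiff ℝ 1 ζ) (hc : HasCompactSupport ζ) (v : Euc N × ℝ) :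
    ∫ p, a p * fderiv ℝ ζ p v = - ∫ p, a' p v * ζ p := by
  have hac : Continuous a := continuous_iff_continuousAt.mpr fun x => (ha x).continuousAt
  have hfc : Continuous (fderiv ℝ ζ) := hζ.continuous_fderiv (by norm_num)
  have hcf : HasCompactSupport (fun p => fderiv ℝ ζ p v) := by
    refine HasCompactSupport.intro hc.isCompact fun p hp => ?_
    rw [notMem_tsupport_iff_eventuallyEq] at hp
    rw [hp.fderiv_eq]; simp
  have := integral_mul_fderiv_eq_neg_fderiv_mul_of_integrable (μ := (volume : Measure (Euc N × ℝ)))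
    (f := a) (g := ζ) (v := v)
    (by
      simp only [(ha _).fderiv]
      exact ((ha'.clm_apply continuous_const).mul hζ.continuous).integrable_of_hasCompactSupport hc.mul_left)
    ((hac.mul (hfc.clm_apply continuous_const)).integrable_of_hasCompactSupport hcf.mul_left)
    ((hac.mul hζ.continuous).integrable_of_hasCompactSupport hc.mul_left)
    (fun x _ => (ha x).differentiableAt) (fun x _ => hζ.differentiable (by norm_num) x)
  simpa only [(ha _).fderiv] using this

/-- second directional derivative -/
def dd {N : ℕ} (f : Euc N × ℝ → ℝ) (v : Euc N × ℝ) (p : Euc N × ℝ) : ℝ :=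
  fderiv ℝ (fun q => fderiv ℝ f q v) p v

/-- heat operator -/
def hop {N : ℕ} (f : Euc N × ℝ → ℝ) (p : Euc N × ℝ) : ℝ :=
  fderiv ℝ f p (0, 1) - ∑ i : Fin N, dd f (ee i, 0) p

theorem dd_fun {N : ℕ} {f : Euc N × ℝ → ℝ} (hf : ContDiff ℝ 3 f) (v : Euc N × ℝ) :
    ContDiff ℝ 2 (fun q => fderiv ℝ f q v) :=
  (hf.fderiv_right (m := 2) (by norm_num)).clm_apply contDiff_const

theorem fderiv_cs {N : ℕ} {ζ : Euc N × ℝ → ℝ} (hc : HasCompactSupport ζ) (v : Euc N × ℝ) :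
    HasCompactSupport (fun p => fderiv ℝ ζ p v) := by
  refine HasCompactSupport.intro hc.isCompact fun p hp => ?_
  rw [notMem_tsupport_iff_eventuallyEq] at hp
  rw [hp.fderiv_eq]; simp

theorem dd_cont {N : ℕ} {f : Euc N × ℝ → ℝ} (hf : ContDiff ℝ 3 f) (v : Euc N × ℝ) : Continuous (dd f v) :=
  ((dd_fun hf v).continuous_fderiv (by norm_num)).clm_apply continuous_const

theorem hop_cont {N : ℕ} {f : Euc N × ℝ → ℝ} (hf : ContDiff ℝ 3 f) : Continuous (hop f) :=
  ((dd_fun hf (0,1)).continuous).sub (continuous_finsetSum _ fun i _ => dd_cont hf _)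

theorem convex_dd {N : ℕ} {f ζ : Euc N × ℝ → ℝ} (hf : ContDiff ℝ 3 f) (hζ : ContDiff ℝ 3 ζ)
    (hn : ∀ p, 0 ≤ ζ p) (hc : HasCompactSupport ζ) {J d d' : ℝ → ℝ} (hJ : ∀ s, HasDerivAt J (d s) s)
    (hd : ∀ s, HasDerivAt d (d' s) s) (hd' : Continuous d') (hd'0 : ∀ s, 0 ≤ d' s) (v : Euc N × ℝ) :
    - ∫ p, J (f p) * dd ζ v p ≤ - ∫ p, d (f p) * dd f v p * ζ p := by
  have hdc : Continuous d := continuous_iff_continuousAt.mpr fun x => (hd x).continuousAt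
  have hfd : ∀ p, HasFDerivAt f (fderiv ℝ f p) p := fun p => (hf.differentiable (by norm_num) p).hasFDerivAt
  have hfc : Continuous (fderiv ℝ f) := hf.continuous_fderiv (by norm_num)
  have h1 : ∀ p, HasFDerivAt (fun p => J (f p)) (d (f p) • fderiv ℝ f p) p := fun p =>
    (hJ (f p)).comp_hasFDerivAt p (hfd p)
  have e1 := ibp h1 ((hdc.comp hf.continuous).smul hfc) ((dd_fun hζ v).of_le (by norm_num)) (fderiv_cs hc v) v
  have hf2 : ∀ p, HasFDerivAt (fun q => fderiv ℝ f q v) (fderiv ℝ (fun q => fderiv ℝ f q v) p) p := fun p =>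
    ((dd_fun hf v).differentiable (by norm_num) p).hasFDerivAt
  have h2 : ∀ p, HasFDerivAt (fun p => d (f p) * fderiv ℝ f p v)
      (d (f p) • fderiv ℝ (fun q => fderiv ℝ f q v) p + (fderiv ℝ f p v) • (d' (f p) • fderiv ℝ f p)) p := fun p =>
    ((hd (f p)).comp_hasFDerivAt p (hfd p)).mul (hf2 p)
  have hfcv : Continuous (fun p => fderiv ℝ f p v) := hfc.clm_apply continuous_const
  have e2 := ibp h2 (((hdc.comp hf.continuous).smul ((dd_fun hf v).continuous_fderiv (by norm_num))).add
    (hfcv.smul ((hd'.comp hf.continuous).smul hfc))) (hζ.of_le (by norm_num)) hc v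
  unfold dd
  rw [e1, neg_neg]
  simp only [ContinuousLinearMap.smul_apply, smul_eq_mul]
  rw [e2]
  apply neg_le_neg
  have hddc : Continuous (fun p => fderiv ℝ (fun q => fderiv ℝ f q v) p v) := dd_cont hf v
  have hcc : Continuous (fun p => d (f p)) := hdc.comp hf.continuous
  have hcc' : Continuous (fun p => d' (f p)) := hd'.comp hf.continuous
  have hzc := hζ.continuous
  refine integral_mono ?_ ?_ ?_
  · exact Continuous.integrable_of_hasCompactSupport (by fun_prop) hc.mul_left
  · refine Continuous.integrable_of_hasCompactSupport ?_ hc.mul_left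
    simp only [ContinuousLinearMap.add_apply, ContinuousLinearMap.smul_apply, smul_eq_mul]
    fun_prop
  · intro p
    simp only [ContinuousLinearMap.add_apply, ContinuousLinearMap.smul_apply, smul_eq_mul, add_mul]
    have : 0 ≤ fderiv ℝ f p v * (d' (f p) * fderiv ℝ f p v) * ζ p := by
      have := hd'0 (f p)
      have := hn p
      have : fderiv ℝ f p v * (d' (f p) * fderiv ℝ f p v) * ζ p = d' (f p) * (fderiv ℝ f p v)^2 * ζ p := by ring
      rw [this]; positivity
    linarith

theorem convex_chain {N : ℕ} {f ζ : Euc N × ℝ → ℝ} (hf : ContDiff ℝ 3 f) (hζ : ContDiff ℝ 3 ζ)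
    (hn : ∀ p, 0 ≤ ζ p) (hc : HasCompactSupport ζ) {J d d' : ℝ → ℝ} (hJ : ∀ s, HasDerivAt J (d s) s)
    (hd : ∀ s, HasDerivAt d (d' s) s) (hd' : Continuous d') (hd'0 : ∀ s, 0 ≤ d' s) :
    - ∫ p, J (f p) * heatAdj (cur ζ) p ≤ ∫ p, d (f p) * hop f p * ζ p := by
  have hJc : Continuous J := continuous_iff_continuousAt.mpr fun x => (hJ x).continuousAt
  have hdc : Continuous d := continuous_iff_continuousAt.mpr fun x => (hd x).continuousAt
  have hfd : ∀ p, HasFDerivAt f (fderiv ℝ f p) p := fun p => (hf.differentiable (by norm_num) p).hasFDerivAt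
  have hfc : Continuous (fderiv ℝ f) := hf.continuous_fderiv (by norm_num)
  have h1 : ∀ p, HasFDerivAt (fun p => J (f p)) (d (f p) • fderiv ℝ f p) p := fun p =>
    (hJ (f p)).comp_hasFDerivAt p (hfd p)
  have e1 := ibp h1 ((hdc.comp hf.continuous).smul hfc) (hζ.of_le (by norm_num)) hc (0,1)
  simp only [ContinuousLinearMap.smul_apply, smul_eq_mul] at e1
  have hJf : Continuous (fun p => J (f p)) := hJc.comp hf.continuous
  have hdf : Continuous (fun p => d (f p)) := hdc.comp hf.continuous
  have hz := hζ.continuous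
  have i1 : Integrable (fun p => J (f p) * fderiv ℝ ζ p (0,1)) :=
    (hJf.mul (dd_fun hζ (0,1)).continuous).integrable_of_hasCompactSupport (fderiv_cs hc (0,1)).mul_left
  have i2 : ∀ i : Fin N, Integrable (fun p => J (f p) * dd ζ (ee i, 0) p) := fun i =>
    (hJf.mul (dd_cont hζ _)).integrable_of_hasCompactSupport (fderiv_cs (fderiv_cs hc (ee i, 0)) (ee i, 0)).mul_left
  have i3 : Integrable (fun p => d (f p) * fderiv ℝ f p (0,1) * ζ p) :=
    ((hdf.mul (dd_fun hf (0,1)).continuous).mul hz).integrable_of_hasCompactSupport hc.mul_left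
  have i4 : ∀ i : Fin N, Integrable (fun p => d (f p) * dd f (ee i, 0) p * ζ p) := fun i =>
    ((hdf.mul (dd_cont hf _)).mul hz).integrable_of_hasCompactSupport hc.mul_left
  have s1 : ∀ p, J (f p) * heatAdj (cur ζ) p = J (f p) * fderiv ℝ ζ p (0,1) + ∑ i : Fin N, J (f p) * dd ζ (ee i, 0) p := by
    intro p; rw [heatAdj_smooth hζ, mul_add, Finset.mul_sum]; rfl
  have s2 : ∀ p, d (f p) * hop f p * ζ p = d (f p) * fderiv ℝ f p (0,1) * ζ p - ∑ i : Fin N, d (f p) * dd f (ee i, 0) p * ζ p := by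
    intro p; rw [hop, mul_sub, sub_mul, Finset.mul_sum, Finset.sum_mul]
  simp only [s1, s2]
  rw [integral_add i1 (integrable_finsetSum _ fun i _ => i2 i), integral_sub i3 (integrable_finsetSum _ fun i _ => i4 i),
    integral_finsetSum _ (fun i _ => i2 i), integral_finsetSum _ (fun i _ => i4 i), e1, neg_add, neg_neg, sub_eq_add_neg,
    ← Finset.sum_neg_distrib, ← Finset.sum_neg_distrib]
  refine add_le_add le_rfl (Finset.sum_le_sum fun i _ => ?_)
  exact convex_dd hf hζ hn hc hJ hd hd' hd'0 _

/-- mollification -/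
def moll {N : ℕ} (ρ w : Euc N × ℝ → ℝ) (p : Euc N × ℝ) : ℝ := ∫ q, w q * ρ (p - q)

theorem moll_fderiv {N : ℕ} {ρ w : Euc N × ℝ → ℝ} (hρ : ContDiff ℝ 1 ρ) (hc : HasCompactSupport ρ)
    (hw : Integrable w) (p v : Euc N × ℝ) : fderiv ℝ (moll ρ w) p v = moll (fun x => fderiv ℝ ρ x v) w p := by
  have hfc : Continuous (fderiv ℝ ρ) := hρ.continuous_fderiv (by norm_num)
  obtain ⟨C, hC⟩ := (hc.fderiv (𝕜 := ℝ)).exists_bound_of_continuous hfc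
  obtain ⟨C0, hC0⟩ := hc.exists_bound_of_continuous hρ.continuous
  have hcr := hρ.continuous
  have key := hasFDerivAt_integral_of_dominated_of_fderiv_le (𝕜 := ℝ) (μ := (volume : Measure (Euc N × ℝ)))
    (F := fun p q => w q * ρ (p - q)) (F' := fun p q => w q • fderiv ℝ ρ (p - q)) (x₀ := p) (s := univ)
    (bound := fun q => ‖w q‖ * C) univ_mem
    (Eventually.of_forall fun x => hw.1.mul (by apply Continuous.aestronglyMeasurable; fun_prop))
    (hw.mul_bdd (c := C0) (by apply Continuous.aestronglyMeasurable; fun_prop) (Eventually.of_forall fun q => hC0 _))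
    (hw.1.smul (by apply Continuous.aestronglyMeasurable; fun_prop))
    (Eventually.of_forall fun q x _ => by rw [norm_smul]; gcongr; exact hC _)
    (hw.norm.mul_const C)
    (Eventually.of_forall fun q x _ => by
      have h1 : HasFDerivAt ρ (fderiv ℝ ρ (x - q)) (x - q) := (hρ.differentiable (by norm_num) _).hasFDerivAt
      have h2 := h1.comp x ((hasFDerivAt_id x).sub_const q)
      exact h2.const_mul (w q))
  have : fderiv ℝ (moll ρ w) p = ∫ q, w q • fderiv ℝ ρ (p - q) := key.fderiv
  rw [this, ContinuousLinearMap.integral_apply]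
  · rfl
  · refine (hw.norm.mul_const C).mono' (hw.1.smul (by apply Continuous.aestronglyMeasurable; fun_prop))
      (Eventually.of_forall fun q => ?_)
    rw [norm_smul]; gcongr; exact hC _

theorem moll_contDiff {N : ℕ} {ρ w : Euc N × ℝ → ℝ} {n : ℕ∞} (hρ : ContDiff ℝ n ρ) (hc : HasCompactSupport ρ)
    (hw : Integrable w) : ContDiff ℝ n (moll ρ w) :=
  hc.contDiff_convolution_right (ContinuousLinearMap.mul ℝ ℝ) hw.locallyIntegrable hρ

theorem moll_hop {N : ℕ} {ρ w : Euc N × ℝ → ℝ} (hρ : ContDiff ℝ 3 ρ) (hc : HasCompactSupport ρ)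
    (hw : Integrable w) (p : Euc N × ℝ) : hop (moll ρ w) p = moll (hop ρ) w p := by
  unfold hop dd
  rw [moll_fderiv (hρ.of_le (by norm_num)) hc hw]
  have h1 : ∀ i : Fin N, fderiv ℝ (fun q => fderiv ℝ (moll ρ w) q (ee i, 0)) p (ee i, 0) =
      moll (fun x => fderiv ℝ (fun q => fderiv ℝ ρ q (ee i, 0)) x (ee i, 0)) w p := by
    intro i
    have : (fun q => fderiv ℝ (moll ρ w) q (ee i, 0)) = moll (fun x => fderiv ℝ ρ x (ee i, 0)) w := by
      ext q; exact moll_fderiv (hρ.of_le (by norm_num)) hc hw q _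
    rw [this, moll_fderiv ((dd_fun hρ _).of_le (by norm_num)) (fderiv_cs hc _) hw]
  simp only [h1]
  unfold moll
  have hb : ∀ h : Euc N × ℝ → ℝ, Continuous h → HasCompactSupport h → Integrable (fun q => w q * h (p - q)) := by
    intro h h1 h2
    obtain ⟨C, hC⟩ := h2.exists_bound_of_continuous h1
    exact hw.mul_bdd (c := C) (by apply Continuous.aestronglyMeasurable; fun_prop) (Eventually.of_forall fun q => hC _)
  rw [← integral_finsetSum, ← integral_sub]
  · congr 1; ext q; rw [mul_sub, Finset.mul_sum]
  · exact hb (fun x => fderiv ℝ ρ x (0,1)) (dd_fun hρ _).continuous (fderiv_cs hc _)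
  · exact integrable_finsetSum _ fun i _ => hb _ (dd_cont hρ _) (fderiv_cs (fderiv_cs hc (ee i, 0)) (ee i, 0))
  · exact fun i _ => hb _ (dd_cont hρ _) (fderiv_cs (fderiv_cs hc (ee i, 0)) (ee i, 0))

/-- reflection -/
theorem heatAdj_refl {N : ℕ} {ρ : Euc N × ℝ → ℝ} (hρ : ContDiff ℝ 3 ρ) (p q : Euc N × ℝ) :
    heatAdj (cur (fun q => ρ (p - q))) q = - hop ρ (p - q) := by
  have hs : ContDiff ℝ 3 (fun q => ρ (p - q)) := hρ.comp (contDiff_const.sub contDiff_id)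
  have h1 : ∀ {h : Euc N × ℝ → ℝ} (_ : ContDiff ℝ 1 h) (q v : Euc N × ℝ),
      fderiv ℝ (fun q => h (p - q)) q v = - fderiv ℝ h (p - q) v := by
    intro h hh q v
    have a1 : HasFDerivAt h (fderiv ℝ h (p - q)) (p - q) := (hh.differentiable (by norm_num) _).hasFDerivAt
    have a2 := a1.comp q ((hasFDerivAt_id q).const_sub p)
    have a3 : fderiv ℝ (fun q => h (p - q)) q = _ := a2.fderiv
    rw [a3]; simp
  rw [heatAdj_smooth hs, hop, h1 (hρ.of_le (by norm_num)), neg_sub, sub_eq_neg_add (∑ i : Fin N, dd ρ (ee i, 0) (p - q))]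
  congr 1
  refine Finset.sum_congr rfl fun i _ => ?_
  unfold dd
  have : (fun r => fderiv ℝ (fun q => ρ (p - q)) r (ee i, 0)) = fun r => (fun x => - fderiv ℝ ρ x (ee i, 0)) (p - r) := by
    ext r; exact h1 (hρ.of_le (by norm_num)) _ _
  rw [this, h1 ((dd_fun hρ _).neg.of_le (by norm_num))]
  have : fderiv ℝ (fun x => - fderiv ℝ ρ x (ee i, 0)) (p - q) = - fderiv ℝ (fun x => fderiv ℝ ρ x (ee i, 0)) (p - q) :=
    fderiv_fun_neg
  rw [this]; simp



/-- bumps -/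
def bmp (N : ℕ) (n : ℕ) : ContDiffBump (0 : Euc N × ℝ) :=
  ⟨1/(2*((n:ℝ)+1)), 1/((n:ℝ)+1), by positivity, by
    apply one_div_lt_one_div_of_lt <;> have := n.cast_nonneg (α := ℝ) <;> linarith⟩

/-- normalized bumps -/
def rb (N : ℕ) (n : ℕ) : Euc N × ℝ → ℝ := (bmp N n).normed volume

theorem bmp_rOut (N n : ℕ) : (bmp N n).rOut = 1/((n:ℝ)+1) := rfl

theorem rb_cd (N n : ℕ) {k : ℕ∞} : ContDiff ℝ k (rb N n) := ContDiffBump.contDiff_normed _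
theorem rb_nn (N n : ℕ) (p) : 0 ≤ rb N n p := ContDiffBump.nonneg_normed _ _
theorem rb_cs (N n : ℕ) : HasCompactSupport (rb N n) := ContDiffBump.hasCompactSupport_normed _
theorem rb_ts (N n : ℕ) : tsupport (rb N n) = Metric.closedBall 0 (1/((n:ℝ)+1)) :=
  ContDiffBump.tsupport_normed_eq _
theorem rb_int (N n : ℕ) : ∫ p, rb N n p = 1 := ContDiffBump.integral_normed _
theorem rb_integrable (N n : ℕ) : Integrable (rb N n) :=
  (rb_cd N n (k := 1)).continuous.integrable_of_hasCompactSupport (rb_cs N n)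

theorem rb_ae {N : ℕ} {w : Euc N × ℝ → ℝ} (hw : Integrable w) :
    ∀ᵐ p, Tendsto (fun n => moll (rb N n) w p) atTop (𝓝 (w p)) := by
  have := ContDiffBump.ae_convolution_tendsto_right_of_locallyIntegrable (μ := (volume : Measure (Euc N × ℝ)))
    (φ := bmp N) (l := atTop) (K := 2) (g := w) tendsto_one_div_add_atTop_nhds_zero_nat
    (Eventually.of_forall fun n => by
      change 1/((n:ℝ)+1) ≤ 2 * (1/(2*((n:ℝ)+1)))
      apply le_of_eq; field_simp) hw.locallyIntegrable
  filter_upwards [this] with p hp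
  convert hp using 2 with n
  rw [convolution_eq_swap]
  unfold moll
  refine integral_congr_ae (Eventually.of_forall fun q => ?_)
  change w q * rb N n (p - q) = rb N n (p-q) * w q
  ring

theorem moll_integrable {N : ℕ} {w : Euc N × ℝ → ℝ} (hw : Integrable w) (n : ℕ) :
    Integrable (moll (rb N n) w) :=
  hw.integrable_convolution (ContinuousLinearMap.mul ℝ ℝ) (rb_integrable N n)

theorem moll_norm {N : ℕ} {w : Euc N × ℝ → ℝ} (hw : Integrable w) (n : ℕ) :
    ∫ p, |moll (rb N n) w p| ≤ ∫ p, |w p| := by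
  have h1 : ∫ p, moll (rb N n) (fun q => |w q|) p = ∫ p, |w p| := by
    have := integral_convolution (L := ContinuousLinearMap.mul ℝ ℝ) (hw.abs) (rb_integrable N n)
    rw [rb_int] at this
    exact this.trans (by simp)
  rw [← h1]
  refine integral_mono (moll_integrable hw n).abs (moll_integrable hw.abs n) fun p => ?_
  unfold moll
  refine (abs_integral_le_integral_abs).trans (le_of_eq (integral_congr_ae (Eventually.of_forall fun q => ?_)))
  simp only [abs_mul, abs_of_nonneg (rb_nn N n _)]

theorem moll_L1 {N : ℕ} {w : Euc N × ℝ → ℝ} (hw : Integrable w) :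
    Tendsto (fun n => ∫ p, |moll (rb N n) w p - w p|) atTop (𝓝 0) := by
  have hi := fun n => moll_integrable hw n
  have h1 : Tendsto (fun n => ∫ p, (|moll (rb N n) w p - w p| - |moll (rb N n) w p| + |w p|)) atTop
      (𝓝 (∫ p : Euc N × ℝ, (0:ℝ))) := by
    refine tendsto_integral_of_dominated_convergence (fun p => 2 * |w p|) (fun n => ?_) (hw.abs.const_mul 2)
      (fun n => Eventually.of_forall fun p => ?_) ?_
    · exact ((((hi n).sub hw).abs.sub (hi n).abs).add hw.abs).aestronglyMeasurable
    · rw [Real.norm_eq_abs, abs_le]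
      have := abs_sub_abs_le_abs_sub (moll (rb N n) w p) (w p)
      have := abs_sub (moll (rb N n) w p) (w p)
      have := abs_nonneg (w p)
      constructor <;> linarith
    · filter_upwards [rb_ae hw] with p hp
      have : Tendsto (fun n => |moll (rb N n) w p - w p| - |moll (rb N n) w p| + |w p|) atTop
        (𝓝 (|w p - w p| - |w p| + |w p|)) := ((hp.sub_const _).abs.sub hp.abs).add_const _
      simpa using this
  rw [integral_zero] at h1
  refine squeeze_zero (fun n => integral_nonneg fun p => abs_nonneg _) (fun n => ?_) h1
  have e : ∫ p, (|moll (rb N n) w p - w p| - |moll (rb N n) w p| + |w p|) =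
      (∫ p, |moll (rb N n) w p - w p|) - (∫ p, |moll (rb N n) w p|) + ∫ p, |w p| := by
    have a1 : Integrable (fun p => |moll (rb N n) w p - w p|) := ((hi n).sub hw).abs
    have a2 : Integrable (fun p => |moll (rb N n) w p|) := (hi n).abs
    have a3 : Integrable (fun p => |w p|) := hw.abs
    have a4 : Integrable (fun p => |moll (rb N n) w p - w p| - |moll (rb N n) w p|) := a1.sub a2
    rw [integral_add a4 a3, integral_sub a1 a2]
  have := moll_norm hw n
  linarith

theorem moll_sub {N : ℕ} {U : Set (Euc N × ℝ)} {w F : Euc N × ℝ → ℝ} (hw : Integrable w) (hF : Integrable F)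
    (h : ∀ ζ, Tst U ζ → ∫ p, (-(w p * heatAdj (cur ζ) p) + F p * ζ p) ≤ 0) {p : Euc N × ℝ} {n : ℕ}
    (hp : Metric.closedBall p (1/((n:ℝ)+1)) ⊆ U) :
    hop (moll (rb N n) w) p + moll (rb N n) F p ≤ 0 := by
  have hs : ContDiff ℝ 3 (rb N n) := rb_cd N n (k := 3)
  have hT : Tst U (fun q => rb N n (p - q)) := by
    have hsup : tsupport (fun q => rb N n (p - q)) ⊆ Metric.closedBall p (1/((n:ℝ)+1)) := by
      refine closure_minimal (fun q hq => ?_) Metric.isClosed_closedBall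
      have : p - q ∈ tsupport (rb N n) := subset_tsupport _ hq
      rw [rb_ts, mem_closedBall_zero_iff] at this
      rw [Metric.mem_closedBall, dist_comm, dist_eq_norm]; exact this
    exact ⟨hs.comp (contDiff_const.sub contDiff_id), fun q => rb_nn _ _ _,
      HasCompactSupport.of_support_subset_isCompact (isCompact_closedBall p (1/((n:ℝ)+1)))
        ((subset_tsupport _).trans hsup), hsup.trans hp⟩
  have := h _ hT
  have e : ∀ q, -(w q * heatAdj (cur (fun q => rb N n (p - q))) q) + F q * rb N n (p - q) =
     w q * hop (rb N n) (p - q) + F q * rb N n (p - q) := fun q => by rw [heatAdj_refl hs]; ring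
  simp_rw [e] at this
  rw [moll_hop hs (rb_cs N n) hw]
  unfold moll
  have hcs : HasCompactSupport (hop (rb N n)) := by
    refine HasCompactSupport.intro (rb_cs N n).isCompact fun q hq => ?_
    rw [notMem_tsupport_iff_eventuallyEq] at hq
    unfold hop dd
    have h1 : ∀ v, (fun r => fderiv ℝ (rb N n) r v) =ᶠ[𝓝 q] fun _ => 0 := fun v => by
      filter_upwards [hq.fderiv (𝕜 := ℝ)] with r hr
      rw [hr]; simp
    have h2 : ∀ v : Euc N × ℝ, fderiv ℝ (fun r => fderiv ℝ (rb N n) r v) q v = 0 := fun v => by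
      rw [(h1 v).fderiv_eq]; simp
    simp only [h2]
    rw [hq.fderiv_eq]; simp
  obtain ⟨C, hC⟩ := hcs.exists_bound_of_continuous (hop_cont hs)
  obtain ⟨C', hC'⟩ := (rb_cs N n).exists_bound_of_continuous hs.continuous
  have hcont : Continuous fun q : Euc N × ℝ => hop (rb N n) (p - q) := (hop_cont hs).comp (by fun_prop)
  have hcont' : Continuous fun q : Euc N × ℝ => rb N n (p - q) := hs.continuous.comp (by fun_prop)
  have i1 : Integrable (fun q => w q * hop (rb N n) (p - q)) :=
    hw.mul_bdd (c := C) hcont.aestronglyMeasurable (Eventually.of_forall fun q => hC _)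
  have i2 : Integrable (fun q => F q * rb N n (p - q)) :=
    hF.mul_bdd (c := C') hcont'.aestronglyMeasurable (Eventually.of_forall fun q => hC' _)
  rwa [integral_add i1 i2] at this

theorem cs_bounds {N : ℕ} {ζ : Euc N × ℝ → ℝ} (hs : ContDiff ℝ 3 ζ) (hc : HasCompactSupport ζ) :
    ∃ C, (∀ p, |ζ p| ≤ C) ∧ ∀ p, |heatAdj (cur ζ) p| ≤ C := by
  obtain ⟨C, hC⟩ := (heatAdj_compact (ζ := cur ζ) hc).exists_bound_of_continuous (C21_of_contDiff hs).heatAdj_cont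
  obtain ⟨C', hC'⟩ := hc.exists_bound_of_continuous hs.continuous
  exact ⟨max C C', fun p => (hC' p).trans (le_max_right _ _), fun p => (hC p).trans (le_max_left _ _)⟩

theorem kato_smooth {N : ℕ} {U : Set (Euc N × ℝ)} (hU : IsOpen U) {w F : Euc N × ℝ → ℝ}
    (hw : Integrable w) (hF : Integrable F)
    (h : ∀ ζ, Tst U ζ → ∫ p, (-(w p * heatAdj (cur ζ) p) + F p * ζ p) ≤ 0)
    {J d d' : ℝ → ℝ} (hJ : ∀ s, HasDerivAt J (d s) s)
    (hd : ∀ s, HasDerivAt d (d' s) s) (hd' : Continuous d') (hd'0 : ∀ s, 0 ≤ d' s) (hd0 : ∀ s, 0 ≤ d s)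
    (hd1 : ∀ s, d s ≤ 1) (hJ0 : J 0 = 0) {ζ : Euc N × ℝ → ℝ} (hζ : Tst U ζ) :
    ∫ p, (-(J (w p) * heatAdj (cur ζ) p) + F p * d (w p) * ζ p) ≤ 0 := by
  have hJc : Continuous J := continuous_iff_continuousAt.mpr fun x => (hJ x).continuousAt
  have hdc : Continuous d := continuous_iff_continuousAt.mpr fun x => (hd x).continuousAt
  have hL : ∀ a b, |J a - J b| ≤ |a - b| := by
    intro a b
    have := Convex.norm_image_sub_le_of_norm_hasDerivWithin_le (f := J) (f' := d) (C := 1) (s := univ) (x := b) (y := a)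
      (fun x _ => (hJ x).hasDerivWithinAt) (fun x _ => by
        rw [Real.norm_eq_abs, abs_of_nonneg (hd0 x)]; exact hd1 x) convex_univ (mem_univ _) (mem_univ _)
    simpa using this
  obtain ⟨C, hC, hC'⟩ := cs_bounds hζ.sm hζ.cs
  have hAc : Continuous (heatAdj (cur ζ)) := (C21_of_contDiff hζ.sm).heatAdj_cont
  have hζc := hζ.sm.continuous
  have hda : ∀ s, |d s| ≤ 1 := fun s => by rw [abs_of_nonneg (hd0 s)]; exact hd1 s
  -- integrability
  have iJ : ∀ v : Euc N × ℝ → ℝ, Integrable v → Integrable (fun p => J (v p)) := fun v hv =>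
    hv.mono (hJc.comp_aestronglyMeasurable hv.aestronglyMeasurable) (Eventually.of_forall fun p => by
      have := hL (v p) 0
      simpa [hJ0] using this)
  have iJA : ∀ v : Euc N × ℝ → ℝ, Integrable v → Integrable (fun p => J (v p) * heatAdj (cur ζ) p) := fun v hv =>
    (iJ v hv).mul_bdd (c := C) hAc.aestronglyMeasurable (Eventually.of_forall hC')
  have iFd : ∀ v G : Euc N × ℝ → ℝ, Integrable v → Integrable G → Integrable (fun p => G p * d (v p) * ζ p) :=
    fun v G hv hG => (hG.mul_bdd (c := 1) (hdc.comp_aestronglyMeasurable hv.aestronglyMeasurable)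
      (Eventually.of_forall fun p => hda _)).mul_bdd (c := C) hζc.aestronglyMeasurable (Eventually.of_forall hC)
  have hI : ∀ n, Integrable (moll (rb N n) w) := moll_integrable hw
  have hG : ∀ n, Integrable (moll (rb N n) F) := moll_integrable hF
  -- eventually inequality
  obtain ⟨δ, hδ, hδU⟩ := hζ.cs.isCompact.exists_cthickening_subset_open hU hζ.sub
  have hev : ∀ᶠ n : ℕ in atTop, -(∫ p, J (moll (rb N n) w p) * heatAdj (cur ζ) p) +
      (∫ p, moll (rb N n) F p * d (moll (rb N n) w p) * ζ p) ≤ 0 := by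
    have h0 := (tendsto_one_div_add_atTop_nhds_zero_nat (𝕜 := ℝ)).eventually (gt_mem_nhds hδ)
    filter_upwards [h0] with n hn
    have hm : ContDiff ℝ 3 (moll (rb N n) w) := moll_contDiff (n := 3) (rb_cd N n) (rb_cs N n) hw
    have h1 := convex_chain hm hζ.sm hζ.nn hζ.cs hJ hd hd' hd'0
    have h2 : ∫ p, d (moll (rb N n) w p) * hop (moll (rb N n) w) p * ζ p ≤
        ∫ p, -(moll (rb N n) F p * d (moll (rb N n) w p) * ζ p) := by
      have hcm := hm.continuous
      have hch := hop_cont hm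
      refine integral_mono ?_ (iFd _ _ (hI n) (hG n)).neg fun p => ?_
      · refine Continuous.integrable_of_hasCompactSupport (by fun_prop) ?_
        exact hζ.cs.mul_left
      · by_cases hp : p ∈ tsupport ζ
        · have hb : Metric.closedBall p (1/((n:ℝ)+1)) ⊆ U :=
            (Metric.closedBall_subset_closedBall hn.le).trans
              ((Metric.closedBall_subset_cthickening hp δ).trans hδU)
          have := moll_sub hw hF h hb
          have h3 : d (moll (rb N n) w p) * hop (moll (rb N n) w) p ≤ - (moll (rb N n) F p * d (moll (rb N n) w p)) := by
            nlinarith [hd0 (moll (rb N n) w p)]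
          simpa using mul_le_mul_of_nonneg_right h3 (hζ.nn p)
        · simp [image_eq_zero_of_notMem_tsupport hp]
    rw [integral_neg] at h2
    linarith
  -- limits
  have l1 : Tendsto (fun n => ∫ p, J (moll (rb N n) w p) * heatAdj (cur ζ) p) atTop
      (𝓝 (∫ p, J (w p) * heatAdj (cur ζ) p)) := by
    rw [tendsto_iff_norm_sub_tendsto_zero]
    refine squeeze_zero (fun _ => norm_nonneg _) (fun n => ?_)
      (by simpa using (moll_L1 hw).mul_const C)
    rw [← integral_sub (iJA _ (hI n)) (iJA _ hw), ← integral_mul_const]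
    refine norm_integral_le_of_norm_le (((hI n).sub hw).abs.mul_const C) (Eventually.of_forall fun p => ?_)
    rw [← sub_mul, norm_mul]
    exact mul_le_mul (hL _ _) (hC' p) (norm_nonneg _) (abs_nonneg _)
  have l2 : Tendsto (fun n => ∫ p, F p * d (moll (rb N n) w p) * ζ p) atTop
      (𝓝 (∫ p, F p * d (w p) * ζ p)) := by
    refine tendsto_integral_of_dominated_convergence (fun p => |F p| * C) (fun n => (iFd _ _ (hI n) hF).aestronglyMeasurable)
      (hF.abs.mul_const C) (fun n => Eventually.of_forall fun p => ?_) ?_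
    · rw [norm_mul, norm_mul]
      refine mul_le_mul ?_ (hC p) (norm_nonneg _) (abs_nonneg _)
      have := hda (moll (rb N n) w p)
      simp only [Real.norm_eq_abs]
      nlinarith [abs_nonneg (F p)]
    · filter_upwards [rb_ae hw] with p hp
      exact ((((hdc.tendsto _).comp hp).const_mul _).mul_const _)
  have l3 : Tendsto (fun n => ∫ p, moll (rb N n) F p * d (moll (rb N n) w p) * ζ p) atTop
      (𝓝 (∫ p, F p * d (w p) * ζ p)) := by
    have : Tendsto (fun n => (∫ p, moll (rb N n) F p * d (moll (rb N n) w p) * ζ p) - ∫ p, F p * d (moll (rb N n) w p) * ζ p) atTop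
        (𝓝 0) := by
      rw [tendsto_zero_iff_norm_tendsto_zero]
      refine squeeze_zero (fun _ => norm_nonneg _) (fun n => ?_)
        (by simpa using (moll_L1 hF).mul_const C)
      rw [← integral_sub (iFd _ _ (hI n) (hG n)) (iFd _ _ (hI n) hF), ← integral_mul_const]
      refine norm_integral_le_of_norm_le (((hG n).sub hF).abs.mul_const C) (Eventually.of_forall fun p => ?_)
      rw [← sub_mul, ← sub_mul, norm_mul, norm_mul]
      refine mul_le_mul ?_ (hC p) (norm_nonneg _) (abs_nonneg _)
      have := hda (moll (rb N n) w p)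
      simp only [Real.norm_eq_abs, Pi.sub_apply]
      nlinarith [abs_nonneg (moll (rb N n) F p - F p)]
    simpa using this.add l2
  have := le_of_tendsto (l1.neg.add l3) hev
  have i1 : Integrable (fun p => -(J (w p) * heatAdj (cur ζ) p)) := (iJA _ hw).neg
  rw [integral_add i1 (iFd _ _ hw hF), integral_neg]
  exact this

theorem kato {N : ℕ} {U : Set (Euc N × ℝ)} (hU : IsOpen U) {w F : Euc N × ℝ → ℝ}
    (hw : Integrable w) (hF : Integrable F)
    (h : ∀ ζ, Tst U ζ → ∫ p, (-(w p * heatAdj (cur ζ) p) + F p * ζ p) ≤ 0)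
    {ζ : Euc N × ℝ → ℝ} (hζ : Tst U ζ) :
    ∫ p, (-(max (w p) 0 * heatAdj (cur ζ) p) + F p * (if 0 < w p then 1 else 0) * ζ p) ≤ 0 := by
  obtain ⟨C, hC, hC'⟩ := cs_bounds hζ.sm hζ.cs
  have hAc : Continuous (heatAdj (cur ζ)) := (C21_of_contDiff hζ.sm).heatAdj_cont
  have hζc := hζ.sm.continuous
  have hst : ContDiff ℝ 2 Real.smoothTransition := Real.smoothTransition.contDiff
  let d : ℕ → ℝ → ℝ := fun k s => Real.smoothTransition (k * s)
  have hdC : ∀ k, ContDiff ℝ 2 (d k) := fun k => hst.comp (contDiff_const.mul contDiff_id)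
  let J : ℕ → ℝ → ℝ := fun k s => ∫ x in (0:ℝ)..s, d k x
  have hJ : ∀ k s, HasDerivAt (J k) (d k s) s := fun k s =>
    intervalIntegral.integral_hasDerivAt_right ((hdC k).continuous.intervalIntegrable _ _)
      ((hdC k).continuous.stronglyMeasurableAtFilter _ _) (hdC k).continuous.continuousAt
  have hJ0 : ∀ k, J k 0 = 0 := fun k => by simp [J]
  have hd0 : ∀ k s, 0 ≤ d k s := fun k s => Real.smoothTransition.nonneg _
  have hd1 : ∀ k s, d k s ≤ 1 := fun k s => Real.smoothTransition.le_one _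
  have hmono : ∀ k, Monotone (d k) := fun k a b hab =>
    Real.smoothTransition.monotone (mul_le_mul_of_nonneg_left hab k.cast_nonneg)
  have hk := fun k => kato_smooth hU hw hF h (hJ k) (fun s => ((hdC k).differentiable (by norm_num) s).hasDerivAt)
    ((hdC k).continuous_deriv (by norm_num)) (fun s => (hmono k).deriv_nonneg) (hd0 k) (hd1 k) (hJ0 k) hζ
  have hL : ∀ k a, |J k a| ≤ |a| := by
    intro k a
    have := Convex.norm_image_sub_le_of_norm_hasDerivWithin_le (f := J k) (f' := d k) (C := 1) (s := univ) (x := 0) (y := a)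
      (fun x _ => (hJ k x).hasDerivWithinAt) (fun x _ => by
        rw [Real.norm_eq_abs, abs_of_nonneg (hd0 k x)]; exact hd1 k x) convex_univ (mem_univ _) (mem_univ _)
    simpa [hJ0] using this
  have hdl : ∀ s, Tendsto (fun k => d k s) atTop (𝓝 (if 0 < s then 1 else 0)) := by
    intro s
    split_ifs with hs
    · refine tendsto_const_nhds.congr' ?_
      obtain ⟨n, hn⟩ := exists_nat_ge (1/s)
      filter_upwards [eventually_ge_atTop n] with k hk
      refine (Real.smoothTransition.one_of_one_le ?_).symm
      rw [div_le_iff₀ hs] at hn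
      have : (n:ℝ) ≤ k := by exact_mod_cast hk
      nlinarith
    · refine tendsto_const_nhds.congr fun k => ?_
      exact (Real.smoothTransition.zero_of_nonpos (mul_nonpos_of_nonneg_of_nonpos k.cast_nonneg (not_lt.mp hs))).symm
  have hJl : ∀ s, Tendsto (fun k => J k s) atTop (𝓝 (max s 0)) := by
    intro s
    have h1 : Tendsto (fun k => J k s) atTop (𝓝 (∫ x in (0:ℝ)..s, if 0 < x then 1 else 0)) := by
      refine intervalIntegral.tendsto_integral_filter_of_dominated_convergence (fun _ => 1)
        (Eventually.of_forall fun k => (hdC k).continuous.aestronglyMeasurable) (Eventually.of_forall fun k => Eventually.of_forall fun x _ => ?_)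
        (by simp) (Eventually.of_forall fun x _ => hdl x)
      rw [Real.norm_eq_abs, abs_of_nonneg (hd0 k x)]; exact hd1 k x
    convert h1 using 2
    rcases le_total s 0 with hs | hs
    · rw [max_eq_right hs, intervalIntegral.integral_symm, intervalIntegral.integral_of_le hs]
      rw [setIntegral_congr_fun (g := fun _ => (0:ℝ)) measurableSet_Ioc]
      · simp
      · intro x hx
        simp [hx.2]
    · rw [max_eq_left hs, intervalIntegral.integral_of_le hs]
      rw [setIntegral_congr_fun (g := fun _ => (1:ℝ)) measurableSet_Ioc]
      · simp [hs]
      · intro x hx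
        simp [hx.1]
  have hJc : ∀ k, Continuous (J k) := fun k => continuous_iff_continuousAt.mpr fun x => (hJ k x).continuousAt
  have hdc := fun k => (hdC k).continuous
  refine le_of_tendsto (tendsto_integral_of_dominated_convergence (fun p => |w p| * C + |F p| * C) (fun k => ?_)
    ((hw.abs.mul_const C).add (hF.abs.mul_const C)) (fun k => Eventually.of_forall fun p => ?_)
    (Eventually.of_forall fun p => ?_)) (Eventually.of_forall hk)
  · exact (((hJc k).comp_aestronglyMeasurable hw.aestronglyMeasurable).mul hAc.aestronglyMeasurable).neg.add
      ((hF.aestronglyMeasurable.mul ((hdc k).comp_aestronglyMeasurable hw.aestronglyMeasurable)).mul hζc.aestronglyMeasurable)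
  · refine (norm_add_le _ _).trans (add_le_add ?_ ?_)
    · rw [norm_neg, norm_mul]
      exact mul_le_mul (hL k _) (hC' p) (norm_nonneg _) (abs_nonneg _)
    · rw [norm_mul, norm_mul]
      refine mul_le_mul ?_ (hC p) (norm_nonneg _) (abs_nonneg _)
      have : |d k (w p)| ≤ 1 := by rw [abs_of_nonneg (hd0 k _)]; exact hd1 k _
      simp only [Real.norm_eq_abs]
      nlinarith [abs_nonneg (F p)]
  · exact (((hJl _).mul_const _).neg).add (((hdl _).const_mul _).mul_const _)



theorem kato_on {N : ℕ} {U : Set (Euc N × ℝ)} (hU : IsOpen U) {w F : Euc N × ℝ → ℝ}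
    (hw : IntegrableOn w U) (hF : IntegrableOn F U)
    (h : ∀ ζ, Tst U ζ → ∫ p, (-(w p * heatAdj (cur ζ) p) + F p * ζ p) ≤ 0)
    {ζ : Euc N × ℝ → ℝ} (hζ : Tst U ζ) :
    ∫ p, (-(max (w p) 0 * heatAdj (cur ζ) p) + F p * (if 0 < w p then 1 else 0) * ζ p) ≤ 0 := by
  have hz : ∀ ζ, Tst U ζ → ∀ p, p ∉ U → heatAdj (cur ζ) p = 0 ∧ ζ p = 0 := fun ζ hζ p hp =>
    ⟨heatAdj_zero_of (ζ := cur ζ) (fun hh => hp (hζ.sub hh)), image_eq_zero_of_notMem_tsupport (fun hh => hp (hζ.sub hh))⟩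
  have := kato hU (hw.integrable_indicator hU.measurableSet) (hF.integrable_indicator hU.measurableSet)
    (fun ζ hζ => by
      refine le_of_eq_of_le (integral_congr_ae (Eventually.of_forall fun p => ?_)) (h ζ hζ)
      by_cases hp : p ∈ U
      · simp [hp]
      · simp [hz ζ hζ p hp]) hζ
  refine le_of_eq_of_le (integral_congr_ae (Eventually.of_forall fun p => ?_)) this
  by_cases hp : p ∈ U
  · simp [hp]
  · simp [hz ζ hζ p hp]

theorem kato_int {N : ℕ} {U : Set (Euc N × ℝ)} (hU : IsOpen U) {w F : Euc N × ℝ → ℝ}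
    (hw : IntegrableOn w U) (hF : IntegrableOn F U) {ζ : Euc N × ℝ → ℝ} (hζ : Tst U ζ) :
    Integrable (fun p => max (w p) 0 * heatAdj (cur ζ) p) ∧
    Integrable (fun p => F p * (if 0 < w p then 1 else 0) * ζ p) := by
  have hz : ∀ p, p ∉ U → heatAdj (cur ζ) p = 0 ∧ ζ p = 0 := fun p hp =>
    ⟨heatAdj_zero_of (ζ := cur ζ) (fun hh => hp (hζ.sub hh)), image_eq_zero_of_notMem_tsupport (fun hh => hp (hζ.sub hh))⟩
  obtain ⟨C, hC, hC'⟩ := cs_bounds hζ.sm hζ.cs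
  have hAc : Continuous (heatAdj (cur ζ)) := (C21_of_contDiff hζ.sm).heatAdj_cont
  have iw := hw.integrable_indicator hU.measurableSet
  have iF := hF.integrable_indicator hU.measurableSet
  constructor
  · refine (iw.pos_part.mul_bdd (c := C) hAc.aestronglyMeasurable (Eventually.of_forall hC')).congr (Eventually.of_forall fun p => ?_)
    by_cases hp : p ∈ U
    · simp [hp]
    · simp [hz p hp]
  · have h1 : NullMeasurableSet {p | 0 < U.indicator w p} volume :=
      nullMeasurableSet_lt aemeasurable_const iw.aemeasurable
    refine ((iF.indicator₀ h1).mul_bdd (c := C) hζ.sm.continuous.aestronglyMeasurable (Eventually.of_forall hC)).congr (Eventually.of_forall fun p => ?_)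
    by_cases hp : p ∈ U
    · by_cases h2 : 0 < w p
      · simp [indicator, hp, h2]
      · simp [indicator, hp, h2]
    · simp [hz p hp]

theorem slab_integrable {N : ℕ} {w : Euc N × ℝ → ℝ} {l : ℝ} (hl : 0 < l)
    (hw : Integrable (fun p => Real.exp (-l * p.2) * w p)) (M : ℝ) :
    IntegrableOn w {p | p.2 < M} := by
  have hS : MeasurableSet {p : Euc N × ℝ | p.2 < M} := measurableSet_lt measurable_snd measurable_const
  rw [← integrable_indicator_iff hS]
  have hm : Measurable (fun p : Euc N × ℝ => {p : Euc N × ℝ | p.2 < M}.indicator (fun p => min (Real.exp (l * p.2)) (Real.exp (l * M))) p) :=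
    Measurable.indicator (by fun_prop) hS
  have := hw.bdd_mul (c := Real.exp (l * M)) hm.aestronglyMeasurable (Eventually.of_forall fun p => ?_)
  · refine this.congr (Eventually.of_forall fun p => ?_)
    by_cases hp : p.2 < M
    · simp only [indicator, mem_ofPred_eq, hp, if_true]
      rw [min_eq_left (Real.exp_le_exp.mpr (by nlinarith)), ← mul_assoc, ← Real.exp_add]
      simp
    · simp [indicator, hp]
  · by_cases hp : p.2 < M
    · simp only [indicator, mem_ofPred_eq, hp, if_true]
      rw [Real.norm_eq_abs, abs_of_nonneg (by positivity)]; exact min_le_right _ _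
    · simp [indicator, hp]; positivity

theorem lap_smul_const {N : ℕ} {a : Euc N → ℝ} (ha : ContDiff ℝ 3 a) (c : ℝ) (x : Euc N) :
    lap (fun y => a y * c) x = lap a x * c := by
  unfold lap
  rw [Finset.sum_mul]
  refine Finset.sum_congr rfl fun i _ => ?_
  have h1 : (fun y => fderiv ℝ (fun y => a y * c) y (EuclideanSpace.single i 1)) =
      fun y => fderiv ℝ a y (EuclideanSpace.single i 1) * c := by
    ext y
    rw [fderiv_mul_const (ha.differentiable (by norm_num) y)]
    simp [mul_comm]
  rw [h1, fderiv_mul_const]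
  · simp [mul_comm]
  · have := (ha.fderiv_right (m := 2) (by norm_num)).clm_apply (contDiff_const (c := (EuclideanSpace.single i (1:ℝ) : Euc N)))
    exact this.differentiable (by norm_num) x

theorem heatAdj_prod {N : ℕ} {a : Euc N → ℝ} {b : ℝ → ℝ} (ha : ContDiff ℝ 3 a) (hb : ContDiff ℝ 3 b) (p : Euc N × ℝ) :
    heatAdj (cur (fun p => a p.1 * b p.2)) p = a p.1 * deriv b p.2 + lap a p.1 * b p.2 := by
  unfold heatAdj cur
  simp only
  rw [lap_smul_const ha, deriv_const_mul _ (hb.differentiable (by norm_num) _)]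

theorem lap_scale {N : ℕ} {a : Euc N → ℝ} (ha : ContDiff ℝ 3 a) (c : ℝ) (x : Euc N) :
    lap (fun y => a (c • y)) x = c^2 * lap a (c • x) := by
  unfold lap
  rw [Finset.mul_sum]
  refine Finset.sum_congr rfl fun i _ => ?_
  have h0 : ∀ {h : Euc N → ℝ} (_ : ContDiff ℝ 1 h) (y v : Euc N), fderiv ℝ (fun y => h (c • y)) y v = c * fderiv ℝ h (c • y) v := by
    intro h hh y v
    have a1 : HasFDerivAt h (fderiv ℝ h (c • y)) (c • y) := (hh.differentiable (by norm_num) _).hasFDerivAt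
    have a2 := a1.comp y ((hasFDerivAt_id y).const_smul c)
    have a3 : fderiv ℝ (fun y => h (c • y)) y = _ := a2.fderiv
    rw [a3]; simp
  have h1 : (fun y => fderiv ℝ (fun y => a (c • y)) y (EuclideanSpace.single i 1)) =
      fun y => (fun z => c * fderiv ℝ a z (EuclideanSpace.single i 1)) (c • y) := by
    ext y
    exact h0 (ha.of_le (by norm_num)) _ _
  have h2 := (ha.fderiv_right (m := 2) (by norm_num)).clm_apply (contDiff_const (c := (EuclideanSpace.single i (1:ℝ) : Euc N)))
  rw [h1, h0 ((contDiff_const.mul h2).of_le (by norm_num)), fderiv_const_mul (h2.differentiable (by norm_num) _)]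
  simp
  ring

theorem lap_cont {N : ℕ} {a : Euc N → ℝ} (ha : ContDiff ℝ 3 a) : Continuous (lap a) := by
  unfold lap
  refine continuous_finsetSum _ fun i _ => ?_
  have h2 := (ha.fderiv_right (m := 2) (by norm_num)).clm_apply (contDiff_const (c := (EuclideanSpace.single i (1:ℝ) : Euc N)))
  exact (h2.continuous_fderiv (by norm_num)).clm_apply continuous_const

theorem lap_zero_of {N : ℕ} {a : Euc N → ℝ} {x : Euc N} (c : ℝ) (h : a =ᶠ[𝓝 x] fun _ => c) : lap a x = 0 := by
  unfold lap
  refine Finset.sum_eq_zero fun i _ => ?_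
  have h1 : (fun y => fderiv ℝ a y (EuclideanSpace.single i 1)) =ᶠ[𝓝 x] fun _ => 0 := by
    filter_upwards [h.fderiv (𝕜 := ℝ)] with r hr
    rw [hr]; simp
  rw [h1.fderiv_eq]; simp

/-- a time cutoff -/
def tc (M : ℝ) (t : ℝ) : ℝ := Real.smoothTransition (t + 2) * (Real.smoothTransition (M - t) * (M + 1 - t))

theorem tc_cd (M : ℝ) {n : ℕ∞} : ContDiff ℝ n (tc M) := by
  have := Real.smoothTransition.contDiff (n := n)
  exact (this.comp (contDiff_id.add contDiff_const)).mul
    ((this.comp (contDiff_const.sub contDiff_id)).mul (contDiff_const.sub contDiff_id))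

theorem tc_nn (M t : ℝ) : 0 ≤ tc M t := by
  unfold tc
  by_cases h : t ≤ M
  · exact mul_nonneg (Real.smoothTransition.nonneg _) (mul_nonneg (Real.smoothTransition.nonneg _) (by linarith))
  · rw [Real.smoothTransition.zero_of_nonpos (x := M - t) (by linarith)]; simp

theorem tc_supp (M : ℝ) (t : ℝ) (h : t ∉ Icc (-2) M) : tc M t = 0 := by
  unfold tc
  by_cases h' : t ≤ M
  · rw [Real.smoothTransition.zero_of_nonpos (x := t + 2)]; · simp
    by_contra h2
    exact h ⟨by linarith, h'⟩
  · rw [Real.smoothTransition.zero_of_nonpos (x := M - t) (by linarith)]; simp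

theorem tc_deriv (M t : ℝ) (ht : 0 ≤ t) : Real.smoothTransition (M - t) ≤ - deriv (tc M) t := by
  have h1 : tc M =ᶠ[𝓝 t] fun t => Real.smoothTransition (M - t) * (M + 1 - t) := by
    filter_upwards [lt_mem_nhds (show (-1:ℝ) < t by linarith)] with s hs
    unfold tc
    rw [Real.smoothTransition.one_of_one_le (by linarith), one_mul]
  have hS : ContDiff ℝ 1 Real.smoothTransition := Real.smoothTransition.contDiff
  have h2 : HasDerivAt (fun t => Real.smoothTransition (M - t) * (M + 1 - t))
     ((- deriv Real.smoothTransition (M - t)) * (M + 1 - t) + Real.smoothTransition (M - t) * (-1)) t := by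
    refine HasDerivAt.mul ?_ ((hasDerivAt_id t).const_sub _)
    have := HasDerivAt.comp t (h := fun t => M - t) ((hS.differentiable (by norm_num) (M - t)).hasDerivAt) ((hasDerivAt_id t).const_sub M)
    rw [mul_neg_one] at this
    exact this
  rw [h1.deriv_eq, h2.deriv]
  have h3 : 0 ≤ deriv Real.smoothTransition (M - t) := Real.smoothTransition.monotone.deriv_nonneg
  by_cases h : t ≤ M + 1
  · nlinarith [mul_nonneg h3 (by linarith : 0 ≤ M + 1 - t)]
  · have : deriv Real.smoothTransition (M - t) = 0 := by
      have : Real.smoothTransition =ᶠ[𝓝 (M - t)] fun _ => 0 := by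
        filter_upwards [gt_mem_nhds (show M - t < 0 by linarith)] with s hs
        exact Real.smoothTransition.zero_of_nonpos hs.le
      rw [this.deriv_eq]; simp
    rw [this]; linarith

/-- space cutoff -/
def sc (N : ℕ) : ContDiffBump (0 : Euc N) := ⟨1, 2, by norm_num, by norm_num⟩

/-- space cutoff at scale j -/
def scj (N : ℕ) (j : ℕ) (x : Euc N) : ℝ := sc N (((j:ℝ)+1)⁻¹ • x)

theorem scj_cd (N j : ℕ) {n : ℕ∞} : ContDiff ℝ n (scj N j) :=
  (sc N).contDiff.comp (contDiff_const_smul _)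

theorem scj_one {N j : ℕ} {x : Euc N} (h : ‖x‖ ≤ j + 1) : scj N j x = 1 := by
  refine (sc N).one_of_mem_closedBall ?_
  rw [mem_closedBall_zero_iff, norm_smul, norm_inv, Real.norm_of_nonneg (by positivity)]
  change _ ≤ 1
  rw [inv_mul_le_iff₀ (by positivity)]; simpa using h

theorem scj_nn (N j : ℕ) (x : Euc N) : 0 ≤ scj N j x := (sc N).nonneg
theorem scj_le (N j : ℕ) (x : Euc N) : scj N j x ≤ 1 := (sc N).le_one

theorem scj_zero {N j : ℕ} {x : Euc N} (h : 2 * ((j:ℝ) + 1) ≤ ‖x‖) : scj N j x = 0 := by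
  refine (sc N).zero_of_le_dist ?_
  rw [dist_zero_right, norm_smul, norm_inv, Real.norm_of_nonneg (by positivity)]
  change 2 ≤ _
  rw [le_inv_mul_iff₀ (by positivity)]; linarith

theorem scj_lap (N : ℕ) : ∃ C, 0 ≤ C ∧ ∀ j x, |lap (scj N j) x| ≤ C := by
  have hc : ContDiff ℝ 3 (sc N : Euc N → ℝ) := (sc N).contDiff (n := 3)
  have : HasCompactSupport (lap (sc N : Euc N → ℝ)) := by
    refine HasCompactSupport.intro (sc N).hasCompactSupport.isCompact fun x hx => ?_
    rw [notMem_tsupport_iff_eventuallyEq] at hx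
    exact lap_zero_of 0 hx
  obtain ⟨C, hC⟩ := this.exists_bound_of_continuous (lap_cont hc)
  refine ⟨C, (norm_nonneg _).trans (hC 0), fun j x => ?_⟩
  have : lap (scj N j) x = _ := lap_scale hc (((j:ℝ)+1)⁻¹) x
  rw [this, abs_mul, abs_of_nonneg (by positivity)]
  have h1 : (((j:ℝ)+1)⁻¹)^2 ≤ 1 := by
    have : ((j:ℝ)+1)⁻¹ ≤ 1 := inv_le_one_of_one_le₀ (by linarith [j.cast_nonneg (α := ℝ)])
    exact pow_le_one₀ (by positivity) this
  calc _ ≤ 1 * C := mul_le_mul h1 (hC _) (abs_nonneg _) (by norm_num)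
    _ = C := one_mul _

theorem prod_Tst {N : ℕ} {a : Euc N → ℝ} {b : ℝ → ℝ} (ha : ContDiff ℝ 3 a) (hb : ContDiff ℝ 3 b)
    (ha0 : ∀ x, 0 ≤ a x) (hb0 : ∀ t, 0 ≤ b t) {K : Set (Euc N)} {I : Set ℝ} (hK : IsCompact K) (hI : IsCompact I)
    (hKa : ∀ x, x ∉ K → a x = 0) (hIb : ∀ t, t ∉ I → b t = 0) {U : Set (Euc N × ℝ)} (hU : K ×ˢ I ⊆ U) :
    Tst U (fun p => a p.1 * b p.2) := by
  have hs : Function.support (fun p : Euc N × ℝ => a p.1 * b p.2) ⊆ K ×ˢ I := by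
    intro p hp
    refine ⟨?_, ?_⟩
    · by_contra h; exact hp (by simp [hKa _ h])
    · by_contra h; exact hp (by simp [hIb _ h])
  exact ⟨(ha.comp contDiff_fst).mul (hb.comp contDiff_snd), fun p => mul_nonneg (ha0 _) (hb0 _),
    HasCompactSupport.of_support_subset_isCompact (hK.prod hI) hs,
    (closure_minimal hs (hK.prod hI).isClosed).trans hU⟩

theorem lemZ {N : ℕ} {w G : Euc N × ℝ → ℝ} {l : ℝ} (hl : 0 < l)
    (hw : Integrable (fun p => Real.exp (-l * p.2) * w p)) (hw0 : ∀ p, p.2 ≤ 0 → w p = 0)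
    (hG : Integrable (fun p => Real.exp (-l * p.2) * G p)) (hG0 : ∀ p, p.2 ≤ 0 → G p = 0)
    (h : ∀ ζ, Tst univ ζ → ∫ p, (-(w p * heatAdj (cur ζ) p) + G p * ζ p) ≤ 0)
    (hpos : ∀ᵐ p, 0 < w p → 0 ≤ G p) : ∀ᵐ p, w p ≤ 0 := by
  have hM : ∀ M : ℕ, ∀ᵐ p : Euc N × ℝ, p.2 < (M:ℝ) → w p ≤ 0 := by
    intro M
    let U : Set (Euc N × ℝ) := {p | p.2 < M + 1}
    have hU : IsOpen U := isOpen_lt continuous_snd continuous_const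
    have iw : IntegrableOn w U := slab_integrable hl hw _
    have iG : IntegrableOn G U := slab_integrable hl hG _
    have hT : ∀ j, Tst U (fun p => scj N j p.1 * tc M p.2) := fun j =>
      prod_Tst (scj_cd N j (n := 3)) (tc_cd M (n := 3)) (scj_nn N j) (tc_nn M)
        (isCompact_closedBall (0 : Euc N) (2 * ((j:ℝ) + 1))) (isCompact_Icc (a := (-2:ℝ)) (b := M))
        (fun x hx => scj_zero (by rw [mem_closedBall_zero_iff, not_le] at hx; exact hx.le)) (tc_supp M)
        (fun p hp => by
          have := hp.2.2
          change p.2 < M + 1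
          linarith)
    have hk := fun j => kato_on hU iw iG (fun ζ hζ => h ζ ⟨hζ.sm, hζ.nn, hζ.cs, subset_univ _⟩) (hT j)
    obtain ⟨C, hC0, hC⟩ := scj_lap N
    have hcs : HasCompactSupport (tc M) := HasCompactSupport.of_support_subset_isCompact (isCompact_Icc (a := (-2:ℝ)) (b := M))
      (fun t ht => by by_contra h; exact ht (tc_supp M t h))
    obtain ⟨C1, hC1⟩ := hcs.exists_bound_of_continuous (tc_cd M (n := 1)).continuous
    have hdc : Continuous (deriv (tc M)) := (tc_cd M (n := 1)).continuous_deriv (by norm_num)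
    obtain ⟨C2, hC2⟩ := hcs.deriv.exists_bound_of_continuous hdc
    have hts : tsupport (tc M) ⊆ Icc (-2) (M:ℝ) := closure_minimal (fun t ht => by by_contra h; exact ht (tc_supp M t h)) isClosed_Icc
    have hd0 : ∀ t : ℝ, (M:ℝ) < t → deriv (tc M) t = 0 := fun t ht => by
      have : t ∉ tsupport (tc M) := fun h => absurd (hts h).2 (not_le.mpr ht)
      rw [notMem_tsupport_iff_eventuallyEq] at this
      rw [this.deriv_eq]; simp
    -- inequality
    have hw' : Integrable (fun p => max (U.indicator w p) 0) := (iw.integrable_indicator hU.measurableSet).pos_part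
    have i1 : ∀ j, Integrable (fun p : Euc N × ℝ => max (U.indicator w p) 0 * (scj N j p.1 * deriv (tc M) p.2)) := fun j => by
      have := (scj_cd N j (n := 1)).continuous
      refine hw'.mul_bdd (c := C2) (by fun_prop) (Eventually.of_forall fun p => ?_)
      rw [norm_mul, Real.norm_of_nonneg (scj_nn _ _ _)]
      nlinarith [scj_le N j p.1, hC2 p.2, norm_nonneg (deriv (tc M) p.2)]
    have i2 : ∀ j, Integrable (fun p : Euc N × ℝ => max (U.indicator w p) 0 * (lap (scj N j) p.1 * tc M p.2)) := fun j => by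
      have := lap_cont (scj_cd N j (n := 3))
      have := (tc_cd M (n := 1)).continuous
      refine hw'.mul_bdd (c := C * C1) (by fun_prop) (Eventually.of_forall fun p => ?_)
      rw [norm_mul]
      exact mul_le_mul (hC _ _) (hC1 _) (norm_nonneg _) hC0
    have hk2 : ∀ j, - (∫ p, max (U.indicator w p) 0 * (scj N j p.1 * deriv (tc M) p.2)) - (∫ p, max (U.indicator w p) 0 * (lap (scj N j) p.1 * tc M p.2)) ≤ 0 := by
      intro j
      have e1 := i1 j
      have e3 : Integrable (fun p : Euc N × ℝ => - (max (U.indicator w p) 0 * (scj N j p.1 * deriv (tc M) p.2))) := e1.neg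
      rw [← integral_neg, ← integral_sub e3 (i2 j)]
      refine le_trans (integral_mono_ae (e3.sub (i2 j)) ?_ ?_) (hk j)
      · exact (kato_int hU iw iG (hT j)).1.neg.add (kato_int hU iw iG (hT j)).2
      · filter_upwards [hpos] with p hp
        rw [heatAdj_prod (scj_cd N j (n := 3)) (tc_cd M (n := 3))]
        have hb : tc M p.2 = 0 ∨ p ∈ U := by
          by_cases hp : p ∈ U
          · exact Or.inr hp
          · refine Or.inl (tc_supp _ _ fun h => hp ?_)
            have := h.2
            change p.2 < M + 1
            linarith
        have hb' : p ∈ U ∨ deriv (tc M) p.2 = 0 := by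
          by_cases hp : p ∈ U
          · exact Or.inl hp
          · refine Or.inr (hd0 _ ?_)
            have : ¬ (p.2 < (M:ℝ) + 1) := hp
            linarith
        by_cases hpU : p ∈ U
        · simp only [indicator_of_mem hpU]
          have : 0 ≤ G p * (if 0 < w p then 1 else 0) * (scj N j p.1 * tc M p.2) := by
            refine mul_nonneg ?_ (mul_nonneg (scj_nn _ _ _) (tc_nn _ _))
            split_ifs with h0
            · simpa using hp h0
            · simp
          nlinarith
        · have h1 := hb.resolve_right hpU
          have h2 := hb'.resolve_left hpU
          simp [h1, h2]
    have lim2 : Tendsto (fun j => ∫ p, max (U.indicator w p) 0 * (lap (scj N j) p.1 * tc M p.2)) atTop (𝓝 (∫ p : Euc N × ℝ, (0:ℝ))) := by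
      refine tendsto_integral_of_dominated_convergence (fun p => max (U.indicator w p) 0 * (C * C1)) (fun j => (i2 j).aestronglyMeasurable)
        (hw'.mul_const _) (fun j => Eventually.of_forall fun p => ?_) (Eventually.of_forall fun p => ?_)
      · rw [norm_mul, norm_mul, Real.norm_of_nonneg (le_max_right _ _)]
        exact mul_le_mul_of_nonneg_left (mul_le_mul (hC _ _) (hC1 _) (norm_nonneg _) hC0) (le_max_right _ _)
      · obtain ⟨m, hm⟩ := exists_nat_gt ‖p.1‖
        refine tendsto_const_nhds.congr' ?_
        filter_upwards [eventually_ge_atTop m] with j hj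
        have hmj : (m:ℝ) ≤ j := by exact_mod_cast hj
        have : scj N j =ᶠ[𝓝 p.1] fun _ => 1 := by
          filter_upwards [(isOpen_lt continuous_norm continuous_const).mem_nhds (show p.1 ∈ {x : Euc N | ‖x‖ < m} from hm)] with x hx
          have : ‖x‖ < m := hx
          exact scj_one (by linarith)
        rw [lap_zero_of 1 this]; simp
    have lim1 : Tendsto (fun j => ∫ p, max (U.indicator w p) 0 * (scj N j p.1 * deriv (tc M) p.2)) atTop (𝓝 (∫ p, max (U.indicator w p) 0 * deriv (tc M) p.2)) := by
      refine tendsto_integral_of_dominated_convergence (fun p => max (U.indicator w p) 0 * C2) (fun j => (i1 j).aestronglyMeasurable)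
        (hw'.mul_const _) (fun j => Eventually.of_forall fun p => ?_) (Eventually.of_forall fun p => ?_)
      · rw [norm_mul, norm_mul, Real.norm_of_nonneg (le_max_right _ _), Real.norm_of_nonneg (scj_nn _ _ _)]
        refine mul_le_mul_of_nonneg_left ?_ (le_max_right _ _)
        nlinarith [scj_le N j p.1, hC2 p.2, norm_nonneg (deriv (tc M) p.2)]
      · obtain ⟨m, hm⟩ := exists_nat_gt ‖p.1‖
        refine tendsto_const_nhds.congr' ?_
        filter_upwards [eventually_ge_atTop m] with j hj
        have hmj : (m:ℝ) ≤ j := by exact_mod_cast hj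
        rw [scj_one (by linarith), one_mul]
    rw [integral_zero] at lim2
    have hfin := le_of_tendsto (lim1.neg.sub lim2) (Eventually.of_forall hk2)
    rw [sub_zero, ← integral_neg] at hfin
    have hnn : ∀ p : Euc N × ℝ, 0 ≤ -(max (U.indicator w p) 0 * deriv (tc M) p.2) := by
      intro p
      by_cases hp : p.2 ≤ 0
      · have : U.indicator w p = 0 := by
          by_cases hp' : p ∈ U <;> simp [hp', hw0 p hp]
        simp [this]
      · have := tc_deriv M p.2 (not_le.mp hp).le
        have h2 := Real.smoothTransition.nonneg (M - p.2)
        have h3 : 0 ≤ max (U.indicator w p) 0 := le_max_right _ _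
        nlinarith
    have hint : Integrable (fun p : Euc N × ℝ => -(max (U.indicator w p) 0 * deriv (tc M) p.2)) :=
      (hw'.mul_bdd (c := C2) (by fun_prop) (Eventually.of_forall fun p => hC2 _)).neg
    have hz := (integral_eq_zero_iff_of_nonneg hnn hint).mp (le_antisymm hfin (integral_nonneg hnn))
    filter_upwards [hz] with p hp hpM
    by_contra hw1
    rw [not_le] at hw1
    have ht : 0 < p.2 := by
      by_contra h; rw [hw0 p (not_lt.mp h)] at hw1; exact lt_irrefl _ hw1
    have := tc_deriv M p.2 ht.le
    have h2 := Real.smoothTransition.pos_of_pos (show 0 < M - p.2 by linarith)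
    have h4 : p ∈ U := by change p.2 < M + 1; linarith
    simp only [indicator_of_mem h4, max_eq_left hw1.le, Pi.zero_apply] at hp
    nlinarith
  have := ae_all_iff.mpr hM
  filter_upwards [this] with p hp
  obtain ⟨M, hM⟩ := exists_nat_gt p.2
  exact hp M hM



theorem GoodG.nn {g : ℝ → ℝ} (hg : GoodG g) (s : ℝ) : 0 ≤ g s := by
  rcases le_total s 0 with h | h
  · rw [hg.2.2 s h]
  · rw [← hg.2.2 0 le_rfl]; exact hg.2.1 h

/-- Lipschitz regularization -/
def gn (g : ℝ → ℝ) (n : ℕ) (s : ℝ) : ℝ := ⨅ r : ℝ, (g (s + r) + n * |r|)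

theorem gn_bdd {g : ℝ → ℝ} (hg : GoodG g) (n : ℕ) (s : ℝ) : BddBelow (range fun r : ℝ => g (s + r) + n * |r|) :=
  ⟨0, by rintro _ ⟨r, rfl⟩; have := hg.nn (s + r); dsimp only; positivity⟩

theorem gn_nonneg {g : ℝ → ℝ} (hg : GoodG g) (n : ℕ) (s : ℝ) : 0 ≤ gn g n s :=
  le_ciInf fun r => by have := hg.nn (s + r); positivity

theorem gn_le {g : ℝ → ℝ} (hg : GoodG g) (n : ℕ) (s : ℝ) : gn g n s ≤ g s := by
  refine (ciInf_le (gn_bdd hg n s) 0).trans (by simp)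

theorem gn_zero {g : ℝ → ℝ} (hg : GoodG g) (n : ℕ) {s : ℝ} (hs : s ≤ 0) : gn g n s = 0 :=
  le_antisymm ((gn_le hg n s).trans_eq (hg.2.2 s hs)) (gn_nonneg hg n s)

theorem gn_mono {g : ℝ → ℝ} (hg : GoodG g) (n : ℕ) : Monotone (gn g n) := fun a b hab =>
  ciInf_mono (gn_bdd hg n a) fun r => by
    have := hg.2.1 (show a + r ≤ b + r by linarith)
    linarith

theorem gn_mono_n {g : ℝ → ℝ} (hg : GoodG g) {n m : ℕ} (h : n ≤ m) (s : ℝ) : gn g n s ≤ gn g m s :=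
  ciInf_mono (gn_bdd hg n s) fun r => by
    have : (n:ℝ) ≤ m := by exact_mod_cast h
    have := mul_le_mul_of_nonneg_right this (abs_nonneg r)
    linarith

theorem gn_lip {g : ℝ → ℝ} (hg : GoodG g) (n : ℕ) (a b : ℝ) : |gn g n a - gn g n b| ≤ n * |a - b| := by
  have h : ∀ a b, gn g n a - n * |a - b| ≤ gn g n b := by
    intro a b
    refine le_ciInf fun r => ?_
    have h1 := ciInf_le (gn_bdd hg n a) (b + r - a)
    have h2 : |b + r - a| ≤ |r| + |a - b| := by
      have := abs_sub r (a - b)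
      rwa [show r - (a - b) = b + r - a by ring] at this
    have h3 := mul_le_mul_of_nonneg_left h2 (n.cast_nonneg (α := ℝ))
    change gn g n a ≤ _ at h1
    rw [show a + (b + r - a) = b + r by ring] at h1
    linarith
  rw [abs_le]
  have h1 := h a b
  have h2 := h b a
  rw [abs_sub_comm b a] at h2
  constructor <;> linarith

theorem gn_cont {g : ℝ → ℝ} (hg : GoodG g) (n : ℕ) : Continuous (gn g n) := by
  refine (LipschitzWith.of_dist_le_mul (K := n) fun a b => ?_).continuous
  simpa [Real.dist_eq] using gn_lip hg n a b

theorem gn_tendsto {g : ℝ → ℝ} (hg : GoodG g) {s : ℕ → ℝ} {a : ℝ} (hs : Tendsto s atTop (𝓝 a)) :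
    Tendsto (fun n => gn g n (s n)) atTop (𝓝 (g a)) := by
  rw [Metric.tendsto_atTop']
  intro ε hε
  have h1 : ∀ᶠ n in atTop, g (s n) < g a + ε := ((hg.1.tendsto a).comp hs).eventually (gt_mem_nhds (by linarith))
  have h2 : ∀ᶠ y in 𝓝 a, g a - ε/2 < g y := (hg.1.tendsto a).eventually (lt_mem_nhds (by linarith))
  obtain ⟨δ, hδ, hb⟩ := Metric.eventually_nhds_iff.mp h2
  have h3 : g a - ε/2 < g (a - δ/2) := hb (by rw [Real.dist_eq, show a - δ/2 - a = -(δ/2) by ring, abs_neg, abs_of_pos (by linarith)]; linarith)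
  have h4 : ∀ᶠ n in atTop, a - δ/4 < s n := hs.eventually (lt_mem_nhds (by linarith))
  obtain ⟨m, hm⟩ := exists_nat_ge (g a / (δ/4))
  rw [div_le_iff₀ (by linarith)] at hm
  have h5 := eventually_ge_atTop m
  obtain ⟨n0, hn0⟩ := eventually_atTop.mp (h1.and (h4.and h5))
  refine ⟨n0, fun n hn => ?_⟩
  obtain ⟨k1, k4, k5⟩ := hn0 n hn.le
  have k6 : g a - ε/2 ≤ gn g n (s n) := by
    refine le_ciInf fun r => ?_
    have hmn : (m:ℝ) ≤ n := by exact_mod_cast k5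
    rcases le_total (-(δ/4)) r with hr | hr
    · have := hg.2.1 (show a - δ/2 ≤ s n + r by linarith)
      have : 0 ≤ (n:ℝ) * |r| := by positivity
      linarith
    · have := hg.nn (s n + r)
      have h7 : δ/4 ≤ |r| := by rw [abs_of_nonpos (by linarith)]; linarith
      have h8 : (m:ℝ) * (δ/4) ≤ n * |r| := mul_le_mul hmn h7 (by linarith) (by positivity)
      linarith
  rw [Real.dist_eq, abs_lt]
  have := gn_le hg n (s n)
  constructor <;> linarith

/-- penalized nonlinearity -/
def Fn {N : ℕ} (Ω : Set (Euc N)) (g : ℝ → ℝ) (n : ℕ) (p : Euc N × ℝ) (s : ℝ) : ℝ :=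
  gn g n s + n * (Ωᶜ.indicator (fun _ => 1) p.1 * max s 0)

theorem ind_bd {N : ℕ} (Ω : Set (Euc N)) (x : Euc N) : 0 ≤ Ωᶜ.indicator (fun _ => (1:ℝ)) x ∧ Ωᶜ.indicator (fun _ => (1:ℝ)) x ≤ 1 := by
  by_cases h : x ∈ Ω <;> simp [h]

theorem Fn_nonneg {N : ℕ} (Ω : Set (Euc N)) {g : ℝ → ℝ} (hg : GoodG g) (n : ℕ) (p : Euc N × ℝ) (s : ℝ) : 0 ≤ Fn Ω g n p s := by
  have := gn_nonneg hg n s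
  have := (ind_bd Ω p.1).1
  unfold Fn; positivity

theorem Fn_zero {N : ℕ} (Ω : Set (Euc N)) {g : ℝ → ℝ} (hg : GoodG g) (n : ℕ) (p : Euc N × ℝ) {s : ℝ} (hs : s ≤ 0) : Fn Ω g n p s = 0 := by
  unfold Fn; rw [gn_zero hg n hs, max_eq_right hs]; simp

theorem Fn_mono {N : ℕ} (Ω : Set (Euc N)) {g : ℝ → ℝ} (hg : GoodG g) {n m : ℕ} (h : n ≤ m) (p : Euc N × ℝ) {s t : ℝ} (hs : s ≤ t) :
    Fn Ω g n p s ≤ Fn Ω g m p t := by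
  unfold Fn
  have h1 := (gn_mono_n hg h s).trans (gn_mono hg m hs)
  have h2 : (n:ℝ) ≤ m := by exact_mod_cast h
  have h3 := (ind_bd Ω p.1).1
  have h4 : max s 0 ≤ max t 0 := max_le_max hs le_rfl
  have : (n:ℝ) * (Ωᶜ.indicator (fun _ => 1) p.1 * max s 0) ≤ m * (Ωᶜ.indicator (fun _ => 1) p.1 * max t 0) := by
    gcongr
  linarith

theorem Fn_lip {N : ℕ} (Ω : Set (Euc N)) {g : ℝ → ℝ} (hg : GoodG g) (n : ℕ) (p : Euc N × ℝ) (a b : ℝ) :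
    |Fn Ω g n p a - Fn Ω g n p b| ≤ (2 * n + 1) * |a - b| := by
  unfold Fn
  have h1 := gn_lip hg n a b
  obtain ⟨h3, h4⟩ := ind_bd Ω p.1
  set c := Ωᶜ.indicator (fun _ => (1:ℝ)) p.1
  have h2 : |max a 0 - max b 0| ≤ |a - b| := abs_max_sub_max_le_abs a b 0
  have h5 : |(n:ℝ) * (c * (max a 0 - max b 0))| ≤ n * |a - b| := by
    rw [abs_mul, abs_mul, abs_of_nonneg (n.cast_nonneg), abs_of_nonneg h3]
    have : c * |max a 0 - max b 0| ≤ |a - b| := by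
      nlinarith [abs_nonneg (max a 0 - max b 0)]
    gcongr
  rw [show gn g n a + n * (c * max a 0) - (gn g n b + n * (c * max b 0)) = (gn g n a - gn g n b) + n * (c * (max a 0 - max b 0)) by ring]
  have := abs_add_le (gn g n a - gn g n b) (n * (c * (max a 0 - max b 0)))
  nlinarith [abs_nonneg (a - b)]

theorem Fn_meas {N : ℕ} {Ω : Set (Euc N)} (hΩ : IsOpen Ω) {g : ℝ → ℝ} (hg : GoodG g) (n : ℕ) :
    Measurable (fun z : (Euc N × ℝ) × ℝ => Fn Ω g n z.1 z.2) := by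
  unfold Fn
  have h1 : Measurable (Ωᶜ.indicator (fun _ : Euc N => (1:ℝ))) := measurable_const.indicator hΩ.measurableSet.compl
  have h2 := (gn_cont hg n).measurable
  exact (h2.comp measurable_snd).add (measurable_const.mul ((h1.comp (measurable_fst.comp measurable_fst)).mul
    (measurable_snd.max measurable_const)))



theorem pot_expint {N : ℕ} (ν : Measure (Euc N)) [IsFiniteMeasure ν] {v : Euc N × ℝ → ℝ} (hm : AEStronglyMeasurable v)
    (h0 : ∀ᵐ p, 0 ≤ v p) (h1 : ∀ p, v p ≤ pot ν p) {l : ℝ} (hl : 0 < l) :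
    Integrable (fun p => Real.exp (-l * p.2) * v p) := by
  refine (pot_integrable ν hl).mono' ((Continuous.aestronglyMeasurable (by fun_prop)).mul hm) ?_
  filter_upwards [h0] with p hp
  rw [norm_mul, Real.norm_of_nonneg (Real.exp_pos _).le, Real.norm_of_nonneg hp]
  exact mul_le_mul_of_nonneg_left (h1 p) (Real.exp_pos _).le

theorem exists_seq {N : ℕ} (ν : Measure (Euc N)) [IsFiniteMeasure ν] {Ω : Set (Euc N)} (hΩ : IsOpen Ω)
    {g : ℝ → ℝ} (hg : GoodG g) :
    ∃ v : ℕ → Euc N × ℝ → ℝ, (∀ n, AEStronglyMeasurable (v n)) ∧ (∀ n p, p.2 ≤ 0 → v n p = 0) ∧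
      (∀ n p, 0 ≤ v n p) ∧ (∀ n p, v n p ≤ pot ν p) ∧ (∀ p, Antitone (fun n => v n p)) ∧
      (∀ n, ∀ ζ : Euc N → ℝ → ℝ, C21 ζ → HasCompactSupport (fun q : Euc N × ℝ => ζ q.1 q.2) →
        Integrable (fun p => v n p * heatAdj ζ p) ∧ Integrable (fun p => Fn Ω g n p (v n p) * ζ p.1 p.2) ∧ 
        ∫ p, (-(v n p * heatAdj ζ p) + Fn Ω g n p (v n p) * ζ p.1 p.2) = ∫ y, ζ y 0 ∂ν) := by
  have hex := fun n : ℕ => exists_sol ν (Fn Ω g n) (Fn_meas hΩ hg n) (fun p => Fn_zero Ω hg n p le_rfl)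
    (Fn_nonneg Ω hg n) (L := 2 * n + 1) (by positivity) (Fn_lip Ω hg n)
  choose v hm hint ht hpot hweak using hex
  have hFm : ∀ n, AEStronglyMeasurable (fun p => Fn Ω g n p (v n p)) := fun n =>
    ((Fn_meas hΩ hg n).comp_aemeasurable (aemeasurable_id.prodMk (hm n).aemeasurable)).aestronglyMeasurable
  have hFb : ∀ n p, |Fn Ω g n p (v n p)| ≤ (2 * n + 1) * |v n p| := fun n p => by
    have := Fn_lip Ω hg n p (v n p) 0
    rwa [Fn_zero Ω hg n p le_rfl, sub_zero, sub_zero] at this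
  have hFint : ∀ n l, Integrable (fun p => Real.exp (-l * p.2) * v n p) → Integrable (fun p => Real.exp (-l * p.2) * Fn Ω g n p (v n p)) := by
    intro n l h
    refine (h.abs.const_mul (2 * (n:ℝ) + 1)).mono' ((Continuous.aestronglyMeasurable (by fun_prop)).mul (hFm n)) (Eventually.of_forall fun p => ?_)
    rw [norm_mul, Real.norm_of_nonneg (Real.exp_pos _).le, abs_mul, abs_of_nonneg (Real.exp_pos _).le]
    have := mul_le_mul_of_nonneg_left (hFb n p) (Real.exp_pos (-l * p.2)).le
    rw [Real.norm_eq_abs]; linarith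
  have hF0 : ∀ n p, p.2 ≤ 0 → Fn Ω g n p (v n p) = 0 := fun n p hp => Fn_zero Ω hg n p (ht n p hp).le
  -- nonneg
  have hnn : ∀ n, ∀ᵐ p, 0 ≤ v n p := by
    intro n
    obtain ⟨l, hl, hi⟩ := hint n
    have := lemZ (w := fun p => - v n p) (G := fun p => - Fn Ω g n p (v n p)) hl (by simpa using hi.neg)
      (fun p hp => by simp [ht n p hp]) (by simpa using (hFint n l hi).neg) (fun p hp => by simp [hF0 n p hp])
      (fun ζ hζ => by
        have := hweak n (cur ζ) (C21_of_contDiff hζ.sm) hζ.cs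
        have e : ∫ p, (-(- v n p * heatAdj (cur ζ) p) + - Fn Ω g n p (v n p) * ζ p) = - ∫ p, (-(v n p * heatAdj (cur ζ) p) + Fn Ω g n p (v n p) * cur ζ p.1 p.2) := by
          rw [← integral_neg]; congr 1; ext p; change _ = -( _ + _ * ζ p); ring
        rw [e, this]
        have : 0 ≤ ∫ y, cur ζ y 0 ∂ν := integral_nonneg fun y => hζ.nn _
        linarith)
      (Eventually.of_forall fun p hp => by rw [Fn_zero Ω hg n p (by linarith)]; simp)
    filter_upwards [this] with p hp
    linarith
  have hexp : ∀ n, Integrable (fun p => Real.exp (-1 * p.2) * v n p) := fun n => pot_expint ν (hm n) (hnn n) (hpot n) one_pos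
  have hexpF := fun n => hFint n 1 (hexp n)
  have iA : ∀ n, ∀ ζ : Euc N → ℝ → ℝ, C21 ζ → HasCompactSupport (fun q : Euc N × ℝ => ζ q.1 q.2) →
        Integrable (fun p => v n p * heatAdj ζ p) ∧ Integrable (fun p => Fn Ω g n p (v n p) * ζ p.1 p.2) := by
    intro n ζ h hc
    obtain ⟨C, hC⟩ := exp_mul_bound h.heatAdj_cont (heatAdj_compact hc) 1
    obtain ⟨C', hC'⟩ := exp_mul_bound h.cont hc 1
    have c1 := h.heatAdj_cont
    have c2 := h.cont
    constructor
    · refine ((hexp n).mul_bdd (c := C) (g := fun p => Real.exp (1 * p.2) * heatAdj ζ p) (by fun_prop) (Eventually.of_forall hC)).congr (Eventually.of_forall fun p => ?_)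
      change Real.exp (-1 * p.2) * v n p * (Real.exp (1 * p.2) * heatAdj ζ p) = _
      have := exp_cancel (1 * p.2) (v n p * heatAdj ζ p)
      rw [← neg_mul] at this
      linarith
    · refine ((hexpF n).mul_bdd (c := C') (g := fun p => Real.exp (1 * p.2) * ζ p.1 p.2) (by fun_prop) (Eventually.of_forall hC')).congr (Eventually.of_forall fun p => ?_)
      change Real.exp (-1 * p.2) * Fn Ω g n p (v n p) * (Real.exp (1 * p.2) * ζ p.1 p.2) = _
      have := exp_cancel (1 * p.2) (Fn Ω g n p (v n p) * ζ p.1 p.2)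
      rw [← neg_mul] at this
      linarith
  have hanti : ∀ n, ∀ᵐ p, v (n+1) p ≤ v n p := by
    intro n
    have := lemZ (w := fun p => v (n+1) p - v n p) (G := fun p => Fn Ω g (n+1) p (v (n+1) p) - Fn Ω g n p (v n p)) one_pos
      (by simp only [mul_sub]; exact (hexp (n+1)).sub (hexp n))
      (fun p hp => by simp [ht _ p hp]) (by simp only [mul_sub]; exact (hexpF (n+1)).sub (hexpF n)) (fun p hp => by simp [hF0 _ p hp])
      (fun ζ hζ => by
        have hC := C21_of_contDiff hζ.sm
        have h1 := hweak n (cur ζ) hC hζ.cs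
        have h2 := hweak (n+1) (cur ζ) hC hζ.cs
        have j1 := iA n (cur ζ) hC hζ.cs
        have j2 := iA (n+1) (cur ζ) hC hζ.cs
        refine le_of_eq ?_
        have k1 : Integrable (fun p => -(v n p * heatAdj (cur ζ) p) + Fn Ω g n p (v n p) * cur ζ p.1 p.2) := j1.1.neg.add j1.2
        have k2 : Integrable (fun p => -(v (n+1) p * heatAdj (cur ζ) p) + Fn Ω g (n+1) p (v (n+1) p) * cur ζ p.1 p.2) := j2.1.neg.add j2.2
        have := integral_sub k2 k1
        rw [h1, h2, sub_self] at this
        rw [← this]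
        congr 1; ext p
        change _ = -(v (n+1) p * _) + _ * ζ p - (-(v n p * _) + _ * ζ p)
        ring)
      (Eventually.of_forall fun p hp => sub_nonneg.mpr (Fn_mono Ω hg (Nat.le_succ n) p (by linarith)))
    filter_upwards [this] with p hp
    linarith
  have hall : ∀ᵐ p, ∀ n, 0 ≤ v n p ∧ v (n+1) p ≤ v n p := ae_all_iff.mpr fun n => (hnn n).and (hanti n)
  classical
  let w : ℕ → Euc N × ℝ → ℝ := fun n p => if ∀ n, 0 ≤ v n p ∧ v (n+1) p ≤ v n p then v n p else 0
  have hw : ∀ n, w n =ᵐ[volume] v n := fun n => by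
    filter_upwards [hall] with p hp
    simp [w, hp]
  refine ⟨w, fun n => (hm n).congr (hw n).symm, fun n p hp => ?_, fun n p => ?_, fun n p => ?_, fun p => ?_, fun n ζ h hc => ?_⟩
  · simp [w, ht n p hp]
  · dsimp only [w]; split_ifs with h
    · exact (h n).1
    · exact le_rfl
  · dsimp only [w]; split_ifs with h
    · exact hpot n p
    · exact pot_nonneg _ _
  · dsimp only [w]; split_ifs with h
    · exact antitone_nat_of_succ_le fun n => (h n).2
    · exact antitone_const
  · refine ⟨(iA n ζ h hc).1.congr ?_, (iA n ζ h hc).2.congr ?_, (integral_congr_ae ?_).trans (hweak n ζ h hc)⟩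
    · filter_upwards [hw n] with p hp; rw [hp]
    · filter_upwards [hw n] with p hp; rw [hp]
    · filter_upwards [hw n] with p hp; rw [hp]



theorem fatou_real {X : Type*} [MeasurableSpace X] {μ : Measure X} {h : ℕ → X → ℝ} {h' : X → ℝ}
    (hi : ∀ n, Integrable (h n) μ) (hnn : ∀ n x, 0 ≤ h n x)
    (hlim : ∀ᵐ x ∂μ, Tendsto (fun n => h n x) atTop (𝓝 (h' x))) {c : ℝ} (hc : ∀ᶠ n in atTop, ∫ x, h n x ∂μ ≤ c) :
    Integrable h' μ ∧ ∫ x, h' x ∂μ ≤ c := by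
  have hm : AEStronglyMeasurable h' μ := aestronglyMeasurable_of_tendsto_ae atTop (fun n => (hi n).aestronglyMeasurable) hlim
  have hn' : 0 ≤ᵐ[μ] h' := by
    filter_upwards [hlim] with x hx
    exact ge_of_tendsto' hx fun n => hnn n x
  have h1 : ∫⁻ x, ENNReal.ofReal (h' x) ∂μ ≤ ENNReal.ofReal c := by
    calc ∫⁻ x, ENNReal.ofReal (h' x) ∂μ = ∫⁻ x, liminf (fun n => ENNReal.ofReal (h n x)) atTop ∂μ := by
          refine lintegral_congr_ae ?_
          filter_upwards [hlim] with x hx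
          exact ((ENNReal.tendsto_ofReal hx).liminf_eq).symm
      _ ≤ liminf (fun n => ∫⁻ x, ENNReal.ofReal (h n x) ∂μ) atTop :=
          lintegral_liminf_le' fun n => (hi n).aestronglyMeasurable.aemeasurable.ennreal_ofReal
      _ ≤ liminf (fun _ : ℕ => ENNReal.ofReal c) atTop := by
          refine liminf_le_liminf ?_
          filter_upwards [hc] with n hn
          rw [← ofReal_integral_eq_lintegral_ofReal (hi n) (Eventually.of_forall (hnn n))]
          exact ENNReal.ofReal_le_ofReal hn
      _ = _ := liminf_const _
  have h2 : Integrable h' μ := by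
    refine ⟨hm, ?_⟩
    rw [hasFiniteIntegral_iff_ofReal hn']
    exact h1.trans_lt ENNReal.ofReal_lt_top
  refine ⟨h2, ?_⟩
  have hc0 : 0 ≤ c := by
    obtain ⟨n, hn⟩ := hc.exists
    exact (integral_nonneg (hnn n)).trans hn
  rw [← ofReal_integral_eq_lintegral_ofReal h2 hn'] at h1
  exact (ENNReal.ofReal_le_ofReal_iff hc0).mp h1

theorem L1conv {X : Type*} [MeasurableSpace X] {μ : Measure X} {f : ℕ → X → ℝ} {f' : X → ℝ}
    (hi : ∀ n, Integrable (f n) μ) (hnn : ∀ n x, 0 ≤ f n x)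
    (hlim : ∀ᵐ x ∂μ, Tendsto (fun n => f n x) atTop (𝓝 (f' x)))
    (hD : ∀ ε > 0, ∃ D : X → ℝ, Integrable D μ ∧ (∀ x, 0 ≤ D x) ∧ ∀ᶠ n in atTop, ∫ x, max (f n x - D x) 0 ∂μ ≤ ε) :
    Integrable f' μ ∧ Tendsto (fun n => ∫ x, |f n x - f' x| ∂μ) atTop (𝓝 0) := by
  have key : ∀ D : X → ℝ, Integrable D μ → ∀ ε, (∀ᶠ n in atTop, ∫ x, max (f n x - D x) 0 ∂μ ≤ ε) →
      Integrable (fun x => max (f' x - D x) 0) μ ∧ ∫ x, max (f' x - D x) 0 ∂μ ≤ ε := by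
    intro D hDi ε hε
    refine fatou_real (h := fun n x => max (f n x - D x) 0) (fun n => ((hi n).sub hDi).pos_part) (fun n x => le_max_right _ _) ?_ hε
    filter_upwards [hlim] with x hx
    exact (hx.sub_const _).max tendsto_const_nhds
  have hm : AEStronglyMeasurable f' μ := aestronglyMeasurable_of_tendsto_ae atTop (fun n => (hi n).aestronglyMeasurable) hlim
  have hn' : ∀ᵐ x ∂μ, 0 ≤ f' x := by
    filter_upwards [hlim] with x hx
    exact ge_of_tendsto' hx fun n => hnn n x
  have hf' : Integrable f' μ := by
    obtain ⟨D, hDi, hD0, hev⟩ := hD 1 one_pos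
    refine (hDi.add (key D hDi 1 hev).1).mono' hm ?_
    filter_upwards [hn'] with x hx
    rw [Real.norm_of_nonneg hx]
    have := le_max_left (f' x - D x) 0
    change _ ≤ D x + max (f' x - D x) 0
    linarith
  refine ⟨hf', ?_⟩
  rw [Metric.tendsto_atTop']
  intro ε hε
  obtain ⟨D, hDi, hD0, hev⟩ := hD (ε/4) (by linarith)
  obtain ⟨k1, k2⟩ := key D hDi _ hev
  have hl : Tendsto (fun n => ∫ x, |min (f n x) (D x) - min (f' x) (D x)| ∂μ) atTop (𝓝 (∫ x, (0:ℝ) ∂μ)) := by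
    refine tendsto_integral_of_dominated_convergence D (fun n => (((hi n).inf hDi).sub (hf'.inf hDi)).abs.aestronglyMeasurable) hDi (fun n => ?_) ?_
    · filter_upwards [hn'] with x hx
      rw [Real.norm_eq_abs, abs_abs, abs_le]
      have a1 := min_le_right (f n x) (D x)
      have a2 := min_le_right (f' x) (D x)
      have a3 := le_min (hnn n x) (hD0 x)
      have a4 := le_min hx (hD0 x)
      constructor <;> linarith
    · filter_upwards [hlim] with x hx
      have := ((hx.min (tendsto_const_nhds (x := D x))).sub_const (min (f' x) (D x))).abs
      simpa using this
  rw [integral_zero] at hl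
  have hl2 := hl.eventually (gt_mem_nhds (show 0 < ε/4 by linarith))
  obtain ⟨n0, hn0⟩ := eventually_atTop.mp (hev.and hl2)
  refine ⟨n0, fun n hn => ?_⟩
  obtain ⟨m1, m2⟩ := hn0 n hn.le
  rw [Real.dist_eq, sub_zero, abs_of_nonneg (integral_nonneg fun x => abs_nonneg _)]
  have i1 : Integrable (fun x => |min (f n x) (D x) - min (f' x) (D x)|) μ := (((hi n).inf hDi).sub (hf'.inf hDi)).abs
  have i2 : Integrable (fun x => max (f n x - D x) 0) μ := ((hi n).sub hDi).pos_part
  have i3 : Integrable (fun x => |min (f n x) (D x) - min (f' x) (D x)| + max (f n x - D x) 0) μ := i1.add i2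
  have : ∫ x, |f n x - f' x| ∂μ ≤ ∫ x, (|min (f n x) (D x) - min (f' x) (D x)| + max (f n x - D x) 0 + max (f' x - D x) 0) ∂μ := by
    refine integral_mono ((hi n).sub hf').abs (i3.add k1) fun x => ?_
    have e : ∀ a, a = min a (D x) + max (a - D x) 0 := fun a => by
      rcases le_total a (D x) with h | h
      · rw [min_eq_left h, max_eq_right (by linarith)]; ring
      · rw [min_eq_right h, max_eq_left (by linarith)]; ring
    have b1 := le_max_right (f n x - D x) 0
    have b2 := le_max_right (f' x - D x) 0
    have e1 := e (f n x)
    have e2 := e (f' x)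
    dsimp only
    rw [show f n x - f' x = (min (f n x) (D x) - min (f' x) (D x)) + (max (f n x - D x) 0 - max (f' x - D x) 0) by linarith]
    refine (abs_add_le _ _).trans ?_
    have : |max (f n x - D x) 0 - max (f' x - D x) 0| ≤ max (f n x - D x) 0 + max (f' x - D x) 0 := by
      rw [abs_le]; constructor <;> linarith
    linarith
  rw [integral_add i3 k1, integral_add i1 i2] at this
  linarith



/-- time cutoff, `1` on `[-1,a]`, `0` outside `[-2,b]`. -/
def th (a b t : ℝ) : ℝ := Real.smoothTransition (t + 2) * Real.smoothTransition ((b - t) / (b - a))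

theorem th_cd (a b : ℝ) {n : ℕ∞} : ContDiff ℝ n (th a b) := by
  unfold th
  exact (Real.smoothTransition.contDiff.comp (contDiff_id.add contDiff_const)).mul
    (Real.smoothTransition.contDiff.comp ((contDiff_const.sub contDiff_id).div_const _))

theorem th_nn (a b t : ℝ) : 0 ≤ th a b t := mul_nonneg (Real.smoothTransition.nonneg _) (Real.smoothTransition.nonneg _)
theorem th_le (a b t : ℝ) : th a b t ≤ 1 :=
  mul_le_one₀ (Real.smoothTransition.le_one _) (Real.smoothTransition.nonneg _) (Real.smoothTransition.le_one _)

theorem th_zero {a b t : ℝ} (h : a < b) (ht : b ≤ t) : th a b t = 0 := by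
  unfold th
  rw [Real.smoothTransition.zero_of_nonpos (x := (b - t) / (b - a)) (div_nonpos_of_nonpos_of_nonneg (by linarith) (by linarith)), mul_zero]

theorem th_supp {a b t : ℝ} (h : a < b) (ht : t ∉ Icc (-2) b) : th a b t = 0 := by
  by_cases h1 : b ≤ t
  · exact th_zero h h1
  · unfold th
    rw [Real.smoothTransition.zero_of_nonpos (x := t + 2), zero_mul]
    by_contra hc
    exact ht ⟨by linarith, by linarith⟩

theorem th_one {a b t : ℝ} (h : a < b) (h1 : -1 ≤ t) (ht : t ≤ a) : th a b t = 1 := by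
  unfold th
  rw [Real.smoothTransition.one_of_one_le (by linarith), Real.smoothTransition.one_of_one_le, one_mul]
  rw [one_le_div (by linarith)]; linarith

theorem th_ev {a b t : ℝ} (h1 : -1 < t) : th a b =ᶠ[𝓝 t] fun s => Real.smoothTransition ((b - s) / (b - a)) := by
  filter_upwards [lt_mem_nhds h1] with s hs
  unfold th
  rw [Real.smoothTransition.one_of_one_le (by linarith), one_mul]

theorem th_deriv {a b t : ℝ} (h : a < b) (h1 : -1 < t) : deriv (th a b) t ≤ 0 := by
  rw [(th_ev h1).deriv_eq]
  have : Antitone (fun s => Real.smoothTransition ((b - s) / (b - a))) := fun x y hxy =>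
    Real.smoothTransition.monotone (div_le_div_of_nonneg_right (by linarith) (by linarith))
  exact this.deriv_nonpos

theorem smT_deriv_bd : ∃ K, 0 ≤ K ∧ ∀ x, |deriv Real.smoothTransition x| ≤ K := by
  have hc : Continuous (deriv Real.smoothTransition) :=
    (Real.smoothTransition.contDiff (n := 1)).continuous_deriv le_rfl
  obtain ⟨K, hK⟩ := (isCompact_Icc (a := (0:ℝ)) (b := 1)).exists_bound_of_continuousOn hc.continuousOn
  refine ⟨max K 0, le_max_right _ _, fun x => ?_⟩
  by_cases hx : x ∈ Icc (0:ℝ) 1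
  · exact (hK x hx).trans (le_max_left _ _)
  · have : deriv Real.smoothTransition x = 0 := by
      rw [mem_Icc, not_and_or, not_le, not_le] at hx
      rcases hx with hx | hx
      · have : Real.smoothTransition =ᶠ[𝓝 x] fun _ => 0 := by
          filter_upwards [gt_mem_nhds hx] with s hs
          exact Real.smoothTransition.zero_of_nonpos hs.le
        rw [this.deriv_eq]; simp
      · have : Real.smoothTransition =ᶠ[𝓝 x] fun _ => 1 := by
          filter_upwards [lt_mem_nhds hx] with s hs
          exact Real.smoothTransition.one_of_one_le hs.le
        rw [this.deriv_eq]; simp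
    rw [this]; simp

theorem th_deriv_bd : ∃ K, 0 ≤ K ∧ ∀ a b t : ℝ, a < b → -1 < t → |deriv (th a b) t| ≤ K / (b - a) := by
  obtain ⟨K, hK, h⟩ := smT_deriv_bd
  refine ⟨K, hK, fun a b t hab ht => ?_⟩
  rw [(th_ev ht).deriv_eq]
  have e : HasDerivAt (fun s => (b - s) / (b - a)) ((-1) / (b - a)) t := by
    exact ((hasDerivAt_id t).const_sub b).div_const _
  have d : HasDerivAt Real.smoothTransition (deriv Real.smoothTransition ((b - t) / (b - a))) ((b - t) / (b - a)) :=
    (((Real.smoothTransition.contDiff (n := 1)).differentiable one_ne_zero) _).hasDerivAt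
  have := (HasDerivAt.comp t d e).deriv
  rw [show (fun s => Real.smoothTransition ((b - s) / (b - a))) = Real.smoothTransition ∘ (fun s => (b - s) / (b - a)) from rfl, this, abs_mul, abs_div, abs_neg, abs_one, abs_of_pos (show 0 < b - a by linarith), mul_one_div]
  exact div_le_div_of_nonneg_right (h _) (by linarith)

theorem th_deriv_zero {a b t : ℝ} (h : a < b) (h1 : -1 < t) (ht : t < a ∨ b < t) : deriv (th a b) t = 0 := by
  rcases ht with ht | ht
  · have : th a b =ᶠ[𝓝 t] fun _ => 1 := by
      filter_upwards [gt_mem_nhds ht, lt_mem_nhds h1] with s hs hs1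
      exact th_one h hs1.le hs.le
    rw [this.deriv_eq]; simp
  · have : th a b =ᶠ[𝓝 t] fun _ => 0 := by
      filter_upwards [lt_mem_nhds ht] with s hs
      exact th_zero h hs.le
    rw [this.deriv_eq]; simp

theorem Tst.testZero {N : ℕ} {Ω O : Set (Euc N)} {T : ℝ} (hΩ : IsOpen Ω) (hO : O ⊆ Ω) {ζ : Euc N × ℝ → ℝ}
    (hζ : Tst (O ×ˢ Iio T) ζ) : TestZero Ω T (cur ζ) := by
  have hz : ∀ p, p ∉ O ×ˢ Iio T → ζ p = 0 := fun p hp => image_eq_zero_of_notMem_tsupport fun h => hp (hζ.sub h)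
  refine ⟨C21_of_contDiff hζ.sm, fun x hx t _ => hz _ fun h => ?_, fun x _ => hz _ fun h => ?_⟩
  · rw [hΩ.frontier_eq] at hx
    exact hx.2 (hO h.1)
  · exact lt_irrefl _ (mem_Iio.mp h.2)

theorem loc_sol {N : ℕ} {Ω O : Set (Euc N)} {T : ℝ} (hΩ : IsOpen Ω) (hOo : IsOpen O) (hO : O ⊆ Ω) {g : ℝ → ℝ} (hg : GoodG g)
    {r : ℝ} (hr : 0 < r) (hρ : ∀ x ∈ O, r ≤ rho Ω x) {σ : Measure (Euc N)} {u : Euc N × ℝ → ℝ} (hu : WeakSol Ω T g σ u) :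
    Integrable ((QT Ω T).indicator u) ∧ IntegrableOn (fun p => g ((QT Ω T).indicator u p)) (O ×ˢ Iio T) ∧
    ∀ ζ, Tst (O ×ˢ Iio T) ζ → Integrable (fun p => (QT Ω T).indicator u p * heatAdj (cur ζ) p) ∧
      Integrable (fun p => g ((QT Ω T).indicator u p) * ζ p) ∧
      ∫ p, (-((QT Ω T).indicator u p * heatAdj (cur ζ) p) + g ((QT Ω T).indicator u p) * ζ p) = ∫ x, ζ (x, 0) ∂σ := by
  obtain ⟨h1, h2, h3⟩ := hu
  have mQ : MeasurableSet (QT Ω T) := hΩ.measurableSet.prod measurableSet_Ioo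
  have mU : MeasurableSet (O ×ˢ Iio T) := hOo.measurableSet.prod measurableSet_Iio
  have hu0 : Integrable ((QT Ω T).indicator u) := h1.integrable_indicator mQ
  have hg0 : IntegrableOn (fun p => g ((QT Ω T).indicator u p)) (O ×ˢ Iio T) := by
    have a1 : Integrable ((QT Ω T).indicator (fun p => g (u p) * rho Ω p.1)) := h2.integrable_indicator mQ
    have a2 : IntegrableOn (fun p => r⁻¹ * (QT Ω T).indicator (fun p => g (u p) * rho Ω p.1) p) (O ×ˢ Iio T) := (a1.const_mul _).integrableOn
    refine Integrable.mono' a2 (hg.1.comp_aestronglyMeasurable hu0.aestronglyMeasurable).restrict ?_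
    refine (ae_restrict_iff' mU).mpr (Eventually.of_forall fun p hp => ?_)
    rw [Real.norm_of_nonneg (hg.nn _)]
    by_cases hq : p ∈ QT Ω T
    · rw [indicator_of_mem hq, indicator_of_mem hq]
      have := hρ p.1 hp.1
      have hh := hg.nn (u p)
      calc g (u p) = r⁻¹ * (g (u p) * r) := by field_simp
        _ ≤ _ := by gcongr
    · rw [indicator_of_notMem hq, indicator_of_notMem hq, hg.2.2 0 le_rfl, mul_zero]
  refine ⟨hu0, hg0, fun ζ hζ => ?_⟩
  obtain ⟨C, hC1, hC2⟩ := cs_bounds hζ.sm hζ.cs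
  have hz : ∀ p, p ∉ O ×ˢ Iio T → ζ p = 0 := fun p hp => image_eq_zero_of_notMem_tsupport fun h => hp (hζ.sub h)
  have i1 : Integrable (fun p => (QT Ω T).indicator u p * heatAdj (cur ζ) p) :=
    hu0.mul_bdd (c := C) ((C21_of_contDiff hζ.sm).heatAdj_cont.aestronglyMeasurable) (Eventually.of_forall fun p => hC2 p)
  have i2 : Integrable (fun p => g ((QT Ω T).indicator u p) * ζ p) := by
    have : Integrable (fun p => (O ×ˢ Iio T).indicator (fun p => g ((QT Ω T).indicator u p)) p * ζ p) :=
      (hg0.integrable_indicator mU).mul_bdd (c := C) (hζ.sm.continuous.aestronglyMeasurable) (Eventually.of_forall fun p => hC1 p)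
    refine this.congr (Eventually.of_forall fun p => ?_)
    by_cases hp : p ∈ O ×ˢ Iio T
    · simp only [indicator_of_mem hp]
    · simp only [hz p hp, mul_zero]
  refine ⟨i1, i2, ?_⟩
  have := h3 _ (hζ.testZero hΩ hO)
  rw [← integral_indicator mQ] at this
  rw [show (∫ x, ζ (x, 0) ∂σ) = ∫ x, cur ζ x 0 ∂σ from rfl, ← this]
  congr 1; ext p
  by_cases hq : p ∈ QT Ω T
  · rw [indicator_of_mem hq, indicator_of_mem hq]
    unfold heatAdj cur
    ring
  · rw [indicator_of_notMem hq, indicator_of_notMem hq, hg.2.2 0 le_rfl]; simp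



theorem gn_le_mul {g : ℝ → ℝ} (hg : GoodG g) (n : ℕ) {s : ℝ} (hs : 0 ≤ s) : gn g n s ≤ n * s := by
  have := gn_lip hg n s 0
  rw [gn_zero hg n le_rfl, sub_zero, sub_zero, abs_of_nonneg hs] at this
  exact (le_abs_self _).trans this

theorem stepB {N : ℕ} {x0 : Euc N} {r : ℝ} (hr : 0 < r) {C : ℝ} {φ : Euc N → ℝ} (hφ : ContDiff ℝ 3 φ)
    (hφ0 : ∀ x, 0 ≤ φ x) (hφ1 : ∀ x, φ x ≤ 1) (hφs : ∀ x, x ∉ Metric.closedBall x0 (5/2*r) → φ x = 0)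
    (hC : ∀ x, |lap φ x| ≤ C) {T δ : ℝ} (hδ : 0 < δ) (hδT : 2 * δ < T) (n : ℕ) {g : ℝ → ℝ} (hg : GoodG g)
    {v V u0 : Euc N × ℝ → ℝ} (hv0 : ∀ p : Euc N × ℝ, p.2 ≤ 0 → v p = 0) (hu00 : ∀ p : Euc N × ℝ, p.2 ≤ 0 → u0 p = 0)
    (hvn : ∀ p, 0 ≤ v p) (hvV : ∀ p, v p ≤ V p) (hV : IntegrableOn V (Metric.ball x0 (3*r) ×ˢ Iio T))
    (hvm : AEStronglyMeasurable v) (hu0 : Integrable u0)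
    (hgu : IntegrableOn (fun p => g (u0 p)) (Metric.ball x0 (3*r) ×ˢ Iio T))
    (hk : ∀ ζ, Tst (Metric.ball x0 (3*r) ×ˢ Iio T) ζ → 
      ∫ p, (-((v p - u0 p) * heatAdj (cur ζ) p) + (gn g n (v p) - g (u0 p)) * ζ p) ≤ 0) :
    Integrable (fun p => max (gn g n (v p) - g (u0 p)) 0 * (φ p.1 * th δ (2*δ) p.2)) ∧
    ∫ p, max (gn g n (v p) - g (u0 p)) 0 * (φ p.1 * th δ (2*δ) p.2) ≤
      C * (∫ p in Metric.ball x0 (3*r) ×ˢ Ioo 0 (2*δ), (V p + |u0 p|)) + 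
        ∫ p in Metric.ball x0 (3*r) ×ˢ Iio T, (g (u0 p) - gn g n (u0 p)) := by
  set O := Metric.ball x0 (3*r) with hO
  set U := O ×ˢ Iio T with hUdef
  have hOo : IsOpen O := Metric.isOpen_ball
  have hU : IsOpen U := hOo.prod isOpen_Iio
  have hC0 : 0 ≤ C := (abs_nonneg _).trans (hC x0)
  have hV0 : ∀ p, 0 ≤ V p := fun p => (hvn p).trans (hvV p)
  have hsub : Metric.closedBall x0 (5/2*r) ⊆ O := Metric.closedBall_subset_ball (by linarith)
  have hζ : Tst U (fun p : Euc N × ℝ => φ p.1 * th δ (2*δ) p.2) := by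
    refine prod_Tst hφ (th_cd _ _) hφ0 (th_nn _ _) (isCompact_closedBall x0 (5/2*r)) (isCompact_Icc (a := (-2:ℝ)) (b := 2*δ)) hφs
      (fun t ht => th_supp (by linarith) ht) ?_
    exact prod_mono hsub fun t ht => lt_of_le_of_lt ht.2 hδT
  have hvU : IntegrableOn v U := by
    refine Integrable.mono' hV hvm.restrict (Eventually.of_forall fun p => ?_)
    rw [Real.norm_of_nonneg (hvn p)]; exact hvV p
  have hfU : IntegrableOn (fun p => gn g n (v p)) U := by
    refine Integrable.mono' (hvU.const_mul (n:ℝ)) ((gn_cont hg n).comp_aestronglyMeasurable hvm.restrict) (Eventually.of_forall fun p => ?_)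
    rw [Real.norm_of_nonneg (gn_nonneg hg n _)]; exact gn_le_mul hg n (hvn p)
  have heU : IntegrableOn (fun p => g (u0 p) - gn g n (u0 p)) U := by
    refine Integrable.mono' hgu (hgu.aestronglyMeasurable.sub ((gn_cont hg n).comp_aestronglyMeasurable hu0.aestronglyMeasurable.restrict)) (Eventually.of_forall fun p => ?_)
    have a1 := gn_le hg n (u0 p)
    have a2 := gn_nonneg hg n (u0 p)
    rw [Real.norm_of_nonneg (by linarith)]; linarith
  have hwU : IntegrableOn (fun p => v p - u0 p) U := hvU.sub hu0.integrableOn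
  have hFU : IntegrableOn (fun p => gn g n (v p) - g (u0 p)) U := hfU.sub hgu
  have K := kato_on hU hwU hFU hk hζ
  obtain ⟨k1, k2⟩ := kato_int hU hwU hFU hζ
  set ζ : Euc N × ℝ → ℝ := fun p => φ p.1 * th δ (2*δ) p.2 with hζd
  have hζ0 : ∀ p, 0 ≤ ζ p := hζ.nn
  have hζ1 : ∀ p, ζ p ≤ 1 := fun p => mul_le_one₀ (hφ1 _) (th_nn _ _ _) (th_le _ _ _)
  have hz : ∀ p, p ∉ U → ζ p = 0 := fun p hp => image_eq_zero_of_notMem_tsupport fun h => hp (hζ.sub h)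
  have mU := hU.measurableSet
  have ieI : Integrable (U.indicator fun p => g (u0 p) - gn g n (u0 p)) := heU.integrable_indicator mU
  -- pointwise
  have pw : ∀ p, max (gn g n (v p) - g (u0 p)) 0 * ζ p ≤ (gn g n (v p) - g (u0 p)) * (if 0 < v p - u0 p then 1 else 0) * ζ p + U.indicator (fun p => g (u0 p) - gn g n (u0 p)) p := by
    intro p
    by_cases hp : p ∈ U
    · rw [indicator_of_mem hp]
      have a1 := gn_le hg n (u0 p)
      have z0 := hζ0 p
      have z1 := hζ1 p
      have ez : (g (u0 p) - gn g n (u0 p)) * ζ p ≤ g (u0 p) - gn g n (u0 p) := mul_le_of_le_one_right (by linarith) z1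
      split_ifs with hw
      · have a2 := gn_mono hg n (show u0 p ≤ v p by linarith)
        have : max (gn g n (v p) - g (u0 p)) 0 ≤ (gn g n (v p) - g (u0 p)) + (g (u0 p) - gn g n (u0 p)) := max_le (by linarith) (by linarith)
        have := mul_le_mul_of_nonneg_right this z0
        rw [add_mul] at this
        linarith
      · have a2 := gn_mono hg n (show v p ≤ u0 p by linarith)
        rw [max_eq_right (by linarith)]
        simp; linarith
    · rw [hz p hp, indicator_of_notMem hp]; simp
  have iL : Integrable (fun p => max (gn g n (v p) - g (u0 p)) 0 * ζ p) := by
    have : Integrable (fun p => (U.indicator (fun p => max (gn g n (v p) - g (u0 p)) 0) p) * ζ p) :=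
      (IntegrableOn.integrable_indicator (Integrable.pos_part hFU) mU).mul_bdd (c := 1) hζ.sm.continuous.aestronglyMeasurable
        (Eventually.of_forall fun p => by rw [Real.norm_of_nonneg (hζ0 p)]; exact hζ1 p)
    refine this.congr (Eventually.of_forall fun p => ?_)
    by_cases hp : p ∈ U
    · simp only [indicator_of_mem hp]
    · simp only [hz p hp, mul_zero]
  refine ⟨iL, ?_⟩
  have s1 : ∫ p, max (gn g n (v p) - g (u0 p)) 0 * ζ p ≤ (∫ p, (gn g n (v p) - g (u0 p)) * (if 0 < v p - u0 p then 1 else 0) * ζ p) + ∫ p, U.indicator (fun p => g (u0 p) - gn g n (u0 p)) p := by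
    rw [← integral_add k2 ieI]
    exact integral_mono iL (k2.add ieI) pw
  have k1' : Integrable (fun p => -(max (v p - u0 p) 0 * heatAdj (cur ζ) p)) := k1.neg
  rw [integral_add k1' k2, integral_neg] at K
  have mW : MeasurableSet (O ×ˢ Ioo 0 (2*δ)) := hOo.measurableSet.prod measurableSet_Ioo
  have iW : IntegrableOn (fun p => V p + |u0 p|) (O ×ˢ Ioo 0 (2*δ)) :=
    (hV.mono_set (prod_mono le_rfl fun t ht => lt_trans ht.2 hδT)).add hu0.abs.integrableOn
  have s2 : ∫ p, max (v p - u0 p) 0 * heatAdj (cur ζ) p ≤ C * ∫ p in O ×ˢ Ioo 0 (2*δ), (V p + |u0 p|) := by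
    rw [← integral_indicator mW, ← integral_const_mul]
    refine integral_mono k1 ((iW.integrable_indicator mW).const_mul C) fun p => ?_
    dsimp only
    have hh : heatAdj (cur ζ) p = _ := heatAdj_prod hφ (th_cd δ (2*δ)) p
    rw [hh]
    have R0 : 0 ≤ C * (O ×ˢ Ioo 0 (2*δ)).indicator (fun p => V p + |u0 p|) p :=
      mul_nonneg hC0 (indicator_nonneg (fun q _ => add_nonneg (hV0 q) (abs_nonneg _)) p)
    have w0 := le_max_right (v p - u0 p) 0
    rcases le_or_gt p.2 0 with ht | ht
    · rw [hv0 p ht, hu00 p ht]; simpa using R0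
    have d := th_deriv (a := δ) (b := 2*δ) (t := p.2) (by linarith) (by linarith)
    have A1 : φ p.1 * deriv (th δ (2*δ)) p.2 + lap φ p.1 * th δ (2*δ) p.2 ≤ lap φ p.1 * th δ (2*δ) p.2 := by
      have := mul_nonpos_of_nonneg_of_nonpos (hφ0 p.1) d
      linarith
    refine (mul_le_mul_of_nonneg_left A1 w0).trans ?_
    by_cases hp : p ∈ O ×ˢ Ioo 0 (2*δ)
    · rw [indicator_of_mem hp]
      have A2 : lap φ p.1 * th δ (2*δ) p.2 ≤ C := by
        calc lap φ p.1 * th δ (2*δ) p.2 ≤ C * th δ (2*δ) p.2 := mul_le_mul_of_nonneg_right ((le_abs_self _).trans (hC _)) (th_nn _ _ _)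
          _ ≤ C := mul_le_of_le_one_right hC0 (th_le _ _ _)
      have A3 : max (v p - u0 p) 0 ≤ V p + |u0 p| := by
        have := neg_abs_le (u0 p)
        refine max_le ?_ (add_nonneg (hV0 p) (abs_nonneg _))
        linarith [hvV p]
      calc max (v p - u0 p) 0 * (lap φ p.1 * th δ (2*δ) p.2) ≤ max (v p - u0 p) 0 * C := mul_le_mul_of_nonneg_left A2 w0
        _ ≤ (V p + |u0 p|) * C := mul_le_mul_of_nonneg_right A3 hC0
        _ = _ := mul_comm _ _
    · have : lap φ p.1 * th δ (2*δ) p.2 = 0 := by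
        by_cases hx : p.1 ∈ O
        · rw [th_zero (by linarith), mul_zero]
          by_contra hc
          exact hp ⟨hx, ht, by linarith⟩
        · rw [lap_zero_of 0, zero_mul]
          have : p.1 ∈ (Metric.closedBall x0 (5/2*r))ᶜ := fun h => hx (hsub h)
          filter_upwards [Metric.isClosed_closedBall.isOpen_compl.mem_nhds this] with y hy
          exact hφs y hy
      rw [this, mul_zero]; exact R0
  rw [← integral_indicator mU]
  linarith



theorem int_nu_le {N : ℕ} {Ω : Set (Euc N)} {U : Set (Euc N × ℝ)} (hUΩ : ∀ p ∈ U, p.1 ∈ Ω) {σ ν : Measure (Euc N)} 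
    (hσ : MemM1 Ω σ) (hν : ν ≤ σ) {ζ : Euc N × ℝ → ℝ} (hζ : Tst U ζ) : ∫ x, ζ (x, 0) ∂ν ≤ ∫ x, ζ (x, 0) ∂σ := by
  refine integral_mono_measure hν (Eventually.of_forall fun x => hζ.nn _) ?_
  have hK : IsCompact (Prod.fst '' tsupport ζ) := hζ.cs.isCompact.image continuous_fst
  have hKΩ : Prod.fst '' tsupport ζ ⊆ Ω := by
    rintro _ ⟨p, hp, rfl⟩
    exact hUΩ p (hζ.sub hp)
  obtain ⟨C, hC1, hC2⟩ := cs_bounds hζ.sm hζ.cs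
  have : IntegrableOn (fun x => ζ (x, 0)) (Prod.fst '' tsupport ζ) σ := by
    refine Measure.integrableOn_of_bounded (M := C) (hσ.2.1 _ hKΩ hK).ne ?_ (Eventually.of_forall fun x => hC1 _)
    exact (hζ.sm.continuous.comp (by fun_prop : Continuous fun x : Euc N => (x, (0:ℝ)))).aestronglyMeasurable
  refine this.integrable_of_forall_notMem_eq_zero fun x hx => ?_
  exact image_eq_zero_of_notMem_tsupport fun h => hx ⟨_, h, rfl⟩

theorem QT_fin {N : ℕ} {Ω : Set (Euc N)} (hb : Bornology.IsBounded Ω) (T : ℝ) : volume (QT Ω T) < ⊤ :=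
  (hb.prod (Metric.isBounded_Ioo 0 T)).measure_lt_top

theorem main_L1 {N : ℕ} {Ω : Set (Euc N)} (hΩ : IsOpen Ω) (hb : Bornology.IsBounded Ω) (hne : Ωᶜ.Nonempty) {T : ℝ} (hT : 0 < T)
    {g : ℝ → ℝ} (hg : GoodG g) {σ ν : Measure (Euc N)} [IsFiniteMeasure ν] (hσ : MemM1 Ω σ) {u : Euc N × ℝ → ℝ} (hu : WeakSol Ω T g σ u)
    (hνσ : ν ≤ σ) {x0 : Euc N} {r : ℝ} (hr : 0 < r) (hνs : ν (Metric.closedBall x0 r)ᶜ = 0) (hball : Metric.closedBall x0 (4*r) ⊆ Ω)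
    {v : ℕ → Euc N × ℝ → ℝ} (hvm : ∀ n, AEStronglyMeasurable (v n)) (hv0 : ∀ n p, p.2 ≤ 0 → v n p = 0) (hvn : ∀ n p, 0 ≤ v n p)
    (hvV : ∀ n p, v n p ≤ pot ν p) 
    (hv : ∀ n, ∀ ζ : Euc N → ℝ → ℝ, C21 ζ → HasCompactSupport (fun q : Euc N × ℝ => ζ q.1 q.2) →
        Integrable (fun p => v n p * heatAdj ζ p) ∧ Integrable (fun p => Fn Ω g n p (v n p) * ζ p.1 p.2) ∧ 
        ∫ p, (-(v n p * heatAdj ζ p) + Fn Ω g n p (v n p) * ζ p.1 p.2) = ∫ y, ζ y 0 ∂ν) {v' : Euc N × ℝ → ℝ}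
    (hlim : ∀ p, Tendsto (fun n => v n p) atTop (𝓝 (v' p))) :
    (∀ n, Integrable (fun p => gn g n (v n p)) (volume.restrict (QT Ω T))) ∧
    Integrable (fun p => g (v' p)) (volume.restrict (QT Ω T)) ∧ 
      Tendsto (fun n => ∫ p in QT Ω T, |gn g n (v n p) - g (v' p)|) atTop (𝓝 0) := by
  have hOΩ : Metric.ball x0 (3*r) ⊆ Ω := (Metric.ball_subset_closedBall.trans (Metric.closedBall_subset_closedBall (by linarith))).trans hball
  have hρ : ∀ x ∈ Metric.ball x0 (3*r), r ≤ rho Ω x := by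
    intro x hx
    refine (Metric.le_infDist hne).mpr fun y hy => ?_
    by_contra hc
    refine hy (hball ?_)
    rw [Metric.mem_closedBall]
    have := dist_triangle y x x0
    rw [dist_comm y x] at this
    rw [Metric.mem_ball] at hx
    push Not at hc
    linarith
  obtain ⟨hu0, hgu, hsol⟩ := loc_sol hΩ Metric.isOpen_ball hOΩ hg hr hρ hu
  set u0 := (QT Ω T).indicator u with hu0d
  have hu00 : ∀ p : Euc N × ℝ, p.2 ≤ 0 → u0 p = 0 := fun p hp => indicator_of_notMem (fun h => absurd h.2.1 (not_lt.mpr hp)) _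
  set O := Metric.ball x0 (3*r) with hO
  set U := O ×ˢ Iio T with hUd
  have hU : IsOpen U := Metric.isOpen_ball.prod isOpen_Iio
  have mU := hU.measurableSet
  have mQ : MeasurableSet (QT Ω T) := hΩ.measurableSet.prod measurableSet_Ioo
  have hVT : IntegrableOn (pot ν) {p : Euc N × ℝ | p.2 < T} := slab_integrable one_pos (pot_integrable ν one_pos) T
  have hVU : IntegrableOn (pot ν) U := hVT.mono_set fun p hp => hp.2
  have hVQ : IntegrableOn (pot ν) (QT Ω T) := hVT.mono_set fun p hp => hp.2.2
  have hk : ∀ n, ∀ ζ, Tst U ζ → 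
      ∫ p, (-((v n p - u0 p) * heatAdj (cur ζ) p) + (gn g n (v n p) - g (u0 p)) * ζ p) ≤ 0 := by
    intro n ζ hζ
    obtain ⟨a1, a2, a3⟩ := hv n (cur ζ) (C21_of_contDiff hζ.sm) hζ.cs
    obtain ⟨b1, b2, b3⟩ := hsol ζ hζ
    have hz : ∀ p, p ∉ U → ζ p = 0 := fun p hp => image_eq_zero_of_notMem_tsupport fun h => hp (hζ.sub h)
    have i1 : Integrable (fun p => -(v n p * heatAdj (cur ζ) p) + Fn Ω g n p (v n p) * cur ζ p.1 p.2) := a1.neg.add a2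
    have i2 : Integrable (fun p => -(u0 p * heatAdj (cur ζ) p) + g (u0 p) * ζ p) := b1.neg.add b2
    have e : ∀ p, (-((v n p - u0 p) * heatAdj (cur ζ) p) + (gn g n (v n p) - g (u0 p)) * ζ p) = 
        (-(v n p * heatAdj (cur ζ) p) + Fn Ω g n p (v n p) * cur ζ p.1 p.2) - (-(u0 p * heatAdj (cur ζ) p) + g (u0 p) * ζ p) := by
      intro p
      have : Fn Ω g n p (v n p) * cur ζ p.1 p.2 = gn g n (v n p) * ζ p := by
        change _ * ζ p = _
        by_cases hp : p ∈ U
        · unfold Fn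
          rw [indicator_of_notMem (show p.1 ∉ Ωᶜ from fun h => h (hOΩ hp.1))]; ring
        · rw [hz p hp]; ring
      rw [this]; ring
    simp_rw [e]
    rw [integral_sub i1 i2, a3, b3]
    have := int_nu_le (fun p hp => hOΩ (And.left hp)) hσ hνσ hζ
    exact sub_nonpos.mpr this
  have hi : ∀ n, Integrable (fun p => gn g n (v n p)) (volume.restrict (QT Ω T)) := by
    intro n
    refine Integrable.mono' (hVQ.const_mul (n:ℝ)) ((gn_cont hg n).comp_aestronglyMeasurable (hvm n).restrict) (Eventually.of_forall fun p => ?_)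
    rw [Real.norm_of_nonneg (gn_nonneg hg n _)]
    exact (gn_le_mul hg n (hvn n p)).trans (mul_le_mul_of_nonneg_left (hvV n p) (Nat.cast_nonneg n))
  refine ⟨hi, L1conv hi (fun n p => gn_nonneg hg n _) (Eventually.of_forall fun p => gn_tendsto hg (hlim p)) ?_⟩
  intro ε hε
  let φ : ContDiffBump x0 := ⟨2*r, 5/2*r, by linarith, by linarith⟩
  have hφc : ContDiff ℝ 3 (φ : Euc N → ℝ) := φ.contDiff
  have hφs : ∀ x, x ∉ Metric.closedBall x0 (5/2*r) → φ x = 0 := fun x hx => φ.zero_of_le_dist (by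
    rw [Metric.mem_closedBall, not_le] at hx; exact hx.le)
  obtain ⟨C, hC⟩ : ∃ C, ∀ x, |lap (φ : Euc N → ℝ) x| ≤ C := by
    have hcs : HasCompactSupport (lap (φ : Euc N → ℝ)) := by
      refine HasCompactSupport.intro (isCompact_closedBall x0 (5/2*r)) fun x hx => lap_zero_of 0 ?_
      filter_upwards [Metric.isClosed_closedBall.isOpen_compl.mem_nhds hx] with y hy
      exact hφs y hy
    exact hcs.exists_bound_of_continuous (lap_cont hφc)
  have hC0 : 0 ≤ C := (abs_nonneg _).trans (hC x0)
  -- choose δ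
  obtain ⟨δ, hδ, hδT, hδε⟩ : ∃ δ : ℝ, 0 < δ ∧ 2*δ < T ∧ C * (∫ p in O ×ˢ Ioo 0 (2*δ), (pot ν p + |u0 p|)) < ε/2 := by
    have hs : Tendsto (fun k : ℕ => ∫ p in O ×ˢ Ioo 0 (2*(T/(3*((k:ℝ)+1)))), (pot ν p + |u0 p|)) atTop
        (𝓝 (∫ p in ⋂ k : ℕ, O ×ˢ Ioo 0 (2*(T/(3*((k:ℝ)+1)))), (pot ν p + |u0 p|))) := by
      refine Antitone.tendsto_setIntegral (s := fun k : ℕ => O ×ˢ Ioo 0 (2*(T/(3*((k:ℝ)+1))))) (fun k => Metric.isOpen_ball.measurableSet.prod measurableSet_Ioo) ?_ ?_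
      · intro i j hij
        refine prod_mono le_rfl (Ioo_subset_Ioo le_rfl ?_)
        have : (i:ℝ) ≤ j := by exact_mod_cast hij
        gcongr
      · refine (hVU.mono_set (prod_mono le_rfl fun t ht => ?_)).add hu0.abs.integrableOn
        have := ht.2
        rw [mem_Iio]
        norm_num at this
        linarith
    have he : (⋂ k : ℕ, O ×ˢ Ioo 0 (2*(T/(3*((k:ℝ)+1))))) = (∅ : Set (Euc N × ℝ)) := by
      rw [eq_empty_iff_forall_notMem]
      intro p hp
      rw [mem_iInter] at hp
      have p0 := (hp 0).2.1
      obtain ⟨k, hk⟩ := exists_nat_gt (T / p.2)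
      have h2 := (hp k).2.2
      rw [div_lt_iff₀ p0] at hk
      have k0 : (0:ℝ) ≤ k := Nat.cast_nonneg k
      rw [← mul_div_assoc, lt_div_iff₀ (by positivity)] at h2
      nlinarith
    rw [he] at hs
    simp only [Measure.restrict_empty, integral_zero_measure] at hs
    have hs2 := (hs.const_mul C)
    rw [mul_zero] at hs2
    obtain ⟨k, hk⟩ := (hs2.eventually (gt_mem_nhds (show 0 < ε/2 by linarith))).exists
    refine ⟨T/(3*((k:ℝ)+1)), by positivity, ?_, hk⟩
    have k0 : (0:ℝ) ≤ k := Nat.cast_nonneg k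
    rw [← mul_div_assoc, div_lt_iff₀ (by positivity)]
    nlinarith
  obtain ⟨Cd, hCd0, hCd⟩ := pot_bound ν hr hδ hνs
  have he : Tendsto (fun n => ∫ p in U, (g (u0 p) - gn g n (u0 p))) atTop (𝓝 (∫ p in U, (0:ℝ))) := by
    refine tendsto_integral_of_dominated_convergence (fun p => g (u0 p)) (fun n => hgu.aestronglyMeasurable.sub ((gn_cont hg n).comp_aestronglyMeasurable hu0.aestronglyMeasurable.restrict)) hgu (fun n => Eventually.of_forall fun p => ?_) (Eventually.of_forall fun p => ?_)
    · have a1 := gn_le hg n (u0 p)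
      have a2 := gn_nonneg hg n (u0 p)
      rw [Real.norm_of_nonneg (by linarith)]; linarith
    · have := (gn_tendsto hg (tendsto_const_nhds (x := u0 p))).const_sub (g (u0 p))
      rwa [sub_self] at this
  rw [integral_zero] at he
  have ifm : IsFiniteMeasure (volume.restrict (QT Ω T)) := ⟨by rw [Measure.restrict_apply_univ]; exact QT_fin hb T⟩
  have hDi : Integrable (fun p => g Cd + U.indicator (fun p => g (u0 p)) p) (volume.restrict (QT Ω T)) :=
    (integrable_const _).add (hgu.integrable_indicator mU).restrict
  refine ⟨fun p => g Cd + U.indicator (fun p => g (u0 p)) p, hDi, fun p => add_nonneg (hg.nn _) (indicator_nonneg (fun q _ => hg.nn _) p), ?_⟩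
  filter_upwards [he.eventually (gt_mem_nhds (show 0 < ε/2 by linarith))] with n hn
  obtain ⟨B1, B2⟩ := stepB hr hφc (fun x => φ.nonneg) (fun x => φ.le_one) hφs hC hδ hδT n hg (hv0 n) hu00 (hvn n) (hvV n) hVU (hvm n) hu0 hgu (hk n)
  have B3 : ∫ p in QT Ω T, max (gn g n (v n p) - (g Cd + U.indicator (fun p => g (u0 p)) p)) 0 ≤ ∫ p in QT Ω T, max (gn g n (v n p) - g (u0 p)) 0 * (φ p.1 * th δ (2*δ) p.2) := by
    refine setIntegral_mono_on ((hi n).sub hDi).pos_part B1.integrableOn mQ fun p hp => ?_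
    have R0 : 0 ≤ max (gn g n (v n p) - g (u0 p)) 0 * (φ p.1 * th δ (2*δ) p.2) := 
      mul_nonneg (le_max_right _ _) (mul_nonneg φ.nonneg (th_nn _ _ _))
    by_cases hc : p.1 ∉ Metric.ball x0 (2*r) ∨ δ ≤ p.2
    · have a1 : gn g n (v n p) ≤ g Cd := (gn_le hg n _).trans (hg.2.1 ((hvV n p).trans (hCd p hc)))
      have a2 : 0 ≤ U.indicator (fun p => g (u0 p)) p := indicator_nonneg (fun q _ => hg.nn _) p
      rw [max_eq_right (by linarith)]
      exact R0
    · push Not at hc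
      obtain ⟨c1, c2⟩ := hc
      have hpU : p ∈ U := ⟨Metric.ball_subset_ball (by linarith) c1, hp.2.2⟩
      rw [indicator_of_mem hpU, φ.one_of_mem_closedBall (Metric.ball_subset_closedBall c1), th_one (by linarith) (by linarith [hp.2.1]) c2.le, one_mul, mul_one]
      exact max_le_max (by linarith [hg.nn Cd]) le_rfl
  have B4 : ∫ p in QT Ω T, max (gn g n (v n p) - g (u0 p)) 0 * (φ p.1 * th δ (2*δ) p.2) ≤ ∫ p, max (gn g n (v n p) - g (u0 p)) 0 * (φ p.1 * th δ (2*δ) p.2) :=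
    setIntegral_le_integral B1 (Eventually.of_forall fun p => mul_nonneg (le_max_right _ _) (mul_nonneg φ.nonneg (th_nn _ _ _)))
  linarith



theorem pot_mul_int {N : ℕ} (ν : Measure (Euc N)) [IsFiniteMeasure ν] {ψ : Euc N × ℝ → ℝ} (hψ : Continuous ψ) (hc : HasCompactSupport ψ) :
    Integrable (fun p => pot ν p * ψ p) := by
  obtain ⟨C, hC⟩ := exp_mul_bound hψ hc 1
  have : Integrable (fun p => (Real.exp (-1 * p.2) * pot ν p) * (Real.exp (1 * p.2) * ψ p)) :=
    (pot_integrable ν one_pos).mul_bdd (c := C) (Continuous.aestronglyMeasurable (by fun_prop)) (Eventually.of_forall hC)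
  refine this.congr (Eventually.of_forall fun p => ?_)
  have : Real.exp (-1 * p.2) * Real.exp (1 * p.2) = 1 := by rw [← Real.exp_add]; simp
  dsimp only
  linear_combination (pot ν p * ψ p) * this

set_option maxHeartbeats 2000000 in
theorem star_bd {N : ℕ} {Ω : Set (Euc N)} (hΩ : IsOpen Ω) (T R : ℝ)
    {g : ℝ → ℝ} (hg : GoodG g) {ν : Measure (Euc N)} [IsFiniteMeasure ν] 
    {v : ℕ → Euc N × ℝ → ℝ} (hvm : ∀ n, AEStronglyMeasurable (v n)) (hvn : ∀ n p, 0 ≤ v n p)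
    (hvV : ∀ n p, v n p ≤ pot ν p) 
    (hv : ∀ n, ∀ ζ : Euc N → ℝ → ℝ, C21 ζ → HasCompactSupport (fun q : Euc N × ℝ => ζ q.1 q.2) →
        Integrable (fun p => v n p * heatAdj ζ p) ∧ Integrable (fun p => Fn Ω g n p (v n p) * ζ p.1 p.2) ∧ 
        ∫ p, (-(v n p * heatAdj ζ p) + Fn Ω g n p (v n p) * ζ p.1 p.2) = ∫ y, ζ y 0 ∂ν) :
    ∃ C, 0 ≤ C ∧ ∀ n, IntegrableOn (fun p => Fn Ω g n p (v n p)) (Metric.closedBall 0 R ×ˢ Icc 0 T) ∧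
      ∫ p in Metric.closedBall 0 R ×ˢ Icc 0 T, Fn Ω g n p (v n p) ≤ C := by
  obtain ⟨j, hj⟩ := exists_nat_gt R
  have hΘ : Tst univ (fun p : Euc N × ℝ => scj N j p.1 * tc (T+1) p.2) := by
    refine prod_Tst (scj_cd N j) (tc_cd _) (scj_nn N j) (tc_nn _) (isCompact_closedBall (0 : Euc N) (2*((j:ℝ)+1))) (isCompact_Icc (a := (-2:ℝ)) (b := T+1))
      (fun x hx => scj_zero ?_) (fun t ht => tc_supp _ t ht) (subset_univ _)
    rw [mem_closedBall_zero_iff, not_le] at hx; exact hx.le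
  set Θ : Euc N × ℝ → ℝ := fun p => scj N j p.1 * tc (T+1) p.2 with hΘd
  have hc21 := C21_of_contDiff hΘ.sm
  have iV : Integrable (fun p => pot ν p * |heatAdj (cur Θ) p|) :=
    pot_mul_int ν hc21.heatAdj_cont.abs (HasCompactSupport.comp_left (heatAdj_compact hΘ.cs) abs_zero)
  have mS : MeasurableSet ((Metric.closedBall (0 : Euc N) R) ×ˢ Icc (0:ℝ) T) := Metric.isClosed_closedBall.measurableSet.prod measurableSet_Icc
  have hΘ1 : ∀ p ∈ (Metric.closedBall (0 : Euc N) R) ×ˢ Icc (0:ℝ) T, 1 ≤ Θ p := by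
    intro p hp
    obtain ⟨h1, h2, h3⟩ := hp
    rw [mem_closedBall_zero_iff] at h1
    simp only [hΘd, tc]
    rw [scj_one (by linarith), Real.smoothTransition.one_of_one_le (by linarith), Real.smoothTransition.one_of_one_le (by linarith)]
    linarith
  refine ⟨(∫ y, cur Θ y 0 ∂ν) + ∫ p, pot ν p * |heatAdj (cur Θ) p|, add_nonneg (integral_nonneg fun y => hΘ.nn _)
    (integral_nonneg fun p => mul_nonneg ((hvn 0 p).trans (hvV 0 p)) (abs_nonneg _)), fun n => ?_⟩
  obtain ⟨a1, a2, a3⟩ := hv n _ hc21 hΘ.cs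
  have a2' : Integrable (fun p => Fn Ω g n p (v n p) * Θ p) := a2
  have hF0 := fun p => Fn_nonneg Ω hg n p (v n p)
  have hFm : AEStronglyMeasurable (fun p => Fn Ω g n p (v n p)) :=
    ((Fn_meas hΩ hg n).comp_aemeasurable (aemeasurable_id.prodMk (hvm n).aemeasurable)).aestronglyMeasurable
  have hle : ∀ p ∈ (Metric.closedBall (0 : Euc N) R) ×ˢ Icc (0:ℝ) T, Fn Ω g n p (v n p) ≤ Fn Ω g n p (v n p) * Θ p :=
    fun p hp => le_mul_of_one_le_right (hF0 p) (hΘ1 p hp)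
  have i0 : IntegrableOn (fun p => Fn Ω g n p (v n p)) (Metric.closedBall 0 R ×ˢ Icc 0 T) := by
    refine Integrable.mono' a2'.integrableOn hFm.restrict ((ae_restrict_iff' mS).mpr (Eventually.of_forall fun p hp => ?_))
    rw [Real.norm_of_nonneg (hF0 p)]
    exact hle p hp
  refine ⟨i0, ?_⟩
  have b1 := setIntegral_mono_on i0 a2'.integrableOn mS hle
  have b2 : ∫ p in Metric.closedBall 0 R ×ˢ Icc 0 T, Fn Ω g n p (v n p) * Θ p ≤ ∫ p, Fn Ω g n p (v n p) * Θ p :=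
    setIntegral_le_integral a2' (Eventually.of_forall fun p => mul_nonneg (hF0 p) (hΘ.nn p))
  have a1' : Integrable (fun p => -(v n p * heatAdj (cur Θ) p)) := a1.neg
  rw [integral_add a1' a2, integral_neg] at a3
  have b3 : ∫ p, v n p * heatAdj (cur Θ) p ≤ ∫ p, pot ν p * |heatAdj (cur Θ) p| := by
    refine integral_mono a1 iV fun p => ?_
    exact (mul_le_mul_of_nonneg_left (le_abs_self _) (hvn n p)).trans (mul_le_mul_of_nonneg_right (hvV n p) (abs_nonneg _))
  have a3' : -(∫ p, v n p * heatAdj (cur Θ) p) + ∫ p, Fn Ω g n p (v n p) * Θ p = ∫ y, cur Θ y 0 ∂ν := a3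
  linarith

theorem v_zero {N : ℕ} {Ω : Set (Euc N)} (hΩ : IsOpen Ω) {S : Set (Euc N × ℝ)} (hS : MeasurableSet S)
    {g : ℝ → ℝ} (hg : GoodG g) {v : ℕ → Euc N × ℝ → ℝ} {C : ℝ} (hvn : ∀ n p, 0 ≤ v n p)
    {v' : Euc N × ℝ → ℝ} (hv'm : AEStronglyMeasurable v') (hv'0 : ∀ p, 0 ≤ v' p) (hv' : ∀ n p, v' p ≤ v n p)
    (h : ∀ n, IntegrableOn (fun p => Fn Ω g n p (v n p)) S ∧ ∫ p in S, Fn Ω g n p (v n p) ≤ C) :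
    ∀ᵐ p, p ∈ S → p.1 ∉ Ω → v' p = 0 := by
  set S' := S ∩ {p | p.1 ∉ Ω} with hS'
  have mS' : MeasurableSet S' := hS.inter (hΩ.measurableSet.compl.preimage measurable_fst)
  have hle : ∀ n, ∀ p ∈ S', n * v' p ≤ Fn Ω g n p (v n p) := by
    intro n p hp
    unfold Fn
    rw [indicator_of_mem (show p.1 ∈ Ωᶜ from hp.2), max_eq_left (hvn n p), one_mul]
    have := gn_nonneg hg n (v n p)
    have := mul_le_mul_of_nonneg_left (hv' n p) (Nat.cast_nonneg (α := ℝ) n)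
    linarith
  have i1 : IntegrableOn v' S' := by
    refine Integrable.mono' ((h 1).1.mono_set inter_subset_left) hv'm.restrict ((ae_restrict_iff' mS').mpr (Eventually.of_forall fun p hp => ?_))
    rw [Real.norm_of_nonneg (hv'0 p)]
    have := hle 1 p hp
    simpa using this
  have hb : ∀ n : ℕ, n * ∫ p in S', v' p ≤ C := by
    intro n
    rw [← integral_const_mul]
    refine (setIntegral_mono_on (i1.const_mul _) ((h n).1.mono_set inter_subset_left) mS' (hle n)).trans ?_
    refine (setIntegral_mono_set (h n).1 (Eventually.of_forall fun p => Fn_nonneg Ω hg n p _) (Eventually.of_forall fun p hp => hp.1)).trans (h n).2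
  have h0 : ∫ p in S', v' p = 0 := by
    have p0 : 0 ≤ ∫ p in S', v' p := integral_nonneg hv'0
    by_contra hne
    have hp : 0 < ∫ p in S', v' p := lt_of_le_of_ne p0 (Ne.symm hne)
    obtain ⟨n, hn⟩ := exists_nat_gt (C / ∫ p in S', v' p)
    rw [div_lt_iff₀ hp] at hn
    linarith [hb n]
  rw [integral_eq_zero_iff_of_nonneg hv'0 i1] at h0
  have := (ae_restrict_iff' mS').mp h0
  filter_upwards [this] with p hp h1 h2
  exact hp ⟨h1, h2⟩

theorem W_open {N : ℕ} {ζ : Euc N → ℝ → ℝ} (hζ : C21 ζ) (T ε : ℝ) : IsOpen {x | ∀ t ∈ Icc (0:ℝ) T, |ζ x t| < ε} := by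
  rw [isOpen_iff_eventually]
  intro x hx
  refine isCompact_Icc.eventually_forall_of_forall_eventually (P := fun x t => |ζ x t| < ε) fun t ht => ?_
  exact hζ.cont.abs.continuousAt.eventually (gt_mem_nhds (hx t ht))

open scoped Manifold in
theorem exists_chi {N : ℕ} {K V : Set (Euc N)} (hK : IsClosed K) (hV : IsOpen V) (hKV : K ⊆ V) :
    ∃ χ : Euc N → ℝ, ContDiff ℝ 3 χ ∧ (∀ x ∈ K, χ =ᶠ[𝓝 x] fun _ => 1) ∧ (∀ x ∉ V, χ x = 0) ∧ (∀ x, 0 ≤ χ x) ∧ ∀ x, χ x ≤ 1 := by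
  obtain ⟨f, h1, h2, h3⟩ := exists_contMDiffMap_one_nhds_of_subset_interior 𝓘(ℝ, Euc N) (n := 3) hK (hKV.trans hV.interior_eq.ge)
  refine ⟨f, f.contMDiff.contDiff, fun x hx => ?_, h2, fun x => (h3 x).1, fun x => (h3 x).2⟩
  exact h1.filter_mono (nhds_le_nhdsSet hx)



theorem lap_mul_const' {N : ℕ} {ζ : Euc N → ℝ → ℝ} (h : C21 ζ) (t c : ℝ) (x : Euc N) :
    lap (fun y => ζ y t * c) x = lap (fun y => ζ y t) x * c := by
  unfold lap
  rw [Finset.sum_mul]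
  refine Finset.sum_congr rfl fun i _ => ?_
  have e : (fun y => fderiv ℝ (fun y => ζ y t * c) y (EuclideanSpace.single i 1)) = fun y => (fderiv ℝ (fun y => ζ y t) y (EuclideanSpace.single i 1)) * c := by
    ext y
    rw [fderiv_mul_const (h.2.2.2.1 t y)]
    simp [mul_comm]
  rw [e, fderiv_mul_const ((h.2.2.2.2.2.1 t x).clm_apply (differentiableAt_const _))]
  simp [mul_comm]

theorem C21_time {N : ℕ} {b : ℝ → ℝ} (hb : ContDiff ℝ 3 b) : C21 (fun (_ : Euc N) t => b t) :=
  C21_of_contDiff (f := fun p : Euc N × ℝ => b p.2) (hb.comp contDiff_snd)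

theorem C21_space {N : ℕ} {b : Euc N → ℝ} (hb : ContDiff ℝ 3 b) : C21 (fun x (_ : ℝ) => b x) :=
  C21_of_contDiff (f := fun p : Euc N × ℝ => b p.1) (hb.comp contDiff_fst)

theorem heatAdj_time {N : ℕ} {ζ : Euc N → ℝ → ℝ} (h : C21 ζ) {b : ℝ → ℝ} (hb : ContDiff ℝ 3 b) (p : Euc N × ℝ) :
    heatAdj (fun x t => ζ x t * b t) p = ζ p.1 p.2 * deriv b p.2 + heatAdj ζ p * b p.2 := by
  unfold heatAdj
  rw [lap_mul_const' h]
  have := deriv_fun_mul (h.2.1 p.1 p.2) ((hb.differentiable (by norm_num)) p.2)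
  rw [this]; ring

theorem core {N : ℕ} {Ω : Set (Euc N)} (hΩ : IsOpen Ω) (hbd : Bornology.IsBounded Ω) {T : ℝ} (hT : 0 < T)
    {g : ℝ → ℝ} (hg : GoodG g) {ν : Measure (Euc N)} [IsFiniteMeasure ν] (hνΩ : ν Ωᶜ = 0)
    {v : ℕ → Euc N × ℝ → ℝ} (hvm : ∀ n, AEStronglyMeasurable (v n)) (hv0 : ∀ n p, p.2 ≤ 0 → v n p = 0) (hvn : ∀ n p, 0 ≤ v n p)
    (hvV : ∀ n p, v n p ≤ pot ν p) 
    (hv : ∀ n, ∀ ζ : Euc N → ℝ → ℝ, C21 ζ → HasCompactSupport (fun q : Euc N × ℝ => ζ q.1 q.2) →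
        Integrable (fun p => v n p * heatAdj ζ p) ∧ Integrable (fun p => Fn Ω g n p (v n p) * ζ p.1 p.2) ∧ 
        ∫ p, (-(v n p * heatAdj ζ p) + Fn Ω g n p (v n p) * ζ p.1 p.2) = ∫ y, ζ y 0 ∂ν) {v' : Euc N × ℝ → ℝ}
    (hlim : ∀ p, Tendsto (fun n => v n p) atTop (𝓝 (v' p))) (hv' : ∀ n p, v' p ≤ v n p)
    (hi : ∀ n, Integrable (fun p => gn g n (v n p)) (volume.restrict (QT Ω T)))
    (hgi : Integrable (fun p => g (v' p)) (volume.restrict (QT Ω T)))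
    (hL1 : Tendsto (fun n => ∫ p in QT Ω T, |gn g n (v n p) - g (v' p)|) atTop (𝓝 0))
    {ζ : Euc N → ℝ → ℝ} (hζ : TestZero Ω T ζ) {h : ℝ} (hh : 0 < h) (hhT : 2 * h < T) :
    -(∫ p in QT Ω T, v' p * heatAdj (fun x t => ζ x t * th (T-2*h) (T-h) t) p) + 
      ∫ p in QT Ω T, g (v' p) * (ζ p.1 p.2 * th (T-2*h) (T-h) p.2) = ∫ x, ζ x 0 ∂ν := by
  have hv'0 : ∀ p, 0 ≤ v' p := fun p => ge_of_tendsto' (hlim p) fun n => hvn n p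
  have hv'm : AEStronglyMeasurable v' := aestronglyMeasurable_of_tendsto_ae atTop hvm (Eventually.of_forall hlim)
  have hv't : ∀ p : Euc N × ℝ, p.2 ≤ 0 → v' p = 0 := fun p hp => le_antisymm ((hv' 0 p).trans (hv0 0 p hp).le) (hv'0 p)
  have mQ : MeasurableSet (QT Ω T) := hΩ.measurableSet.prod measurableSet_Ioo
  obtain ⟨R, hR⟩ : ∃ R, closure Ω ⊆ Metric.ball 0 R := hbd.closure.subset_ball 0
  obtain ⟨C, hC0, hC⟩ := star_bd hΩ T R hg hvm hvn hvV hv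
  have mS : MeasurableSet ((Metric.closedBall (0 : Euc N) R) ×ˢ Icc (0:ℝ) T) := Metric.isClosed_closedBall.measurableSet.prod measurableSet_Icc
  have hvz := v_zero hΩ mS hg hvn hv'm hv'0 hv' hC
  have hab : T - 2*h < T - h := by linarith
  set θ := th (T-2*h) (T-h) with hθ
  have hθc : ContDiff ℝ 3 θ := th_cd _ _
  set η0 : Euc N → ℝ → ℝ := fun x t => ζ x t * θ t with hη0
  have cη0 : C21 η0 := hζ.1.mul (C21_time hθc)
  obtain ⟨M, hM⟩ : ∃ M, ∀ p ∈ QT Ω T, ‖η0 p.1 p.2‖ ≤ M := by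
    have hcomp : IsCompact (closure Ω ×ˢ Icc (0:ℝ) T) := hbd.isCompact_closure.prod isCompact_Icc
    obtain ⟨M, hM⟩ := hcomp.exists_bound_of_continuousOn cη0.cont.continuousOn
    exact ⟨M, fun p hp => hM p ⟨subset_closure hp.1, hp.2.1.le, hp.2.2.le⟩⟩
  -- limit of the good part
  have hG : Tendsto (fun n => ∫ p in QT Ω T, gn g n (v n p) * η0 p.1 p.2) atTop (𝓝 (∫ p in QT Ω T, g (v' p) * η0 p.1 p.2)) := by
    have hbm : ∀ᵐ p ∂(volume.restrict (QT Ω T)), ‖η0 p.1 p.2‖ ≤ M := (ae_restrict_iff' mQ).mpr (Eventually.of_forall hM)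
    have hηm : AEStronglyMeasurable (fun p : Euc N × ℝ => η0 p.1 p.2) (volume.restrict (QT Ω T)) := cη0.cont.aestronglyMeasurable
    have j1 : ∀ n, Integrable (fun p => gn g n (v n p) * η0 p.1 p.2) (volume.restrict (QT Ω T)) := fun n => (hi n).mul_bdd (c := M) hηm hbm
    have j2 : Integrable (fun p => g (v' p) * η0 p.1 p.2) (volume.restrict (QT Ω T)) := hgi.mul_bdd (c := M) hηm hbm
    rw [tendsto_iff_norm_sub_tendsto_zero]
    have hM' := hL1.const_mul M
    rw [mul_zero] at hM'
    refine squeeze_zero (fun n => norm_nonneg _) (fun n => ?_) hM'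
    rw [← integral_sub (j1 n) j2, ← integral_const_mul]
    refine norm_integral_le_of_norm_le (((hi n).sub hgi).abs.const_mul M) ?_
    filter_upwards [hbm] with p hp
    rw [← sub_mul, norm_mul, mul_comm]
    exact mul_le_mul_of_nonneg_right hp (norm_nonneg _)
  -- error estimate
  have key : ∀ ε > 0, |-(∫ p in QT Ω T, v' p * heatAdj η0 p) + (∫ p in QT Ω T, g (v' p) * η0 p.1 p.2) - ∫ x, ζ x 0 ∂ν| ≤ ε * C := by
    intro ε hε
    set W := {x | ∀ t ∈ Icc (0:ℝ) T, |ζ x t| < ε} with hW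
    have oW : IsOpen W := W_open hζ.1 T ε
    have hcov : closure Ω ⊆ (Ω ∪ W) ∩ Metric.ball 0 R := by
      refine subset_inter (fun x hx => ?_) hR
      by_cases hx1 : x ∈ Ω
      · exact Or.inl hx1
      · right
        intro t ht
        rw [hζ.2.1 x (by rw [hΩ.frontier_eq]; exact ⟨hx, hx1⟩) t ht, abs_zero]
        exact hε
    obtain ⟨χ, hχc, hχ1, hχ0, hχn, hχl⟩ := exists_chi isClosed_closure ((hΩ.union oW).inter Metric.isOpen_ball) hcov
    have hχΩ : ∀ x ∈ Ω, χ x = 1 := fun x hx => (hχ1 x (subset_closure hx)).self_of_nhds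
    set η : Euc N → ℝ → ℝ := fun x t => η0 x t * χ x with hη
    have cη : C21 η := cη0.mul (C21_space hχc)
    have hsupp : Function.support (fun q : Euc N × ℝ => η q.1 q.2) ⊆ Metric.closedBall 0 R ×ˢ Icc (-2) (T-h) := by
      intro p hp
      refine ⟨?_, ?_⟩
      · by_contra hc
        refine hp ?_
        have : χ p.1 = 0 := hχ0 _ fun h => hc (Metric.ball_subset_closedBall h.2)
        simp [hη, this]
      · by_contra hc
        refine hp ?_
        have : θ p.2 = 0 := th_supp hab hc
        simp [hη, hη0, this]
    have hKc : IsCompact ((Metric.closedBall (0 : Euc N) R) ×ˢ Icc (-2:ℝ) (T-h)) := (isCompact_closedBall _ _).prod isCompact_Icc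
    have cs : HasCompactSupport (fun q : Euc N × ℝ => η q.1 q.2) := HasCompactSupport.of_support_subset_isCompact hKc hsupp
    have hts : tsupport (fun q : Euc N × ℝ => η q.1 q.2) ⊆ Metric.closedBall 0 R ×ˢ Icc (-2) (T-h) := closure_minimal hsupp hKc.isClosed
    have hA0 : ∀ p, p ∉ (Metric.closedBall (0 : Euc N) R) ×ˢ Icc (-2:ℝ) (T-h) → heatAdj η p = 0 := fun p hp => heatAdj_zero_of fun h => hp (hts h)
    -- rhs
    have hrhs : ∫ y, η y 0 ∂ν = ∫ x, ζ x 0 ∂ν := by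
      refine integral_congr_ae ?_
      have : ∀ᵐ y ∂ν, y ∈ Ω := hνΩ
      filter_upwards [this] with y hy
      simp only [hη, hη0]
      rw [hχΩ y hy, hθ, th_one hab (by norm_num) (by linarith)]; simp
    -- v part limit
    have hVl : Tendsto (fun n => ∫ p, v n p * heatAdj η p) atTop (𝓝 (∫ p, v' p * heatAdj η p)) := by
      have iV : Integrable (fun p => pot ν p * |heatAdj η p|) :=
        pot_mul_int ν cη.heatAdj_cont.abs (HasCompactSupport.comp_left (heatAdj_compact cs) abs_zero)
      refine tendsto_integral_of_dominated_convergence _ (fun n => (hvm n).mul cη.heatAdj_cont.aestronglyMeasurable) iV (fun n => Eventually.of_forall fun p => ?_) (Eventually.of_forall fun p => (hlim p).mul_const _)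
      rw [norm_mul, Real.norm_of_nonneg (hvn n p), Real.norm_eq_abs]
      exact mul_le_mul_of_nonneg_right (hvV n p) (abs_nonneg _)
    have hVe : ∫ p, v' p * heatAdj η p = ∫ p in QT Ω T, v' p * heatAdj η0 p := by
      rw [← integral_indicator mQ]
      refine integral_congr_ae ?_
      filter_upwards [hvz] with p hp
      by_cases hq : p ∈ QT Ω T
      · rw [indicator_of_mem hq]
        congr 1
        refine heatAdj_congr ?_
        have := (hχ1 p.1 (subset_closure hq.1))
        filter_upwards [(continuous_fst.tendsto p).eventually this] with q hq
        simp only [hη]; rw [hq, mul_one]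
      · rw [indicator_of_notMem hq]
        rcases le_or_gt p.2 0 with ht | ht
        · rw [hv't p ht, zero_mul]
        by_cases hk : p ∈ (Metric.closedBall (0 : Euc N) R) ×ˢ Icc (-2:ℝ) (T-h)
        · have hx : p.1 ∉ Ω := fun hx => hq ⟨hx, ht, by linarith [hk.2.2]⟩
          rw [hp ⟨hk.1, ht.le, by linarith [hk.2.2]⟩ hx, zero_mul]
        · rw [hA0 p hk, mul_zero]
    -- per n
    have hn : ∀ n, |-(∫ p, v n p * heatAdj η p) + (∫ p in QT Ω T, gn g n (v n p) * η0 p.1 p.2) - ∫ x, ζ x 0 ∂ν| ≤ ε * C := by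
      intro n
      obtain ⟨a1, a2, a3⟩ := hv n η cη cs
      have a1' : Integrable (fun p => -(v n p * heatAdj η p)) := a1.neg
      rw [integral_add a1' a2, integral_neg, hrhs, ← integral_add_compl mQ a2] at a3
      have e1 : ∫ p in QT Ω T, Fn Ω g n p (v n p) * η p.1 p.2 = ∫ p in QT Ω T, gn g n (v n p) * η0 p.1 p.2 := by
        refine setIntegral_congr_fun mQ fun p hp => ?_
        simp only [hη]
        unfold Fn
        rw [indicator_of_notMem (show p.1 ∉ Ωᶜ from fun h => h hp.1), hχΩ _ hp.1]; ring
      have e2 : |∫ p in (QT Ω T)ᶜ, Fn Ω g n p (v n p) * η p.1 p.2| ≤ ε * C := by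
        have b0 : Integrable (fun p => ε * ((Metric.closedBall (0 : Euc N) R) ×ˢ Icc (0:ℝ) T).indicator (fun p => Fn Ω g n p (v n p)) p) :=
          ((hC n).1.integrable_indicator mS).const_mul ε
        have b1 : ‖∫ p in (QT Ω T)ᶜ, Fn Ω g n p (v n p) * η p.1 p.2‖ ≤ ∫ p in (QT Ω T)ᶜ, ε * ((Metric.closedBall (0 : Euc N) R) ×ˢ Icc (0:ℝ) T).indicator (fun p => Fn Ω g n p (v n p)) p := by
          refine norm_integral_le_of_norm_le b0.integrableOn ((ae_restrict_iff' mQ.compl).mpr (Eventually.of_forall fun p hp => ?_))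
          have F0 := Fn_nonneg Ω hg n p (v n p)
          have R0 : 0 ≤ ε * ((Metric.closedBall (0 : Euc N) R) ×ˢ Icc (0:ℝ) T).indicator (fun p => Fn Ω g n p (v n p)) p :=
            mul_nonneg hε.le (indicator_nonneg (fun q _ => Fn_nonneg Ω hg n q _) p)
          rw [norm_mul, Real.norm_of_nonneg F0]
          rcases le_or_gt p.2 0 with ht | ht
          · rw [Fn_zero Ω hg n p (hv0 n p ht).le, zero_mul]; exact R0
          by_cases hz : η p.1 p.2 = 0
          · rw [hz, norm_zero, mul_zero]; exact R0
          have hk := hsupp hz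
          have hx : p.1 ∉ Ω := fun hx => hp ⟨hx, ht, by linarith [hk.2.2]⟩
          have hxW : p.1 ∈ W := by
            by_contra hw
            refine hz ?_
            have : χ p.1 = 0 := hχ0 _ fun h => h.1.elim hx hw
            simp only [hη]; rw [this, mul_zero]
          have tT : p.2 ≤ T := by linarith [hk.2.2]
          rw [indicator_of_mem (show p ∈ (Metric.closedBall (0 : Euc N) R) ×ˢ Icc (0:ℝ) T from ⟨hk.1, ht.le, tT⟩), mul_comm]
          refine mul_le_mul_of_nonneg_right ?_ F0
          simp only [hη, hη0]
          have z1 : |ζ p.1 p.2| ≤ ε := (hxW p.2 ⟨ht.le, tT⟩).le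
          rw [norm_mul, norm_mul, Real.norm_of_nonneg (hχn _), Real.norm_of_nonneg (th_nn _ _ _), Real.norm_eq_abs]
          calc |ζ p.1 p.2| * θ p.2 * χ p.1 ≤ |ζ p.1 p.2| * θ p.2 * 1 := mul_le_mul_of_nonneg_left (hχl _) (mul_nonneg (abs_nonneg _) (th_nn _ _ _))
            _ ≤ |ζ p.1 p.2| * 1 := by rw [mul_one]; exact mul_le_mul_of_nonneg_left (th_le _ _ _) (abs_nonneg _)
            _ ≤ ε := by rw [mul_one]; exact z1
        have b2 : ∫ p in (QT Ω T)ᶜ, ε * ((Metric.closedBall (0 : Euc N) R) ×ˢ Icc (0:ℝ) T).indicator (fun p => Fn Ω g n p (v n p)) p ≤ ε * ∫ p in (Metric.closedBall (0 : Euc N) R) ×ˢ Icc (0:ℝ) T, Fn Ω g n p (v n p) := by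
          rw [← integral_indicator mS, ← integral_const_mul]
          exact setIntegral_le_integral (s := (QT Ω T)ᶜ) b0 (Eventually.of_forall fun p => mul_nonneg hε.le (indicator_nonneg (fun q _ => Fn_nonneg Ω hg n q _) p))
        have b3 := mul_le_mul_of_nonneg_left (hC n).2 hε.le
        exact b1.trans (b2.trans b3)
      rw [e1] at a3
      have : -(∫ p, v n p * heatAdj η p) + (∫ p in QT Ω T, gn g n (v n p) * η0 p.1 p.2) - ∫ x, ζ x 0 ∂ν = -(∫ p in (QT Ω T)ᶜ, Fn Ω g n p (v n p) * η p.1 p.2) := by linarith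
      rw [this, abs_neg]; exact e2
    rw [hVe] at hVl
    exact le_of_tendsto' ((hVl.neg.add hG).sub_const _).abs hn
  have : |-(∫ p in QT Ω T, v' p * heatAdj η0 p) + (∫ p in QT Ω T, g (v' p) * η0 p.1 p.2) - ∫ x, ζ x 0 ∂ν| ≤ 0 := by
    refine le_of_forall_pos_le_add fun e he => ?_
    rw [zero_add]
    refine (key (e/(C+1)) (by positivity)).trans ?_
    rw [div_mul_eq_mul_div, div_le_iff₀ (by positivity)]
    nlinarith
  have := abs_nonpos_iff.mp this
  linarith



theorem h_limit {N : ℕ} {Ω : Set (Euc N)} (hΩ : IsOpen Ω) (hbd : Bornology.IsBounded Ω) {T : ℝ} (hT : 0 < T)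
    {g : ℝ → ℝ} {v' : Euc N × ℝ → ℝ} {L : ℝ}
    (hvi : Integrable v' (volume.restrict (QT Ω T)))
    (hgi : Integrable (fun p => g (v' p)) (volume.restrict (QT Ω T)))
    {ζ : Euc N → ℝ → ℝ} (hζ : TestZero Ω T ζ)
    (hc : ∀ h : ℝ, 0 < h → 2 * h < T → -(∫ p in QT Ω T, v' p * heatAdj (fun x t => ζ x t * th (T-2*h) (T-h) t) p) + 
      ∫ p in QT Ω T, g (v' p) * (ζ p.1 p.2 * th (T-2*h) (T-h) p.2) = L) :
    ∫ p in QT Ω T, (-(v' p) * deriv (ζ p.1) p.2 - v' p * lap (fun y => ζ y p.2) p.1 + ζ p.1 p.2 * g (v' p)) = L := by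
  have mQ : MeasurableSet (QT Ω T) := hΩ.measurableSet.prod measurableSet_Ioo
  have hcomp : IsCompact (closure Ω ×ˢ Icc (0:ℝ) T) := hbd.isCompact_closure.prod isCompact_Icc
  have hsub : QT Ω T ⊆ closure Ω ×ˢ Icc (0:ℝ) T := fun p hp => ⟨subset_closure hp.1, hp.2.1.le, hp.2.2.le⟩
  obtain ⟨M1, hM1⟩ := hcomp.exists_bound_of_continuousOn hζ.1.cont.continuousOn
  obtain ⟨M2, hM2⟩ := hcomp.exists_bound_of_continuousOn hζ.1.heatAdj_cont.continuousOn
  obtain ⟨M3, hM3⟩ := hcomp.exists_bound_of_continuousOn hζ.1.2.2.1.continuousOn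
  obtain ⟨K, hK0, hK⟩ := th_deriv_bd
  have hz : ∀ p ∈ QT Ω T, |ζ p.1 p.2| ≤ M3 * (T - p.2) := by
    intro p hp
    have := Convex.norm_image_sub_le_of_norm_deriv_le (f := ζ p.1) (s := Icc 0 T) (C := M3) (fun t _ => hζ.1.2.1 p.1 t)
      (fun t ht => hM3 (p.1, t) ⟨subset_closure hp.1, ht⟩) (convex_Icc 0 T) (x := p.2) (y := T) ⟨hp.2.1.le, hp.2.2.le⟩ ⟨hT.le, le_rfl⟩
    rw [hζ.2.2 p.1 (subset_closure hp.1), zero_sub, norm_neg, Real.norm_eq_abs, Real.norm_of_nonneg (by linarith [hp.2.2])] at this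
    exact this
  -- sequence
  set s : ℕ → ℝ := fun k => T / (3 * ((k:ℝ)+1)) with hs
  have hs0 : ∀ k, 0 < s k := fun k => by positivity
  have hsT : ∀ k, 2 * s k < T := fun k => by
    have k0 : (0:ℝ) ≤ k := Nat.cast_nonneg k
    simp only [hs]
    rw [← mul_div_assoc, div_lt_iff₀ (by positivity)]
    nlinarith
  have hsl : Tendsto s atTop (𝓝 0) := by
    have : Tendsto (fun k : ℕ => (T/3) * (1 / ((k:ℝ)+1))) atTop (𝓝 ((T/3) * 0)) := tendsto_one_div_add_atTop_nhds_zero_nat.const_mul _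
    rw [mul_zero] at this
    refine this.congr fun k => ?_
    simp only [hs]; field_simp
  have hthd : ∀ k, ∀ p ∈ QT Ω T, |ζ p.1 p.2 * deriv (th (T - 2 * s k) (T - s k)) p.2| ≤ 2 * M3 * K := by
    intro k p hp
    have s0 := hs0 k
    have M30 : 0 ≤ M3 := (norm_nonneg _).trans (hM3 p (hsub hp))
    rcases lt_or_ge p.2 (T - 2 * s k) with ht | ht
    · rw [th_deriv_zero (by linarith) (by linarith [hp.2.1]) (Or.inl ht), mul_zero, abs_zero]; positivity
    · rw [abs_mul]
      have a1 := hz p hp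
      have a2 := hK (T - 2 * s k) (T - s k) p.2 (by linarith) (by linarith [hp.2.1])
      rw [show T - s k - (T - 2 * s k) = s k by ring] at a2
      have a3 : |ζ p.1 p.2| ≤ M3 * (2 * s k) := a1.trans (mul_le_mul_of_nonneg_left (by linarith) M30)
      calc _ ≤ (M3 * (2 * s k)) * (K / s k) := mul_le_mul a3 a2 (abs_nonneg _) (by positivity)
        _ = 2 * M3 * K := by field_simp
  have key1 : Tendsto (fun k => ∫ p in QT Ω T, v' p * heatAdj (fun x t => ζ x t * th (T - 2 * s k) (T - s k) t) p) atTop (𝓝 (∫ p in QT Ω T, v' p * heatAdj ζ p)) := by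
    refine tendsto_integral_of_dominated_convergence (fun p => |v' p| * (2 * M3 * K + M2)) (fun k => ?_) (hvi.abs.mul_const _) (fun k => ?_) ?_
    · exact hvi.aestronglyMeasurable.mul (hζ.1.mul (C21_time (th_cd _ _))).heatAdj_cont.aestronglyMeasurable
    · refine (ae_restrict_iff' mQ).mpr (Eventually.of_forall fun p hp => ?_)
      rw [heatAdj_time hζ.1 (th_cd _ _), norm_mul, Real.norm_eq_abs]
      refine mul_le_mul_of_nonneg_left ((norm_add_le _ _).trans (add_le_add (hthd k p hp) ?_)) (abs_nonneg _)
      rw [norm_mul, Real.norm_of_nonneg (th_nn _ _ _)]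
      exact (mul_le_of_le_one_right (norm_nonneg _) (th_le _ _ _)).trans (hM2 p (hsub hp))
    · refine (ae_restrict_iff' mQ).mpr (Eventually.of_forall fun p hp => ?_)
      refine tendsto_const_nhds.congr' ?_
      have hpos : 0 < (T - p.2) / 2 := by linarith [hp.2.2]
      filter_upwards [hsl.eventually (gt_mem_nhds hpos)] with k hk
      have s0 := hs0 k
      rw [heatAdj_time hζ.1 (th_cd _ _), th_deriv_zero (by linarith) (by linarith [hp.2.1]) (Or.inl (by linarith)), th_one (by linarith) (by linarith [hp.2.1]) (by linarith)]
      ring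
  have key2 : Tendsto (fun k => ∫ p in QT Ω T, g (v' p) * (ζ p.1 p.2 * th (T - 2 * s k) (T - s k) p.2)) atTop (𝓝 (∫ p in QT Ω T, g (v' p) * ζ p.1 p.2)) := by
    refine tendsto_integral_of_dominated_convergence (fun p => |g (v' p)| * M1) (fun k => ?_) (hgi.abs.mul_const _) (fun k => ?_) ?_
    · exact hgi.aestronglyMeasurable.mul (hζ.1.mul (C21_time (th_cd _ _))).cont.aestronglyMeasurable
    · refine (ae_restrict_iff' mQ).mpr (Eventually.of_forall fun p hp => ?_)
      rw [norm_mul, Real.norm_eq_abs]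
      refine mul_le_mul_of_nonneg_left ?_ (abs_nonneg _)
      rw [norm_mul, Real.norm_of_nonneg (th_nn _ _ _)]
      exact (mul_le_of_le_one_right (norm_nonneg _) (th_le _ _ _)).trans (hM1 p (hsub hp))
    · refine (ae_restrict_iff' mQ).mpr (Eventually.of_forall fun p hp => ?_)
      refine tendsto_const_nhds.congr' ?_
      have hpos : 0 < (T - p.2) / 2 := by linarith [hp.2.2]
      filter_upwards [hsl.eventually (gt_mem_nhds hpos)] with k hk
      have s0 := hs0 k
      rw [th_one (by linarith) (by linarith [hp.2.1]) (by linarith)]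
      ring
  have hfin := tendsto_nhds_unique ((key1.neg.add key2).congr fun k => hc (s k) (hs0 k) (hsT k)) tendsto_const_nhds
  have i1 : Integrable (fun p => v' p * heatAdj ζ p) (volume.restrict (QT Ω T)) :=
    hvi.mul_bdd (c := M2) hζ.1.heatAdj_cont.aestronglyMeasurable ((ae_restrict_iff' mQ).mpr (Eventually.of_forall fun p hp => hM2 p (hsub hp)))
  have i2 : Integrable (fun p => g (v' p) * ζ p.1 p.2) (volume.restrict (QT Ω T)) :=
    hgi.mul_bdd (c := M1) hζ.1.cont.aestronglyMeasurable ((ae_restrict_iff' mQ).mpr (Eventually.of_forall fun p hp => hM1 p (hsub hp)))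
  have i1' : Integrable (fun p => -(v' p * heatAdj ζ p)) (volume.restrict (QT Ω T)) := i1.neg
  rw [← hfin, ← integral_neg, ← integral_add i1' i2]
  congr 1; ext p
  unfold heatAdj; ring

theorem local_good {N : ℕ} {Ω : Set (Euc N)} (hΩ : IsOpen Ω) (hb : Bornology.IsBounded Ω) (hne : Ωᶜ.Nonempty) {T : ℝ} (hT : 0 < T)
    {g : ℝ → ℝ} (hg : GoodG g) {σ ν : Measure (Euc N)} [IsFiniteMeasure ν] (hσ : MemM1 Ω σ) (hu : GoodMeasure Ω T g σ)
    (hνσ : ν ≤ σ) {x0 : Euc N} {r : ℝ} (hr : 0 < r) (hνs : ν (Metric.closedBall x0 r)ᶜ = 0) (hball : Metric.closedBall x0 (4*r) ⊆ Ω) :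
    GoodMeasure Ω T g ν := by
  obtain ⟨u, hu⟩ := hu
  obtain ⟨v, hvm, hv0, hvn, hvV, hva, hv⟩ := exists_seq ν hΩ hg
  have hlim : ∀ p, Tendsto (fun n => v n p) atTop (𝓝 (⨅ n, v n p)) := fun p =>
    tendsto_atTop_ciInf (hva p) ⟨0, by rintro _ ⟨n, rfl⟩; exact hvn n p⟩
  set v' : Euc N × ℝ → ℝ := fun p => ⨅ n, v n p with hv'd
  have hv' : ∀ n p, v' p ≤ v n p := fun n p => ciInf_le ⟨0, by rintro _ ⟨n, rfl⟩; exact hvn n p⟩ n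
  have hv'0 : ∀ p, 0 ≤ v' p := fun p => le_ciInf fun n => hvn n p
  obtain ⟨hi, hgi, hL1⟩ := main_L1 hΩ hb hne hT hg hσ hu hνσ hr hνs hball hvm hv0 hvn hvV hv hlim
  have hv'm : AEStronglyMeasurable v' := aestronglyMeasurable_of_tendsto_ae atTop hvm (Eventually.of_forall hlim)
  have mQ : MeasurableSet (QT Ω T) := hΩ.measurableSet.prod measurableSet_Ioo
  have hVT : IntegrableOn (pot ν) {p : Euc N × ℝ | p.2 < T} := slab_integrable one_pos (pot_integrable ν one_pos) T
  have hvi : IntegrableOn v' (QT Ω T) := by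
    refine Integrable.mono' (hVT.mono_set fun p hp => hp.2.2) hv'm.restrict (Eventually.of_forall fun p => ?_)
    rw [Real.norm_of_nonneg (hv'0 p)]
    exact (hv' 0 p).trans (hvV 0 p)
  have hνΩ : ν Ωᶜ = 0 := measure_mono_null (compl_subset_compl.mpr ((Metric.closedBall_subset_closedBall (by linarith)).trans hball)) hνs
  refine ⟨v', hvi, ?_, fun ζ hζ => ?_⟩
  · obtain ⟨M, hM⟩ := hb.isCompact_closure.exists_bound_of_continuousOn (f := rho Ω) (Metric.continuous_infDist_pt _).continuousOn
    exact hgi.mul_bdd (c := M) ((Metric.continuous_infDist_pt _).comp continuous_fst).aestronglyMeasurable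
      ((ae_restrict_iff' mQ).mpr (Eventually.of_forall fun p hp => hM p.1 (subset_closure hp.1)))
  · exact h_limit hΩ hb hT hvi hgi hζ fun h h0 h1 => core hΩ hb hT hg hνΩ hvm hv0 hvn hvV hv hlim hv' hi hgi hL1 hζ h0 h1



theorem half {N : ℕ} {Ω : Set (Euc N)} (hΩ : IsOpen Ω) (hb : Bornology.IsBounded Ω) (hne : Ωᶜ.Nonempty) {T : ℝ} (hT : 0 < T)
    {g : ℝ → ℝ} (hg : GoodG g) {σ μ₁ μ₂ μs : Measure (Euc N)} (hσ : MemM1 Ω σ) (hu : GoodMeasure Ω T g σ) (hle : σ ≤ μ₁ + μ₂)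
    (hred : IsReducedMeasure Ω T g μ₁ μs) {A : Set (Euc N)} (hA : MeasurableSet A) (h2 : μ₂ A = 0) :
    σ.restrict A ≤ μs := by
  have hloc : ∀ x ∈ Ω, ∃ r : ℝ, 0 < r ∧ Metric.closedBall x (4*r) ⊆ Ω := by
    intro x hx
    obtain ⟨e, he, h⟩ := Metric.nhds_basis_closedBall.mem_iff.mp (hΩ.mem_nhds hx)
    exact ⟨e/4, by linarith, by rwa [show 4 * (e/4) = e by ring]⟩
  choose! r hr hball using hloc
  obtain ⟨t, htΩ, htc, ht⟩ := TopologicalSpace.countable_cover_nhdsWithin (s := Ω) (f := fun x => Metric.closedBall x (r x))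
    (fun x hx => mem_nhdsWithin_of_mem_nhds (Metric.closedBall_mem_nhds x (hr x hx)))
  have hsmall : ∀ x ∈ Ω, σ.restrict (A ∩ Metric.closedBall x (r x)) ≤ μs := by
    intro x hx
    have hBΩ : Metric.closedBall x (r x) ⊆ Ω := (Metric.closedBall_subset_closedBall (by linarith [hr x hx])).trans (hball x hx)
    have hmB : MeasurableSet (Metric.closedBall x (r x)) := Metric.isClosed_closedBall.measurableSet
    have hfin : σ (A ∩ Metric.closedBall x (r x)) < ⊤ := (measure_mono inter_subset_right).trans_lt (hσ.2.1 _ hBΩ (isCompact_closedBall _ _))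
    have : IsFiniteMeasure (σ.restrict (A ∩ Metric.closedBall x (r x))) := ⟨by rwa [Measure.restrict_apply_univ]⟩
    have hls : σ.restrict (A ∩ Metric.closedBall x (r x)) ≤ σ := Measure.restrict_le_self
    refine hred.2.2.2 _ ⟨?_, fun K hK hKc => (hls K).trans_lt (hσ.2.1 K hK hKc), (lintegral_mono' hls le_rfl).trans_lt hσ.2.2⟩ ?_ ?_
    · exact le_antisymm ((hls _).trans hσ.1.le) bot_le
    · refine local_good hΩ hb hne hT hg hσ hu hls (hr x hx) ?_ (hball x hx)
      rw [Measure.restrict_apply hmB.compl]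
      refine measure_mono_null ?_ (measure_empty (μ := σ))
      rintro y ⟨h1, h2⟩
      exact h1 h2.2
    · refine Measure.le_iff.mpr fun s hs => ?_
      rw [Measure.restrict_apply hs]
      refine (hle _).trans ?_
      rw [Measure.add_apply, measure_mono_null (inter_subset_right.trans inter_subset_left) h2, add_zero]
      exact measure_mono inter_subset_left
  -- glue
  have key : ∀ n : ℕ → Euc N, (∀ i, n i ∈ Ω) → Ω ⊆ ⋃ i, Metric.closedBall (n i) (r (n i)) → σ.restrict A ≤ μs := by
    intro y hy hcov
    refine Measure.le_iff.mpr fun s hs => ?_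
    set B : ℕ → Set (Euc N) := fun i => Metric.closedBall (y i) (r (y i)) with hB
    have hBm : ∀ i, MeasurableSet (B i) := fun i => Metric.isClosed_closedBall.measurableSet
    have hDm : ∀ i, MeasurableSet (disjointed B i) := MeasurableSet.disjointed hBm
    rw [Measure.restrict_apply hs]
    have e1 : σ (s ∩ A) ≤ σ (⋃ i, s ∩ A ∩ disjointed B i) := by
      have : s ∩ A ⊆ (⋃ i, s ∩ A ∩ disjointed B i) ∪ Ωᶜ := by
        intro z hz
        by_cases hzΩ : z ∈ Ω
        · left
          rw [← inter_iUnion, iUnion_disjointed]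
          exact ⟨hz, hcov hzΩ⟩
        · exact Or.inr hzΩ
      refine (measure_mono this).trans ((measure_union_le _ _).trans ?_)
      rw [hσ.1, add_zero]
    refine e1.trans ((measure_iUnion_le _).trans ?_)
    calc ∑' i, σ (s ∩ A ∩ disjointed B i) ≤ ∑' i, μs (s ∩ disjointed B i) := by
          refine ENNReal.tsum_le_tsum fun i => ?_
          have := hsmall (y i) (hy i) (s ∩ disjointed B i)
          rw [Measure.restrict_apply (hs.inter (hDm i))] at this
          refine le_trans (measure_mono ?_) this
          rintro z ⟨⟨h1, h2⟩, h3⟩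
          exact ⟨⟨h1, h3⟩, h2, disjointed_le B i h3⟩
      _ = μs (⋃ i, s ∩ disjointed B i) := by
          rw [measure_iUnion (fun i j hij => ?_) (fun i => hs.inter (hDm i))]
          exact (disjoint_disjointed B hij).mono inter_subset_right inter_subset_right
      _ ≤ μs s := measure_mono (iUnion_subset fun i => inter_subset_left)
  rcases t.eq_empty_or_nonempty with h0 | h0
  · subst h0
    have hΩe : Ω = ∅ := by
      rw [← subset_empty_iff]; simpa using ht
    have : σ = 0 := by
      rw [← Measure.measure_univ_eq_zero]
      have := hσ.1
      rwa [hΩe, compl_empty] at this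
    rw [this, Measure.restrict_zero]; exact Measure.zero_le _
  · obtain ⟨y, rfl⟩ := htc.exists_eq_range h0
    refine key y (fun i => htΩ (mem_range_self i)) ?_
    rwa [biUnion_range] at ht

theorem compl_ne {N : ℕ} (hN : 1 ≤ N) {Ω : Set (Euc N)} (hb : Bornology.IsBounded Ω) : Ωᶜ.Nonempty := by
  have : Nonempty (Fin N) := ⟨⟨0, hN⟩⟩
  have : Nontrivial (Euc N) := inferInstance
  rw [nonempty_compl]
  rintro rfl
  exact NormedSpace.unbounded_univ ℝ (Euc N) hb

theorem MemM1.add_singular_le {N : ℕ} {σ μ ν μ' ν' : Measure (Euc N)} (h1 : μ' ≤ μ) (h2 : ν' ≤ ν) (hμ : μ' ≤ σ) (hν : ν' ≤ σ)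
    {A : Set (Euc N)} (hA : MeasurableSet A) (a1 : μ A = 0) (a2 : ν Aᶜ = 0) : μ' + ν' ≤ σ := by
  refine Measure.le_iff.mpr fun s hs => ?_
  have b1 : μ' A = 0 := le_antisymm ((h1 A).trans a1.le) bot_le
  have b2 : ν' Aᶜ = 0 := le_antisymm ((h2 _).trans a2.le) bot_le
  rw [Measure.add_apply, ← measure_inter_add_sdiff (μ := μ') s hA, ← measure_inter_add_sdiff (μ := ν') s hA, ← measure_inter_add_sdiff (μ := σ) s hA,
    measure_mono_null inter_subset_right b1, measure_mono_null (s := s \ A) (fun z hz => hz.2) b2, zero_add, add_zero, add_comm]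
  exact add_le_add (hν _) (hμ _)

/-- **Corollary 2.19 (3).** If `μ₁` and `μ₂` are mutually singular then
`(μ₁ + μ₂)* = μ₁* + μ₂*`. -/
theorem stmt_15 {N : ℕ} (hN : 1 ≤ N) (Ω : Set (Euc N)) (hΩo : IsOpen Ω)
    (hΩc : IsConnected Ω) (hΩb : Bornology.IsBounded Ω) (T : ℝ) (hT : 0 < T)
    (g : ℝ → ℝ) (hg : GoodG g) (μ₁ μ₂ μ₁star μ₂star σ : Measure (Euc N))
    (hμ₁ : MemM1 Ω μ₁) (hμ₂ : MemM1 Ω μ₂)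
    (hsing : μ₁ ⟂ₘ μ₂)
    (hred₁ : IsReducedMeasure Ω T g μ₁ μ₁star)
    (hred₂ : IsReducedMeasure Ω T g μ₂ μ₂star)
    (hred : IsReducedMeasure Ω T g (μ₁ + μ₂) σ) :
    σ = μ₁star + μ₂star := by
  have hne := compl_ne hN hΩb
  obtain ⟨A, hA, a1, a2⟩ := hsing
  obtain ⟨m1, l1, g1, x1⟩ := hred₁
  obtain ⟨m2, l2, g2, x2⟩ := hred₂
  obtain ⟨m, l, gs, x⟩ := hred
  refine le_antisymm ?_ ?_
  · have e1 := half hΩo hΩb hne hT hg m gs l ⟨m1, l1, g1, x1⟩ hA.compl a2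
    have e2 := half hΩo hΩb hne hT hg m gs (by rwa [add_comm] at l) ⟨m2, l2, g2, x2⟩ hA a1
    rw [← Measure.restrict_add_restrict_compl (μ := σ) hA, add_comm]
    exact add_le_add e1 e2
  · exact MemM1.add_singular_le l1 l2 (x _ m1 g1 (l1.trans (Measure.le_add_right le_rfl))) (x _ m2 g2 (l2.trans (Measure.le_add_left le_rfl))) hA a1 a2
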